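/- Assume 𝔤 is simple. Then Tor(Γ_𝔨) is isomorphic to one of the following abelian groups: a direct sum of copies of ℤ/2ℤ (possibly the trivial group), ℤ/3ℤ, ℤ/4ℤ, ℤ/5ℤ, ℤ/2ℤ ⊕ ℤ/3ℤ, ℤ/2ℤ ⊕ ℤ/4ℤ, or ℤ/3ℤ ⊕ ℤ/3ℤ. -/

import Mathlib

open LieAlgebra

section CombinatorialDefs

variable {V : Type*} [AddCommGroup V] [Module ℂ V]

/-- `P` is a closed symmetric subsystem of `Ω`: `P ⊆ Ω`, `P = -P`, and `P` is closed
under addition within `Ω`. -/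
def IsClosedSymmetricSubsystem (Ω P : Set V) : Prop :=
  P ⊆ Ω ∧ (∀ a ∈ P, -a ∈ P) ∧ ∀ a ∈ P, ∀ b ∈ P, a + b ∈ Ω → a + b ∈ P

/-- `Pi` is a system of simple roots of `Q`: a linearly independent subset of `Q` such that
every element of `Q` is an integral linear combination of elements of `Pi` with coefficients
all nonnegative or all nonpositive. -/
def IsSimpleSystem (Q Pi : Set V) : Prop :=
  Pi ⊆ Q ∧ LinearIndependent ℂ (Subtype.val : Pi → V) ∧
    ∀ q ∈ Q, ∃ c : V →₀ ℤ, (c.support : Set V) ⊆ Pi ∧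
      q = c.sum (fun v n => n • v) ∧ ((∀ v, 0 ≤ c v) ∨ (∀ v, c v ≤ 0))

/-- The Levi procedure: `Q' = ℤΣ ∩ Q` for a subset `Sig` of a system of simple roots of `Q`. -/
def LeviStep (Q Q' : Set V) : Prop :=
  ∃ Pi Sig : Set V, IsSimpleSystem Q Pi ∧ Sig ⊆ Pi ∧
    Q' = {q ∈ Q | q ∈ AddSubgroup.closure Sig}

/-- The Dynkin procedure: `Q'` consists of those elements of `Q` whose coefficient of `α`
in the expansion in the simple system `Pi` is divisible by `n`. -/
def DynkinStep (Q Q' : Set V) : Prop :=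
  ∃ Pi : Set V, IsSimpleSystem Q Pi ∧ ∃ α ∈ Pi, ∃ n : ℕ, 0 < n ∧
    Q' = {β ∈ Q | ∃ c : V →₀ ℤ, (c.support : Set V) ⊆ Pi ∧
      β = c.sum (fun v k => k • v) ∧ (n : ℤ) ∣ c α}

end CombinatorialDefs

section LieSetup

variable (L : Type*) [LieRing L] [LieAlgebra ℂ L] [FiniteDimensional ℂ L]
  (H : LieSubalgebra ℂ L) [H.IsCartanSubalgebra]

/-- The set `Ω` of roots of `L` with respect to the Cartan subalgebra `H`, regarded as
(nonzero) linear functionals on `H` with nonzero root space. -/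
def lieRoots : Set (Module.Dual ℂ H) :=
  {α | α ≠ 0 ∧ rootSpace H ⇑α ≠ ⊥}

/-- The group `Γ_𝔨 = ℤΩ / ℤP`. -/
abbrev GammaK (P : Set (Module.Dual ℂ H)) : Type _ :=
  AddSubgroup.closure (lieRoots L H) ⧸
    (AddSubgroup.closure P).addSubgroupOf (AddSubgroup.closure (lieRoots L H))

/-- The image `ᾱ` of a root `α` in `Γ_𝔨 = ℤΩ / ℤP`. -/
def rootImage (P : Set (Module.Dual ℂ H)) {α : Module.Dual ℂ H}
    (hα : α ∈ lieRoots L H) : GammaK L H P :=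
  QuotientAddGroup.mk ⟨α, AddSubgroup.subset_closure hα⟩

/-- The subspace `𝔨 = 𝔥 ⊕ ⨁_{α ∈ P} 𝔤_α` of `L`. -/
noncomputable def lieK (P : Set (Module.Dual ℂ H)) : Submodule ℂ L :=
  H.toSubmodule ⊔ ⨆ α ∈ P, (rootSpace H ⇑α : LieSubmodule ℂ H L).toSubmodule

/-- The subspace `𝔪 = ⨁_{γ ∈ Ω \ P} 𝔤_γ` of `L`. -/
noncomputable def lieM (P : Set (Module.Dual ℂ H)) : Submodule ℂ L :=
  ⨆ γ ∈ lieRoots L H \ P, (rootSpace H ⇑γ : LieSubmodule ℂ H L).toSubmodule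

end LieSetup

namespace TS
open scoped InnerProductSpace

structure RSys {E : Type*} [NormedAddCommGroup E] [InnerProductSpace ℝ E] (Φ : Set E) : Prop where
  fin : Φ.Finite
  nz : ∀ a ∈ Φ, a ≠ 0
  refl : ∀ a ∈ Φ, ∀ b ∈ Φ, ∃ n : ℤ, 2 * ⟪a, b⟫_ℝ = n * ⟪b, b⟫_ℝ ∧ a - n • b ∈ Φ

def Irr {E : Type*} [NormedAddCommGroup E] [InnerProductSpace ℝ E] (Φ : Set E) : Prop :=
  Φ.Nonempty ∧ ∀ S ⊆ Φ, S.Nonempty → (∀ a ∈ S, ∀ b ∈ Φ, b ∉ S → ⟪a, b⟫_ℝ = 0) → S = Φ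

section A
variable {E : Type*} [NormedAddCommGroup E] [InnerProductSpace ℝ E] {Φ : Set E}

lemma RSys.pos (h : RSys Φ) {a : E} (ha : a ∈ Φ) : 0 < ⟪a, a⟫_ℝ :=
  real_inner_self_pos.2 (h.nz a ha)

lemma RSys.neg (h : RSys Φ) {a : E} (ha : a ∈ Φ) : -a ∈ Φ := by
  obtain ⟨n, hn, hm⟩ := h.refl a ha a ha
  have h1 : (n : ℝ) = 2 := (mul_right_cancel₀ (h.pos ha).ne' hn).symm
  have h2 : n = 2 := by exact_mod_cast h1
  subst h2
  convert hm using 1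
  rw [two_smul]; abel

lemma RSys.sub (h : RSys Φ) {a b : E} (ha : a ∈ Φ) (hb : b ∈ Φ) (hab : 0 < ⟪a, b⟫_ℝ)
    (hne : a ≠ b) : a - b ∈ Φ := by
  obtain ⟨n, hn, hm⟩ := h.refl a ha b hb
  obtain ⟨n', hn', hm'⟩ := h.refl b hb a ha
  have pa := h.pos ha
  have pb := h.pos hb
  rw [real_inner_comm] at hn'
  have n0 : (0:ℝ) < n := by
    by_contra hc; push Not at hc
    nlinarith
  have n0' : (0:ℝ) < n' := by
    by_contra hc; push Not at hc
    nlinarith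
  have n1 : 0 < n := by exact_mod_cast n0
  have n1' : 0 < n' := by exact_mod_cast n0'
  by_cases c1 : n = 1
  · subst c1; simpa using hm
  by_cases c2 : n' = 1
  · subst c2
    have := h.neg hm'
    simpa using this
  exfalso
  have e1 : (2:ℝ) ≤ n := by exact_mod_cast (by omega : 2 ≤ n)
  have e2 : (2:ℝ) ≤ n' := by exact_mod_cast (by omega : 2 ≤ n')
  have : 0 < ⟪a - b, a - b⟫_ℝ := real_inner_self_pos.2 (sub_ne_zero.2 hne)
  rw [real_inner_sub_sub_self] at this
  nlinarith

lemma RSys.add (h : RSys Φ) {a b : E} (ha : a ∈ Φ) (hb : b ∈ Φ) (hab : ⟪a, b⟫_ℝ < 0)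
    (hne : a ≠ -b) : a + b ∈ Φ := by
  have := h.sub ha (h.neg hb) (by rw [inner_neg_right]; linarith) hne
  simpa using this

structure Base {κ : Type*} [Fintype κ] (Φ : Set E) (u : κ → E) : Prop where
  mem : ∀ k, u k ∈ Φ
  li : ∀ c : κ → ℝ, ∑ k, c k • u k = 0 → ∀ k, c k = 0
  coef : ∀ a ∈ Φ, ∃ c : κ → ℤ, a = ∑ k, c k • u k ∧ ((∀ k, 0 ≤ c k) ∨ (∀ k, c k ≤ 0))
  obt : ∀ i j, i ≠ j → ⟪u i, u j⟫_ℝ ≤ 0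

lemma exists_base [FiniteDimensional ℝ E] (h : RSys Φ) :
    ∃ (κ : Type) (_ : Fintype κ) (u : κ → E), Base Φ u := by
  classical
  have hfin : Finite Φ := h.fin
  obtain ⟨f, hf⟩ := Module.exists_dual_forall_apply_ne_zero (K := ℝ) (fun a : Φ => (a : E))
    (fun a => h.nz a a.2)
  have hf' : ∀ a ∈ Φ, f a ≠ 0 := fun a ha => hf ⟨a, ha⟩
  let D : Set E := {a | a ∈ Φ ∧ 0 < f a ∧ ¬ ∃ b ∈ Φ, ∃ c ∈ Φ, 0 < f b ∧ 0 < f c ∧ a = b + c}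
  have hD : D.Finite := h.fin.subset (fun a ha => ha.1)
  haveI : Finite D := hD
  obtain ⟨n, ⟨e⟩⟩ := Finite.exists_equiv_fin D
  let u : Fin n → E := fun i => (e.symm i : E)
  have hu : ∀ i, u i ∈ D := fun i => (e.symm i).2
  have hobt : ∀ i j, i ≠ j → ⟪u i, u j⟫_ℝ ≤ 0 := by
    intro i j hij
    by_contra hc; push Not at hc
    have hne : u i ≠ u j := fun hh => hij (e.symm.injective (Subtype.ext hh))
    have hs := h.sub (hu i).1 (hu j).1 hc hne
    rcases lt_or_gt_of_ne (hf' _ hs) with hlt | hgt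
    · refine (hu j).2.2 ⟨u j - u i, ?_, u i, (hu i).1, ?_, (hu i).2.1, by abel⟩
      · simpa using h.neg hs
      · rw [map_sub] at hlt ⊢; linarith
    · exact (hu i).2.2 ⟨u i - u j, hs, u j, (hu j).1, hgt, (hu j).2.1, by abel⟩
  have hpos : ∀ a ∈ Φ, 0 < f a → ∃ c : Fin n → ℤ, a = ∑ k, c k • u k ∧ ∀ k, 0 ≤ c k := by
    by_contra hc
    push Not at hc
    let B : Set E := {a | a ∈ Φ ∧ 0 < f a ∧ ¬ ∃ c : Fin n → ℤ, a = ∑ k, c k • u k ∧ ∀ k, 0 ≤ c k}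
    have hB : B.Finite := h.fin.subset (fun a ha => ha.1)
    have hBn : B.Nonempty := by
      obtain ⟨a, ha, hfa, hh⟩ := hc
      refine ⟨a, ha, hfa, ?_⟩
      rintro ⟨c, hc1, hc2⟩
      obtain ⟨k, hk⟩ := hh c hc1
      exact absurd (hc2 k) (not_le.2 hk)
    obtain ⟨a, ⟨ha, hfa, hna⟩, hmin⟩ := Set.exists_min_image B f hB hBn
    by_cases haD : a ∈ D
    · apply hna
      refine ⟨Pi.single (e ⟨a, haD⟩) 1, ?_, ?_⟩
      · simp [Pi.single_apply, u, ite_smul]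
      · intro k; by_cases hk : k = e ⟨a, haD⟩
        · subst hk; simp
        · simp [Pi.single_apply, hk]
    · have : ∃ b ∈ Φ, ∃ c ∈ Φ, 0 < f b ∧ 0 < f c ∧ a = b + c := by
        by_contra hh; exact haD ⟨ha, hfa, hh⟩
      obtain ⟨b, hb, c, hc, hfb, hfc, rfl⟩ := this
      have key : ∀ x ∈ Φ, 0 < f x → f x < f (b + c) →
          ∃ c : Fin n → ℤ, x = ∑ k, c k • u k ∧ ∀ k, 0 ≤ c k := by
        intro x hx hfx hlt
        by_contra hh
        exact absurd (hmin x ⟨hx, hfx, hh⟩) (not_le.2 hlt)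
      obtain ⟨c1, e1, p1⟩ := key b hb hfb (by rw [map_add]; linarith)
      obtain ⟨c2, e2, p2⟩ := key c hc hfc (by rw [map_add]; linarith)
      apply hna
      refine ⟨c1 + c2, ?_, fun k => add_nonneg (p1 k) (p2 k)⟩
      rw [e1, e2, ← Finset.sum_add_distrib]
      exact Finset.sum_congr rfl (fun k _ => by rw [Pi.add_apply, add_smul])
  refine ⟨Fin n, inferInstance, u, fun k => (hu k).1, ?_, ?_, hobt⟩
  · have := LinearMap.BilinForm.linearIndependent_of_pairwise_le_zero (B := innerₗ E)
      (fun x hx => by simpa using real_inner_self_pos.2 hx) (f := f) (v := u)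
      (fun i => (hu i).2.1) (fun i j hij => by simpa using hobt i j hij)
    intro c hc
    exact Fintype.linearIndependent_iff.1 this c hc
  · intro a ha
    rcases lt_or_gt_of_ne (hf' _ ha) with hlt | hgt
    · obtain ⟨c, hc, hc'⟩ := hpos (-a) (h.neg ha) (by rw [map_neg]; linarith)
      refine ⟨-c, ?_, Or.inr fun k => by simpa using hc' k⟩
      rw [← neg_neg a, hc, ← Finset.sum_neg_distrib]
      exact Finset.sum_congr rfl (fun k _ => by rw [Pi.neg_apply, neg_smul])
    · obtain ⟨c, hc, hc'⟩ := hpos a ha hgt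
      exact ⟨c, hc, Or.inl hc'⟩

end A
end TS

namespace TS
open scoped InnerProductSpace
section B
variable {E : Type*} [NormedAddCommGroup E] [InnerProductSpace ℝ E] {Φ : Set E}

structure Aff {κ : Type*} [Fintype κ] (Φ : Set E) (u : κ → E) (m : κ → ℕ) (o : κ) : Prop where
  mem : ∀ k, u k ∈ Φ
  mo : m o = 1
  m1 : ∀ k, 1 ≤ m k
  rel : ∑ k, m k • u k = 0
  li : ∀ c : κ → ℝ, ∑ k, c k • u k = 0 → ∀ k, c k = c o * m k
  coef : ∀ a ∈ Φ, ∃ c : κ → ℤ, c o = 0 ∧ a = ∑ k, c k • u k ∧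
    ((∀ k, 0 ≤ c k ∧ c k ≤ m k) ∨ (∀ k, -(m k : ℤ) ≤ c k ∧ c k ≤ 0))
  long : ∀ a ∈ Φ, ⟪a, a⟫_ℝ ≤ ⟪u o, u o⟫_ℝ
  obt : ∀ i j, i ≠ j → ⟪u i, u j⟫_ℝ ≤ 0
  conn : ∀ S : Set κ, o ∈ S → (∀ i ∈ S, ∀ j, j ∉ S → ⟪u i, u j⟫_ℝ = 0) → ∀ k, k ∈ S

variable {κ : Type*} [Fintype κ] {u : κ → E}

lemma sum_zsmul_cast (c : κ → ℤ) : ∑ k, c k • u k = ∑ k, (c k : ℝ) • u k :=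
  Finset.sum_congr rfl fun k _ => (Int.cast_smul_eq_zsmul ℝ _ _).symm

lemma sum_nsmul_cast (c : κ → ℕ) : ∑ k, c k • u k = ∑ k, (c k : ℝ) • u k :=
  Finset.sum_congr rfl fun k _ => (Nat.cast_smul_eq_nsmul ℝ _ _).symm

lemma inner_zsum (c : κ → ℤ) (x : E) : ⟪∑ k, c k • u k, x⟫_ℝ = ∑ k, (c k : ℝ) * ⟪u k, x⟫_ℝ := by
  rw [sum_zsmul_cast, sum_inner]
  exact Finset.sum_congr rfl fun k _ => by rw [real_inner_smul_left]

lemma Base.uniq (hB : Base Φ u) {c d : κ → ℤ} (h : ∑ k, c k • u k = ∑ k, d k • u k) : c = d := by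
  rw [sum_zsmul_cast, sum_zsmul_cast, ← sub_eq_zero, ← Finset.sum_sub_distrib] at h
  have := hB.li (fun k => (c k : ℝ) - d k) (by simpa only [sub_smul] using h)
  funext k
  have := this k
  have h2 : (c k : ℝ) = d k := by linarith
  exact_mod_cast h2

open Classical in
noncomputable def Base.co (hB : Base Φ u) (a : E) : κ → ℤ :=
  if h : a ∈ Φ then (hB.coef a h).choose else 0

lemma Base.co_eq (hB : Base Φ u) {a : E} (h : a ∈ Φ) : a = ∑ k, hB.co a k • u k := by
  unfold Base.co; rw [dif_pos h]; exact (hB.coef a h).choose_spec.1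

lemma Base.co_sign (hB : Base Φ u) {a : E} (h : a ∈ Φ) :
    (∀ k, 0 ≤ hB.co a k) ∨ (∀ k, hB.co a k ≤ 0) := by
  unfold Base.co; rw [dif_pos h]; exact (hB.coef a h).choose_spec.2

lemma Base.co_of (hB : Base Φ u) {a : E} (h : a ∈ Φ) {c : κ → ℤ} (hc : a = ∑ k, c k • u k) :
    hB.co a = c := hB.uniq ((hB.co_eq h).symm.trans hc)

lemma zsum_single [DecidableEq κ] (k : κ) (n : ℤ) : ∑ i, (Pi.single k n : κ → ℤ) i • u i = n • u k := by
  simp [Pi.single_apply, ite_smul]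

lemma Base.co_u [DecidableEq κ] (hB : Base Φ u) (k : κ) : hB.co (u k) = Pi.single k 1 :=
  hB.co_of (hB.mem k) (by rw [zsum_single, one_smul])

lemma Base.co_add (hB : Base Φ u) {a b : E} (ha : a ∈ Φ) (hb : b ∈ Φ) (n : ℤ)
    (hab : a + n • b ∈ Φ) (k : κ) : hB.co (a + n • b) k = hB.co a k + n * hB.co b k := by
  have : hB.co (a + n • b) = hB.co a + n • hB.co b := by
    apply hB.co_of hab
    conv_lhs => rw [hB.co_eq ha, hB.co_eq hb]
    rw [Finset.smul_sum, ← Finset.sum_add_distrib]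
    exact Finset.sum_congr rfl fun i _ => by
      rw [Pi.add_apply, Pi.smul_apply, add_smul, smul_smul, smul_eq_mul]
  rw [this]; simp

lemma Base.co_neg (hB : Base Φ u) {a : E} (ha : a ∈ Φ) (hn : -a ∈ Φ) (k : κ) :
    hB.co (-a) k = - hB.co a k := by
  have : hB.co (-a) = - hB.co a := by
    apply hB.co_of hn
    conv_lhs => rw [hB.co_eq ha]
    rw [← Finset.sum_neg_distrib]
    exact Finset.sum_congr rfl fun i _ => by rw [Pi.neg_apply, neg_smul]
  rw [this]; simp

lemma Base.ne_zero (h : RSys Φ) (hB : Base Φ u) {a : E} (ha : a ∈ Φ) : ∃ k, hB.co a k ≠ 0 := by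
  by_contra hc; push Not at hc
  apply h.nz a ha
  rw [hB.co_eq ha]; simp [hc]

/-- a positive root has positive inner product with some base element of its support -/
lemma Base.exists_pos (h : RSys Φ) (hB : Base Φ u) {a : E} (ha : a ∈ Φ) (hp : ∀ k, 0 ≤ hB.co a k) :
    ∃ k, 0 < hB.co a k ∧ 0 < ⟪a, u k⟫_ℝ := by
  by_contra hc; push Not at hc
  have h1 := h.pos ha
  have h2 : ⟪a, a⟫_ℝ = ∑ k, (hB.co a k : ℝ) * ⟪u k, a⟫_ℝ := by
    conv_lhs => enter [2]; rw [hB.co_eq ha]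
    rw [inner_zsum]
  have h3 : ∑ k, (hB.co a k : ℝ) * ⟪u k, a⟫_ℝ ≤ 0 := by
    apply Finset.sum_nonpos
    intro k _
    rcases (hp k).eq_or_lt with h0 | h0
    · rw [← h0]; simp
    · have := hc k h0
      rw [real_inner_comm] at this
      have : (0:ℝ) < hB.co a k := by exact_mod_cast h0
      nlinarith
  linarith

lemma Base.split (h : RSys Φ) (hB : Base Φ u) (K : Set κ)
    (hK : ∀ i ∈ K, ∀ j, j ∉ K → ⟪u i, u j⟫_ℝ = 0) {a : E} (ha : a ∈ Φ) :
    (∀ k ∈ K, hB.co a k = 0) ∨ (∀ k, k ∉ K → hB.co a k = 0) := by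
  classical
  -- positive version
  suffices H : ∀ a ∈ Φ, (∀ k, 0 ≤ hB.co a k) →
      (∀ k ∈ K, hB.co a k = 0) ∨ (∀ k, k ∉ K → hB.co a k = 0) by
    rcases hB.co_sign ha with hs | hs
    · exact H a ha hs
    · have := H (-a) (h.neg ha) (fun k => by rw [hB.co_neg ha (h.neg ha)]; linarith [hs k])
      simpa only [hB.co_neg ha (h.neg ha), neg_eq_zero] using this
  clear ha a
  by_contra hc; push Not at hc
  let B : Set E := {a | a ∈ Φ ∧ (∀ k, 0 ≤ hB.co a k) ∧ (∃ k ∈ K, hB.co a k ≠ 0) ∧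
    (∃ k, k ∉ K ∧ hB.co a k ≠ 0)}
  have hBf : B.Finite := h.fin.subset (fun a ha => ha.1)
  obtain ⟨a0, h1, h2, h3, h4⟩ := hc
  obtain ⟨a, ⟨ha, hp, ⟨i, hi, hi'⟩, ⟨j, hj, hj'⟩⟩, hmin⟩ :=
    Set.exists_min_image B (fun a => ∑ k, hB.co a k) hBf ⟨a0, h1, h2, h3, h4⟩
  obtain ⟨b, hb1, hb2⟩ := hB.exists_pos h ha hp
  have hne : a ≠ u b := by
    rintro rfl
    rw [hB.co_u] at hi' hj'
    have e1 : i = b := by by_contra hh; simp [Pi.single_apply, hh] at hi'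
    have e2 : j = b := by by_contra hh; simp [Pi.single_apply, hh] at hj'
    exact hj (e2 ▸ e1 ▸ hi)
  have hs := h.sub ha (hB.mem b) hb2 hne
  have hco : ∀ k, hB.co (a - u b) k = hB.co a k - (Pi.single b 1 : κ → ℤ) k := by
    intro k
    have e : a - u b = a + (-1 : ℤ) • u b := by rw [neg_one_smul]; abel
    have := hB.co_add ha (hB.mem b) (-1) (e ▸ hs) k
    rw [e, this, hB.co_u]; ring
  have hp' : ∀ k, 0 ≤ hB.co (a - u b) k := by
    intro k; rw [hco]
    by_cases hk : k = b
    · subst hk; simp; omega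
    · simp [Pi.single_apply, hk, hp k]
  have hlt : ∑ k, hB.co (a - u b) k < ∑ k, hB.co a k := by
    apply Finset.sum_lt_sum
    · intro k _; rw [hco]
      by_cases hk : k = b
      · subst hk; simp
      · simp [Pi.single_apply, hk]
    · exact ⟨b, Finset.mem_univ _, by rw [hco]; simp⟩
  have hnm : a - u b ∉ B := fun hh => absurd (hmin _ hh) (not_le.2 hlt)
  obtain ⟨n, hn, hm⟩ := h.refl a ha (u b) (hB.mem b)
  have hm' : a + (-n) • u b ∈ Φ := by
    rw [neg_smul, ← sub_eq_add_neg]; exact hm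
  have hcr : ∀ k, hB.co (a + (-n) • u b) k = hB.co a k + (-n) * (Pi.single b 1 : κ → ℤ) k := by
    intro k; rw [hB.co_add ha (hB.mem b) (-n) hm' k, hB.co_u]
  -- key: coefficient of b is one and all others on the side of b vanish
  have key : ∀ (Q : κ → Prop), Q b → (∀ k, ¬ Q k → ⟪u k, u b⟫_ℝ = 0) →
      (∀ k, Q k → hB.co (a - u b) k = 0) → (∃ k, ¬ Q k ∧ hB.co a k ≠ 0) → False := by
    intro Q hQb hQo hQ ⟨l, hl, hl'⟩
    have hab : ⟪a, u b⟫_ℝ = ⟪u b, u b⟫_ℝ := by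
      conv_lhs => rw [hB.co_eq ha]
      rw [inner_zsum, Finset.sum_eq_single b]
      · have := hQ b hQb
        rw [hco] at this
        simp at this
        have : hB.co a b = 1 := by omega
        rw [this]; simp
      · intro k _ hk
        by_cases hq : Q k
        · have := hQ k hq
          rw [hco] at this
          simp [Pi.single_apply, hk] at this
          rw [this]; simp
        · rw [hQo k hq, mul_zero]
      · simp
    have hn2 : (n:ℝ) = 2 := by
      rw [hab] at hn
      exact (mul_right_cancel₀ (h.pos (hB.mem b)).ne' hn).symm
    have hn3 : n = 2 := by exact_mod_cast hn2
    have c1 := hcr b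
    have c2 := hcr l
    have : l ≠ b := fun hh => hl (hh ▸ hQb)
    have hbb := hQ b hQb
    rw [hco] at hbb
    simp at hbb
    simp [Pi.single_apply, this] at c2
    simp at c1
    have hl0 := hp l
    rcases hB.co_sign hm' with hs | hs
    · have := hs b; simp at this; omega
    · have := hs l; simp at this; omega
  by_cases hbK : b ∈ K
  · apply key (fun k => k ∈ K) hbK (fun k hk => by rw [real_inner_comm]; exact hK b hbK k hk) _ ⟨j, hj, hj'⟩
    intro k hk
    by_contra hne0
    exact hnm ⟨hs, hp', ⟨k, hk, hne0⟩, ⟨j, hj, by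
      rw [hco]; have : j ≠ b := fun hh => hj (hh ▸ hbK)
      simpa [Pi.single_apply, this] using hj'⟩⟩
  · apply key (fun k => k ∉ K) hbK (fun k hk => hK k (not_not.1 hk) b hbK) _ ⟨i, not_not.2 hi, hi'⟩
    intro k hk
    by_contra hne0
    exact hnm ⟨hs, hp', ⟨i, hi, by
      rw [hco]; have : i ≠ b := fun hh => hbK (hh ▸ hi)
      simpa [Pi.single_apply, this] using hi'⟩, ⟨k, hk, hne0⟩⟩

lemma Base.conn (h : RSys Φ) (hI : Irr Φ) (hB : Base Φ u) (K : Set κ) (hKn : K.Nonempty)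
    (hK : ∀ i ∈ K, ∀ j, j ∉ K → ⟪u i, u j⟫_ℝ = 0) (k : κ) : k ∈ K := by
  classical
  have hS := hI.2 {a | a ∈ Φ ∧ ∀ k, k ∉ K → hB.co a k = 0} (fun a ha => ha.1) ?_ ?_
  · by_contra hk
    have : u k ∈ {a | a ∈ Φ ∧ ∀ k, k ∉ K → hB.co a k = 0} := by rw [hS]; exact hB.mem k
    have := this.2 k hk
    rw [hB.co_u] at this; simp at this
  · obtain ⟨i, hi⟩ := hKn
    refine ⟨u i, hB.mem i, fun k hk => ?_⟩
    have : k ≠ i := fun hh => hk (hh ▸ hi)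
    rw [hB.co_u]; simp [Pi.single_apply, this]
  · rintro a ⟨ha, ha'⟩ b hb hnb
    have hb' : ∀ k ∈ K, hB.co b k = 0 := by
      rcases hB.split h K hK hb with h1 | h1
      · exact h1
      · exact absurd ⟨hb, h1⟩ hnb
    rw [hB.co_eq ha, inner_zsum]
    apply Finset.sum_eq_zero
    intro i _
    by_cases hi : i ∈ K
    · have : ⟪u i, b⟫_ℝ = 0 := by
        rw [hB.co_eq hb, real_inner_comm, inner_zsum]
        apply Finset.sum_eq_zero
        intro j _
        by_cases hj : j ∈ K
        · rw [hb' j hj]; simp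
        · rw [real_inner_comm, hK i hi j hj, mul_zero]
      rw [this, mul_zero]
    · rw [ha' i hi]; simp

/-- dominant roots have full support -/
lemma Base.full (h : RSys Φ) (hI : Irr Φ) (hB : Base Φ u) {b : E} (hb : b ∈ Φ)
    (hp : ∀ k, 0 ≤ hB.co b k) (hd : ∀ k, 0 ≤ ⟪b, u k⟫_ℝ) (k : κ) : 0 < hB.co b k := by
  apply hB.conn h hI {k | 0 < hB.co b k}
  · obtain ⟨i, hi, _⟩ := hB.exists_pos h hb hp
    exact ⟨i, hi⟩
  · intro i hi j hj
    have hj0 : hB.co b j = 0 := le_antisymm (not_lt.1 hj) (hp j)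
    have hsum : ⟪b, u j⟫_ℝ = ∑ k, (hB.co b k : ℝ) * ⟪u k, u j⟫_ℝ := by
      conv_lhs => rw [hB.co_eq hb]
      rw [inner_zsum]
    have hterm : ∀ k ∈ Finset.univ, (hB.co b k : ℝ) * ⟪u k, u j⟫_ℝ ≤ 0 := by
      intro k _
      by_cases hk : k = j
      · subst hk; rw [hj0]; simp
      · exact mul_nonpos_of_nonneg_of_nonpos (by exact_mod_cast hp k) (hB.obt k j hk)
    have h0 : ∑ k, (hB.co b k : ℝ) * ⟪u k, u j⟫_ℝ = 0 :=
      le_antisymm (Finset.sum_nonpos hterm) (hsum ▸ hd j)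
    have := (Finset.sum_eq_zero_iff_of_nonpos hterm).1 h0 i (Finset.mem_univ _)
    have hi' : (hB.co b i : ℝ) ≠ 0 := by
      have : 0 < hB.co b i := hi
      exact_mod_cast this.ne'
    exact (mul_eq_zero.1 this).resolve_left hi'

lemma Base.inner_nonneg (hB : Base Φ u) {x : E} (hd : ∀ k, 0 ≤ ⟪x, u k⟫_ℝ) (c : κ → ℤ)
    (hc : ∀ k, 0 ≤ c k) : 0 ≤ ⟪∑ k, c k • u k, x⟫_ℝ := by
  rw [inner_zsum]
  exact Finset.sum_nonneg fun k _ => mul_nonneg (by exact_mod_cast hc k)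
    (by rw [real_inner_comm]; exact hd k)

lemma Base.exists_aff (h : RSys Φ) (hI : Irr Φ) (hB : Base Φ u) :
    ∃ (u' : Option κ → E) (m : Option κ → ℕ), Aff Φ u' m none := by
  classical
  let ht : E → ℤ := fun a => ∑ k, hB.co a k
  obtain ⟨θ, hθ, hmax⟩ := Set.exists_max_image Φ ht h.fin hI.1
  have hposht : ∀ a ∈ Φ, 0 ≤ ht a → ∀ k, 0 ≤ hB.co a k := by
    intro a ha h0
    rcases hB.co_sign ha with hs | hs
    · exact hs
    · intro k
      have h1 : ∑ k, hB.co a k = 0 := le_antisymm (Finset.sum_nonpos fun k _ => hs k) h0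
      have := (Finset.sum_eq_zero_iff_of_nonpos (fun k _ => hs k)).1 h1 k (Finset.mem_univ _)
      exact this.ge
  have hnht : ∀ a ∈ Φ, ht (-a) = - ht a := by
    intro a ha
    simp only [ht, hB.co_neg ha (h.neg ha), Finset.sum_neg_distrib]
  have hθ0 : 0 ≤ ht θ := by
    by_contra hc
    have := hmax _ (h.neg hθ)
    rw [hnht _ hθ] at this
    omega
  have hθp := hposht θ hθ hθ0
  have huht : ∀ k, ht (u k) = 1 := by intro k; simp [ht, hB.co_u]
  have haddht : ∀ a ∈ Φ, ∀ b ∈ Φ, ∀ n : ℤ, a + n • b ∈ Φ → ht (a + n • b) = ht a + n * ht b := by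
    intro a ha b hb n hab
    simp only [ht, hB.co_add ha hb n hab, Finset.sum_add_distrib, Finset.mul_sum]
  have haddht1 : ∀ a ∈ Φ, ∀ b ∈ Φ, a + b ∈ Φ → ht (a + b) = ht a + ht b := by
    intro a ha b hb hab
    have := haddht a ha b hb 1 (by simpa using hab)
    simpa using this
  have hco1 : ∀ a ∈ Φ, ∀ b ∈ Φ, a + b ∈ Φ → ∀ k, hB.co (a + b) k = hB.co a k + hB.co b k := by
    intro a ha b hb hab k
    have := hB.co_add ha hb 1 (by simpa using hab) k
    simpa using this
  -- local maxima are dominant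
  have hdom : ∀ b ∈ Φ, (∀ k, 0 ≤ hB.co b k) → (∀ k, b + u k ∈ Φ → False) →
      ∀ k, 0 ≤ ⟪b, u k⟫_ℝ := by
    intro b hb hbp hbm k
    by_contra hc; push Not at hc
    apply hbm k
    apply h.add hb (hB.mem k) hc
    rintro rfl
    have := hbp k
    rw [hB.co_neg (hB.mem k) hb, hB.co_u] at this
    simp at this
  have hθd : ∀ k, 0 ≤ ⟪θ, u k⟫_ℝ := by
    apply hdom θ hθ hθp
    intro k hk
    have := hmax _ hk
    rw [haddht1 _ hθ _ (hB.mem k) hk, huht] at this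
    omega
  have hθf := hB.full h hI hθ hθp hθd
  -- every positive root is below θ
  have hle : ∀ a ∈ Φ, (∀ k, 0 ≤ hB.co a k) → ∀ k, hB.co a k ≤ hB.co θ k := by
    intro a ha hap
    obtain ⟨b, ⟨hb, hab⟩, hbm⟩ := Set.exists_max_image {b | b ∈ Φ ∧ ∀ k, hB.co a k ≤ hB.co b k} ht
      (h.fin.subset fun a ha => ha.1) ⟨a, ha, fun k => le_rfl⟩
    have hbp : ∀ k, 0 ≤ hB.co b k := fun k => (hap k).trans (hab k)
    have hbd : ∀ k, 0 ≤ ⟪b, u k⟫_ℝ := by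
      apply hdom b hb hbp
      intro k hk
      have := hbm _ ⟨hk, fun i => by
        rw [hco1 _ hb _ (hB.mem k) hk, hB.co_u]
        have h1 := hab i
        by_cases hik : i = k
        · subst hik; simp; omega
        · simpa [Pi.single_apply, hik] using h1⟩
      rw [haddht1 _ hb _ (hB.mem k) hk, huht] at this
      omega
    obtain ⟨i, hi, hi2⟩ := hB.exists_pos h hb hbp
    have hin : 0 < ⟪θ, b⟫_ℝ := by
      conv_rhs => enter [2]; rw [hB.co_eq hθ]
      rw [inner_zsum]
      apply Finset.sum_pos'
      · intro k _
        exact mul_nonneg (by exact_mod_cast hθp k) (by rw [real_inner_comm]; exact hbd k)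
      · refine ⟨i, Finset.mem_univ _, mul_pos (by exact_mod_cast hθf i) (by rw [real_inner_comm]; exact hi2)⟩
    by_cases hθb : θ = b
    · rw [hθb]; exact hab
    · exfalso
      have hs := h.sub hθ hb hin hθb
      have e : θ - b + b = θ := by abel
      have hc := hco1 _ hs _ hb (e.symm ▸ hθ)
      have hh := haddht1 _ hs _ hb (e.symm ▸ hθ)
      rw [e] at hc hh
      have hge := hmax b hb
      have hsp := hposht _ hs (by omega)
      have h2 := hbm θ ⟨hθ, fun k => by have := hc k; have := hsp k; have := hab k; omega⟩
      have h3 : ht (θ - b) = 0 := by omega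
      obtain ⟨k, hk⟩ := hB.ne_zero h hs
      apply hk
      exact (Finset.sum_eq_zero_iff_of_nonneg (fun k _ => hsp k)).1 h3 k (Finset.mem_univ _)
  have hlong : ∀ a ∈ Φ, ⟪a, a⟫_ℝ ≤ ⟪θ, θ⟫_ℝ := by
    obtain ⟨a0, ha0, hm0⟩ := Set.exists_max_image Φ (fun a => ⟪a, a⟫_ℝ) h.fin hI.1
    obtain ⟨b, ⟨hb, hbl⟩, hbm⟩ := Set.exists_max_image {b | b ∈ Φ ∧ ⟪b, b⟫_ℝ = ⟪a0, a0⟫_ℝ} ht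
      (h.fin.subset fun a ha => ha.1) ⟨a0, ha0, rfl⟩
    have hb0 : 0 ≤ ht b := by
      by_contra hc
      have := hbm (-b) ⟨h.neg hb, by rw [inner_neg_neg]; exact hbl⟩
      rw [hnht _ hb] at this
      omega
    have hbp := hposht b hb hb0
    have hbd : ∀ k, 0 ≤ ⟪b, u k⟫_ℝ := by
      intro k
      by_contra hc; push Not at hc
      obtain ⟨n, hn, hm⟩ := h.refl b hb (u k) (hB.mem k)
      have pk := h.pos (hB.mem k)
      have hm' : b + (-n) • u k ∈ Φ := by
        rw [neg_smul, ← sub_eq_add_neg]; exact hm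
      have hn0 : (n : ℝ) < 0 := by
        by_contra hh; push Not at hh; nlinarith
      have hn1 : n < 0 := by exact_mod_cast hn0
      have := hbm _ ⟨hm', by
        rw [← hbl, ← Int.cast_smul_eq_zsmul ℝ, real_inner_add_add_self, real_inner_smul_right,
          real_inner_smul_right, real_inner_smul_left]
        push_cast
        nlinarith⟩
      rw [haddht _ hb _ (hB.mem k) _ hm', huht] at this
      omega
    intro a ha
    have h1 := hm0 a ha
    have hbθ := hle b hb hbp
    have hdiff : θ - b = ∑ k, (fun k => hB.co θ k - hB.co b k) k • u k := by
      conv_lhs => rw [hB.co_eq hθ, hB.co_eq hb]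
      rw [← Finset.sum_sub_distrib]
      exact Finset.sum_congr rfl fun i _ => by rw [sub_smul]
    have q1 := hB.inner_nonneg hθd (fun k => hB.co θ k - hB.co b k) (fun k => sub_nonneg.2 (hbθ k))
    have q2 := hB.inner_nonneg hbd (fun k => hB.co θ k - hB.co b k) (fun k => sub_nonneg.2 (hbθ k))
    rw [← hdiff, inner_sub_left] at q1 q2
    rw [real_inner_comm] at q2
    have : ⟪b, θ⟫_ℝ = ⟪θ, b⟫_ℝ := real_inner_comm _ _
    skip
    linarith
  refine ⟨fun x => x.elim (-θ) u, fun x => x.elim 1 (fun k => (hB.co θ k).toNat), ?_⟩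
  have hmk : ∀ k, ((hB.co θ k).toNat : ℤ) = hB.co θ k := fun k => Int.toNat_of_nonneg (hθp k)
  have hmkr : ∀ k, ((hB.co θ k).toNat : ℝ) = hB.co θ k := fun k => by exact_mod_cast hmk k
  refine ⟨?_, rfl, ?_, ?_, ?_, ?_, ?_, ?_, ?_⟩
  · rintro (_ | k)
    · exact h.neg hθ
    · exact hB.mem k
  · rintro (_ | k)
    · exact le_rfl
    · have := hθf k
      simp only [Option.elim]; omega
  · rw [Fintype.sum_option]
    simp only [Option.elim, one_smul]
    rw [sum_nsmul_cast]
    simp only [hmkr]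
    rw [← sum_zsmul_cast, ← hB.co_eq hθ]
    simp
  · intro c hc
    rw [Fintype.sum_option] at hc
    simp only [Option.elim] at hc
    have : ∑ k, (c (some k) - c none * hB.co θ k) • u k = 0 := by
      simp only [sub_smul, mul_smul, Finset.sum_sub_distrib, ← Finset.smul_sum]
      rw [← sum_zsmul_cast, ← hB.co_eq hθ, ← hc]
      simp; abel
    have := hB.li _ this
    rintro (_ | k)
    · simp
    · have := this k
      simp only [Option.elim, hmkr]; linarith
  · intro a ha
    refine ⟨fun x => x.elim 0 (hB.co a), rfl, ?_, ?_⟩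
    · rw [Fintype.sum_option]
      simpa using hB.co_eq ha
    · rcases hB.co_sign ha with hs | hs
      · left
        rintro (_ | k)
        · simp
        · simp only [Option.elim, hmk]
          exact ⟨hs k, hle a ha hs k⟩
      · right
        rintro (_ | k)
        · simp
        · simp only [Option.elim, hmk]
          have := hle (-a) (h.neg ha) (fun k => by rw [hB.co_neg ha (h.neg ha)]; linarith [hs k]) k
          rw [hB.co_neg ha (h.neg ha)] at this
          exact ⟨by linarith, hs k⟩
  · intro a ha
    simp only [Option.elim, inner_neg_neg]
    exact hlong a ha
  · rintro (_ | i) (_ | j) hij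
    · exact absurd rfl hij
    · simp only [Option.elim, inner_neg_left]; linarith [hθd j]
    · simp only [Option.elim, inner_neg_right]; rw [real_inner_comm]; linarith [hθd i]
    · exact hB.obt i j (fun hh => hij (by rw [hh]))
  · intro S hS hcl
    have hK : ∀ k, k ∈ {k | some k ∈ S} := by
      apply hB.conn h hI
      · by_contra hne
        rw [Set.not_nonempty_iff_eq_empty] at hne
        have hz : ∀ k, ⟪θ, u k⟫_ℝ = 0 := by
          intro k
          have := hcl none hS (some k) (fun hh => by
            have : k ∈ ({k | some k ∈ S} : Set κ) := hh
            rw [hne] at this; exact this)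
          simp only [Option.elim, inner_neg_left] at this
          linarith
        obtain ⟨k, _, hk⟩ := hB.exists_pos h hθ hθp
        linarith [hz k]
      · intro i hi j hj
        exact hcl (some i) hi (some j) hj
    rintro (_ | k)
    · exact hS
    · exact hK k

lemma Aff.reindex {m : κ → ℕ} {o : κ} (hA : Aff Φ u m o) {κ' : Type*} [Fintype κ'] (e : κ' ≃ κ) :
    Aff Φ (u ∘ e) (m ∘ e) (e.symm o) := by
  refine ⟨fun k => hA.mem _, by simp [hA.mo], fun k => hA.m1 _, ?_, ?_, ?_, ?_, ?_, ?_⟩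
  · rw [← hA.rel]; exact e.sum_comp (fun k => m k • u k)
  · intro c hc k
    have := hA.li (c ∘ e.symm) (by
      rw [← hc, ← e.sum_comp]; simp) (e k)
    simpa using this
  · intro a ha
    obtain ⟨c, h0, h1, h2⟩ := hA.coef a ha
    refine ⟨c ∘ e, by simpa using h0, ?_, ?_⟩
    · rw [h1]; exact (e.sum_comp (fun k => c k • u k)).symm
    · rcases h2 with h2 | h2
      · exact Or.inl fun k => h2 _
      · exact Or.inr fun k => h2 _
  · intro a ha; simpa using hA.long a ha
  · intro i j hij; exact hA.obt _ _ (fun h => hij (e.injective h))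
  · intro S hS hcl k
    have := hA.conn {k | e.symm k ∈ S} hS (fun i hi j hj => by
      have := hcl _ hi _ hj; simpa using this) (e k)
    simpa using this

end B
end TS

namespace TS
open scoped InnerProductSpace
section C
variable {E : Type*} [NormedAddCommGroup E] [InnerProductSpace ℝ E] {Φ : Set E}

lemma exists_char {A : Type*} [AddCommGroup A] (B : AddSubgroup A) (t : A) (e : ℕ) (he : 0 < e)
    (ht : ∀ k : ℤ, k • t ∈ B ↔ (e : ℤ) ∣ k) :
    ∃ χ : A →+ UnitAddCircle, (∀ b ∈ B, χ b = 0) ∧ ∀ k : ℤ, k • χ t = 0 → (e : ℤ) ∣ k := by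
  haveI : NeZero e := ⟨he.ne'⟩
  let q : A →+ A ⧸ B := QuotientAddGroup.mk' B
  have hq : ∀ a, q a = 0 ↔ a ∈ B := fun a => QuotientAddGroup.eq_zero_iff a
  let f : ZMod e →+ A ⧸ B := ZMod.lift e ⟨(zmultiplesHom _) (q t), by
    simp only [zmultiplesHom_apply]
    rw [← map_zsmul, hq, ht]⟩
  have hf : Function.Injective f := by
    rw [injective_iff_map_eq_zero]
    intro a ha
    obtain ⟨k, rfl⟩ := ZMod.intCast_surjective a
    simp only [f, ZMod.lift_coe, zmultiplesHom_apply] at ha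
    rw [← map_zsmul, hq, ht] at ha
    exact (ZMod.intCast_zmod_eq_zero_iff_dvd k e).2 ha
  obtain ⟨χ, hχ⟩ := Module.Baer.extension_property_addMonoidHom
    (Module.Baer.of_divisible UnitAddCircle) f hf (ZMod.toAddCircle : ZMod e →+ UnitAddCircle)
  refine ⟨χ.comp q, fun b hb => ?_, fun k hk => ?_⟩
  · rw [AddMonoidHom.comp_apply, (hq b).2 hb, map_zero]
  · have h1 : (ZMod.toAddCircle ((k : ℤ) : ZMod e)) = 0 := by
      rw [← hχ, AddMonoidHom.comp_apply]
      simp only [f, ZMod.lift_coe, zmultiplesHom_apply]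
      rw [map_zsmul]; exact hk
    have h2 : ((k : ℤ) : ZMod e) = 0 := by
      apply ZMod.toAddCircle_injective
      rw [h1, map_zero]
    exact (ZMod.intCast_zmod_eq_zero_iff_dvd k e).1 h2

variable {κ : Type*} [Fintype κ] {u : κ → E} {m : κ → ℕ} {o : κ}

lemma Aff.solve [FiniteDimensional ℝ E] (hA : Aff Φ u m o) (r : κ → ℝ) :
    ∃ x : E, ∀ k, k ≠ o → ⟪u k, x⟫_ℝ = r k := by
  classical
  have hli : LinearIndependent ℝ (fun k : {k // k ≠ o} => u k) := by
    rw [Fintype.linearIndependent_iff]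
    intro g hg i
    have := hA.li (fun k => if h : k ≠ o then g ⟨k, h⟩ else 0) (by
      rw [← hg, ← Fintype.sum_subtype_add_sum_subtype (fun k => k ≠ o)]
      have h2 : ∑ i : {x // ¬ x ≠ o}, (if h : (i : κ) ≠ o then g ⟨i, h⟩ else 0) • u i = 0 :=
        Finset.sum_eq_zero fun i _ => by rw [dif_neg i.2, zero_smul]
      rw [h2, add_zero]
      exact Finset.sum_congr rfl fun i _ => by rw [dif_pos i.2]) i
    simpa [i.2] using this
  let b := Module.Basis.span hli
  obtain ⟨f, hf⟩ := LinearMap.exists_extend (b.constr ℝ (fun k : {k // k ≠ o} => r k))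
  refine ⟨(InnerProductSpace.toDual ℝ E).symm (LinearMap.toContinuousLinearMap f), fun k hk => ?_⟩
  rw [real_inner_comm, InnerProductSpace.toDual_symm_apply]
  have h1 := congrArg (fun g => g (b ⟨k, hk⟩)) hf
  simp only [LinearMap.comp_apply, Module.Basis.constr_basis] at h1
  rw [← h1]
  simp [b, Module.Basis.span_apply]

lemma refl_apply (v w : E) : (ℝ ∙ v)ᗮ.reflection w = w - (2 * ⟪w, v⟫_ℝ / ⟪v, v⟫_ℝ) • v := by
  rw [Submodule.reflection_orthogonal_apply, Submodule.reflection_singleton_apply]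
  rw [real_inner_self_eq_norm_sq, real_inner_comm]
  simp only [RCLike.ofReal_real_eq_id, id]
  rw [two_smul, neg_sub, mul_div_assoc, mul_smul, two_smul]

end C
end TS

namespace TS
open scoped InnerProductSpace

def IsInt (r : ℝ) : Prop := ∃ n : ℤ, r = n

lemma IsInt.add {a b : ℝ} : IsInt a → IsInt b → IsInt (a + b) := by
  rintro ⟨n, rfl⟩ ⟨k, rfl⟩; exact ⟨n + k, by push_cast; ring⟩
lemma IsInt.neg {a : ℝ} : IsInt a → IsInt (-a) := by
  rintro ⟨n, rfl⟩; exact ⟨-n, by push_cast; ring⟩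
lemma IsInt.sub {a b : ℝ} : IsInt a → IsInt b → IsInt (a - b) := by
  rintro ⟨n, rfl⟩ ⟨k, rfl⟩; exact ⟨n - k, by push_cast; ring⟩
lemma IsInt.mul {a b : ℝ} : IsInt a → IsInt b → IsInt (a * b) := by
  rintro ⟨n, rfl⟩ ⟨k, rfl⟩; exact ⟨n * k, by push_cast; ring⟩
lemma IsInt.int (n : ℤ) : IsInt n := ⟨n, rfl⟩
lemma IsInt.nat (n : ℕ) : IsInt n := ⟨n, by simp⟩
lemma IsInt.zero : IsInt 0 := ⟨0, by simp⟩

section D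
variable {E : Type*} [NormedAddCommGroup E] [InnerProductSpace ℝ E] {Φ : Set E}

lemma isInt_closure {P : Set E} {x : E} (h : ∀ a ∈ P, IsInt ⟪a, x⟫_ℝ) {t : E}
    (ht : t ∈ AddSubgroup.closure P) : IsInt ⟪t, x⟫_ℝ := by
  induction ht using AddSubgroup.closure_induction with
  | mem a ha => exact h a ha
  | zero => rw [inner_zero_left]; exact IsInt.zero
  | add a b _ _ ha hb => rw [inner_add_left]; exact ha.add hb
  | neg a _ ha => rw [inner_neg_left]; exact ha.neg

variable {κ : Type*} [Fintype κ] {u : κ → E} {m : κ → ℕ} {o : κ}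

lemma Aff.latt (hA : Aff Φ u m o) {t : E} (ht : t ∈ AddSubgroup.closure Φ) :
    ∃ c : κ → ℤ, c o = 0 ∧ t = ∑ k, c k • u k := by
  induction ht using AddSubgroup.closure_induction with
  | mem a ha => obtain ⟨c, h1, h2, _⟩ := hA.coef a ha; exact ⟨c, h1, h2⟩
  | zero => exact ⟨0, rfl, by simp⟩
  | add a b _ _ ha hb =>
    obtain ⟨c, h1, h2⟩ := ha
    obtain ⟨d, h3, h4⟩ := hb
    refine ⟨c + d, by simp [h1, h3], ?_⟩
    rw [h2, h4, ← Finset.sum_add_distrib]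
    exact Finset.sum_congr rfl fun k _ => by rw [Pi.add_apply, add_smul]
  | neg a _ ha =>
    obtain ⟨c, h1, h2⟩ := ha
    refine ⟨-c, by simp [h1], ?_⟩
    rw [h2, ← Finset.sum_neg_distrib]
    exact Finset.sum_congr rfl fun k _ => by rw [Pi.neg_apply, neg_smul]

/-- step (a) -/
lemma Aff.stepa [FiniteDimensional ℝ E] (hA : Aff Φ u m o) {P : Set E} (hP : P ⊆ Φ) {t : E}
    (ht : t ∈ AddSubgroup.closure Φ) {e : ℕ} (he : 0 < e)
    (hord : ∀ k : ℤ, k • t ∈ AddSubgroup.closure P ↔ (e : ℤ) ∣ k) :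
    ∃ x : E, (∀ a ∈ P, IsInt ⟪a, x⟫_ℝ) ∧ ∀ k : ℤ, IsInt (k * ⟪t, x⟫_ℝ) → (e : ℤ) ∣ k := by
  obtain ⟨χ, h1, h2⟩ := exists_char _ t e he hord
  have hr : ∀ k, ∃ r : ℝ, (r : UnitAddCircle) = χ (u k) := fun k =>
    QuotientAddGroup.mk_surjective _
  choose r hr using hr
  obtain ⟨x, hx⟩ := hA.solve r
  have key : ∀ s ∈ AddSubgroup.closure Φ, ((⟪s, x⟫_ℝ : ℝ) : UnitAddCircle) = χ s := by
    intro s hs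
    obtain ⟨c, h0, rfl⟩ := hA.latt hs
    rw [inner_zsum, map_sum]
    rw [QuotientAddGroup.mk_sum]
    apply Finset.sum_congr rfl
    intro k _
    by_cases hk : k = o
    · subst hk; rw [h0]; simp
    · rw [hx k hk, map_zsmul, ← hr, ← zsmul_eq_mul]; rfl
  have hz : ∀ r : ℝ, (r : UnitAddCircle) = 0 ↔ IsInt r := by
    intro r
    rw [AddCircle.coe_eq_zero_iff]
    constructor
    · rintro ⟨n, hn⟩; exact ⟨n, by rw [← hn]; simp⟩
    · rintro ⟨n, hn⟩; exact ⟨n, by rw [hn]; simp⟩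
  refine ⟨x, fun a ha => ?_, fun k hk => h2 k ?_⟩
  · rw [← hz, key a (AddSubgroup.subset_closure (hP ha))]
    exact h1 a (AddSubgroup.subset_closure ha)
  · rw [← key t ht]
    rw [← hz, ← zsmul_eq_mul] at hk
    exact hk

/-- step (b) -/
lemma stepb [FiniteDimensional ℝ E] (h : RSys Φ) (P : Set E) (x : E) :
    ∃ x' : E, (∀ t ∈ Submodule.span ℝ P, ⟪t, x'⟫_ℝ = ⟪t, x⟫_ℝ) ∧
      ∀ a ∈ Φ, IsInt ⟪a, x'⟫_ℝ → a ∈ Submodule.span ℝ P := by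
  set V := Submodule.span ℝ P with hV
  haveI : Finite {a // a ∈ Φ ∧ a ∉ V} := (h.fin.subset (fun a ha => ha.1) : {a | a ∈ Φ ∧ a ∉ V}.Finite)
  obtain ⟨f, hf⟩ := Module.exists_dual_forall_apply_ne_zero (K := ℝ)
    (fun a : {a // a ∈ Φ ∧ a ∉ V} => Vᗮ.orthogonalProjection (a : E)) (fun a ha => a.2.2 (by
      rw [Submodule.orthogonalProjection_eq_zero_iff] at ha
      rwa [Submodule.orthogonal_orthogonal] at ha))
  let y0 : Vᗮ := (InnerProductSpace.toDual ℝ Vᗮ).symm (LinearMap.toContinuousLinearMap f)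
  have hy0 : ∀ a : E, ⟪a, (y0 : E)⟫_ℝ = f (Vᗮ.orthogonalProjection a) := by
    intro a
    have : f (Vᗮ.orthogonalProjection a) = ⟪y0, Vᗮ.orthogonalProjection a⟫_ℝ := by
      simp only [y0]
      rw [InnerProductSpace.toDual_symm_apply]; rfl
    rw [this, real_inner_comm]
    rw [Submodule.coe_inner]
    exact (Submodule.inner_orthogonalProjection_eq_of_mem_left y0 a).symm
  have hc : (⋃ a : {a // a ∈ Φ ∧ a ∉ V}, ⋃ n : ℤ, {s : ℝ | ⟪(a:E), x⟫_ℝ + s * ⟪(a:E), (y0 : E)⟫_ℝ = n}).Countable := by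
    apply Set.countable_iUnion; intro a
    apply Set.countable_iUnion; intro n
    apply Set.Subsingleton.countable
    intro s hs s' hs'
    have : ⟪(a:E), (y0 : E)⟫_ℝ ≠ 0 := by rw [hy0]; exact hf a
    simp only [Set.mem_setOf_eq] at hs hs'
    apply mul_right_cancel₀ this
    linarith
  obtain ⟨s, hs⟩ := (hc.dense_compl ℝ).nonempty
  simp only [Set.mem_compl_iff, Set.mem_iUnion, not_exists, Set.mem_setOf_eq] at hs
  refine ⟨x + s • (y0 : E), fun t ht => ?_, fun a ha hi => ?_⟩
  · rw [inner_add_right, real_inner_smul_right, (Submodule.mem_orthogonal V _).1 y0.2 t ht]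
    simp
  · by_contra hna
    obtain ⟨n, hn⟩ := hi
    apply hs ⟨a, ha, hna⟩ n
    rw [← hn, inner_add_right, real_inner_smul_right]

end D
end TS

namespace TS
open scoped InnerProductSpace
section F
variable {E : Type*} [NormedAddCommGroup E] [InnerProductSpace ℝ E] {Φ : Set E}
variable {κ : Type*} [Fintype κ] {u : κ → E} {m : κ → ℕ} {o : κ}

/-- step (c): finiteness of the orbit in a ball -/
lemma orbit_fin (h : RSys Φ) (hsp : Submodule.span ℝ Φ = ⊤) (x y : E) (R : ℝ) :
    {z : E | ‖z - y‖ ≤ R ∧ ∀ a ∈ Φ, ∃ b ∈ Φ, IsInt (⟪a, z⟫_ℝ - ⟪b, x⟫_ℝ)}.Finite := by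
  have hfin : Finite Φ := h.fin
  have hR : ∃ C : ℕ, ∀ a ∈ Φ, ∀ b ∈ Φ, ‖a‖ * (R + ‖y‖) + |⟪b, x⟫_ℝ| ≤ C := by
    have h1 := (h.fin.image (fun a => ‖a‖ * (R + ‖y‖))).bddAbove
    have h2 := (h.fin.image (fun b => |⟪b, x⟫_ℝ|)).bddAbove
    obtain ⟨c1, hc1⟩ := h1
    obtain ⟨c2, hc2⟩ := h2
    obtain ⟨C, hC⟩ := exists_nat_ge (c1 + c2)
    refine ⟨C, fun a ha b hb => ?_⟩
    have := hc1 ⟨a, ha, rfl⟩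
    have := hc2 ⟨b, hb, rfl⟩
    simp only at *
    linarith
  obtain ⟨C, hC⟩ := hR
  let F : Set ℝ := ((fun p : E × ℤ => ⟪p.1, x⟫_ℝ + p.2) '' (Φ ×ˢ Set.Icc (-(C:ℤ)) C))
  have hF : F.Finite := (h.fin.prod (Set.finite_Icc _ _)).image _
  have hpi : (Set.pi Set.univ (fun _ : Φ => F)).Finite := Set.Finite.pi' (fun _ => hF) |>.subset (by
    intro f hf a; exact hf a trivial)
  apply Set.Finite.of_finite_image (f := fun z : E => fun a : Φ => ⟪(a : E), z⟫_ℝ)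
  · apply hpi.subset
    rintro _ ⟨z, ⟨hz, hz2⟩, rfl⟩ a _
    obtain ⟨b, hb, n, hn⟩ := hz2 a a.2
    refine ⟨(b, n), ⟨hb, ?_⟩, by simp only; linarith⟩
    have hzn : ‖z‖ ≤ R + ‖y‖ := by
      calc ‖z‖ = ‖(z - y) + y‖ := by rw [sub_add_cancel]
        _ ≤ ‖z - y‖ + ‖y‖ := norm_add_le _ _
        _ ≤ _ := by linarith
    have h1 : |⟪(a:E), z⟫_ℝ| ≤ ‖(a:E)‖ * (R + ‖y‖) :=
      (abs_real_inner_le_norm _ _).trans (mul_le_mul_of_nonneg_left hzn (norm_nonneg _))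
    have h2 : |(n:ℝ)| ≤ C := by
      rw [← hn]
      exact (abs_sub _ _).trans ((add_le_add h1 le_rfl).trans (hC a a.2 b hb))
    rw [abs_le] at h2
    constructor
    · have := h2.1; exact_mod_cast this
    · have := h2.2; exact_mod_cast this
  · intro z _ z' _ hzz
    have : ∀ a ∈ Submodule.span ℝ Φ, ⟪a, z - z'⟫_ℝ = 0 := by
      intro a ha
      induction ha using Submodule.span_induction with
      | mem a ha =>
        rw [inner_sub_right]
        have := congrFun hzz ⟨a, ha⟩
        simp only at this
        linarith
      | zero => simp
      | add a b _ _ ha hb => rw [inner_add_left, ha, hb, add_zero]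
      | smul c a _ ha => rw [real_inner_smul_left, ha, mul_zero]
    have h0 := this (z - z') (by rw [hsp]; trivial)
    exact sub_eq_zero.1 (inner_self_eq_zero.1 h0)

lemma Aff.stepc [FiniteDimensional ℝ E] (h : RSys Φ) (hsp : Submodule.span ℝ Φ = ⊤)
    (hA : Aff Φ u m o) (x : E) :
    ∃ (g : E ≃ₗᵢ[ℝ] E) (z : E), (∀ a, g a ∈ Φ ↔ a ∈ Φ) ∧
      (∀ a ∈ Φ, IsInt (⟪g a, z⟫_ℝ - ⟪a, x⟫_ℝ)) ∧ (∀ k, k ≠ o → 0 ≤ ⟪u k, z⟫_ℝ) ∧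
      -1 ≤ ⟪u o, z⟫_ℝ := by
  classical
  let δ : κ → ℤ := fun k => if k = o then 1 else 0
  -- point in the alcove
  obtain ⟨y, hy⟩ : ∃ y : E, ∀ k, -(δ k : ℝ) < ⟪u k, y⟫_ℝ := by
    have hM : (0:ℝ) ≤ ∑ k, (m k : ℝ) := Finset.sum_nonneg fun k _ => by positivity
    obtain ⟨y, hy⟩ := hA.solve (fun _ => 1 / (1 + ∑ k, (m k : ℝ)))
    have hpos : 0 < 1 / (1 + ∑ k, (m k : ℝ)) := by positivity
    refine ⟨y, fun k => ?_⟩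
    by_cases hk : k = o
    · subst hk
      simp only [δ, if_true]
      have h0 : ⟪∑ i, m i • u i, y⟫_ℝ = 0 := by rw [hA.rel, inner_zero_left]
      rw [sum_nsmul_cast, sum_inner] at h0
      simp only [real_inner_smul_left] at h0
      rw [← Finset.add_sum_erase _ _ (Finset.mem_univ k), hA.mo] at h0
      have h1 : ∑ i ∈ Finset.univ.erase k, (m i : ℝ) * ⟪u i, y⟫_ℝ =
          (∑ i ∈ Finset.univ.erase k, (m i : ℝ)) * (1 / (1 + ∑ k, (m k : ℝ))) := by
        rw [Finset.sum_mul]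
        exact Finset.sum_congr rfl fun i hi => by rw [hy i (Finset.ne_of_mem_erase hi)]
      rw [h1] at h0
      have h2 : ∑ i ∈ Finset.univ.erase k, (m i : ℝ) ≤ ∑ i, (m i : ℝ) :=
        Finset.sum_le_sum_of_subset_of_nonneg (Finset.subset_univ _) fun i _ _ => by positivity
      have h3 : (∑ i ∈ Finset.univ.erase k, (m i : ℝ)) * (1 / (1 + ∑ k, (m k : ℝ))) < 1 := by
        rw [mul_one_div, div_lt_one (by positivity)]; linarith
      push_cast at h0 ⊢
      linarith
    · rw [hy k hk]; simp only [δ, if_neg hk]; push_cast; linarith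
  let O : Set E := {z | ∃ g : E ≃ₗᵢ[ℝ] E, (∀ a, g a ∈ Φ ↔ a ∈ Φ) ∧
      (∀ a ∈ Φ, IsInt (⟪g a, z⟫_ℝ - ⟪a, x⟫_ℝ))}
  have hxO : x ∈ O := ⟨LinearIsometryEquiv.refl ℝ E, fun a => Iff.rfl, fun a _ => by
    simp only [LinearIsometryEquiv.coe_refl, id, sub_self]; exact IsInt.zero⟩
  have hOf : {z | z ∈ O ∧ ‖z - y‖ ≤ ‖x - y‖}.Finite := by
    apply (orbit_fin h hsp x y ‖x - y‖).subset
    rintro z ⟨⟨g, hg1, hg2⟩, hz⟩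
    refine ⟨hz, fun a ha => ⟨g.symm a, ?_, ?_⟩⟩
    · rw [← hg1]; simpa using ha
    · have := hg2 (g.symm a) (by rw [← hg1]; simpa using ha)
      simpa using this
  obtain ⟨z, ⟨⟨g, hg1, hg2⟩, hz⟩, hmin⟩ := Set.exists_min_image _ (fun z => ‖z - y‖) hOf ⟨x, hxO, le_rfl⟩
  have key : ∀ k, -(δ k : ℝ) ≤ ⟪u k, z⟫_ℝ := by
    intro k
    by_contra hc; push Not at hc
    have pk := h.pos (hA.mem k)
    let lam : ℝ := -2 * (⟪u k, z⟫_ℝ + δ k) / ⟪u k, u k⟫_ℝ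
    have hlam : 0 < lam := by
      apply div_pos _ pk; linarith
    have hlk : lam * ⟪u k, u k⟫_ℝ = -2 * (⟪u k, z⟫_ℝ + δ k) := div_mul_cancel₀ _ pk.ne'
    let z' := z + lam • u k
    have hO' : z' ∈ O := by
      have hs : ∀ a ∈ Φ, (ℝ ∙ u k)ᗮ.reflection a ∈ Φ := by
        intro a ha
        obtain ⟨n, hn, hm⟩ := h.refl a ha (u k) (hA.mem k)
        rw [refl_apply]
        rw [hn, mul_div_cancel_right₀ _ pk.ne', Int.cast_smul_eq_zsmul]
        exact hm
      refine ⟨g.trans (ℝ ∙ u k)ᗮ.reflection, fun a => ?_, fun a ha => ?_⟩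
      · rw [LinearIsometryEquiv.trans_apply, ← hg1 a]
        refine ⟨fun hh => ?_, hs _⟩
        have := hs _ hh
        rwa [Submodule.reflection_reflection] at this
      · rw [LinearIsometryEquiv.trans_apply]
        obtain ⟨n, hn, hm⟩ := h.refl (g a) ((hg1 a).2 ha) (u k) (hA.mem k)
        have : ⟪(ℝ ∙ u k)ᗮ.reflection (g a), z'⟫_ℝ = ⟪g a, z⟫_ℝ + (n * δ k : ℤ) := by
          rw [refl_apply, hn, mul_div_cancel_right₀ _ pk.ne']
          simp only [z', inner_sub_left, inner_add_right, real_inner_smul_left,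
            real_inner_smul_right]
          have e1 : 2 * (lam * ⟪g a, u k⟫_ℝ) = n * (lam * ⟪u k, u k⟫_ℝ) := by
            linear_combination lam * hn
          push_cast
          linear_combination e1 / 2 - lam * hn + lam * hn - n * hlk / 2 
        rw [this]
        have := (hg2 a ha).add (IsInt.int (n * δ k))
        convert this using 1; ring
    have hlt : ‖z' - y‖ < ‖z - y‖ := by
      rw [← sq_lt_sq₀ (norm_nonneg _) (norm_nonneg _)]
      have e : z' - y = (z - y) + lam • u k := by simp only [z']; abel
      rw [e, ← real_inner_self_eq_norm_sq, ← real_inner_self_eq_norm_sq, real_inner_add_add_self,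
        real_inner_smul_right, real_inner_smul_right, real_inner_smul_left, hlk]
      have e2 : ⟪z - y, u k⟫_ℝ = ⟪u k, z⟫_ℝ - ⟪u k, y⟫_ℝ := by
        rw [real_inner_comm, inner_sub_right]
      rw [e2]
      have := hy k
      nlinarith
    exact absurd (hmin z' ⟨hO', hlt.le.trans hz⟩) (not_le.2 hlt)
  refine ⟨g, z, hg1, hg2, fun k hk => ?_, ?_⟩
  · have := key k; simpa [δ, hk] using this
  · have := key o; simpa [δ] using this

end F
end TS

namespace TS
open scoped InnerProductSpace
section G
variable {E : Type*} [NormedAddCommGroup E] [InnerProductSpace ℝ E] {Φ : Set E}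
variable {κ : Type*} [Fintype κ] {u : κ → E} {m : κ → ℕ} {o : κ}

lemma span_coeff {S : Set κ} {t : E} (ht : t ∈ Submodule.span ℝ (u '' S)) :
    ∃ r : κ → ℝ, (∀ k, k ∉ S → r k = 0) ∧ t = ∑ k, r k • u k := by
  classical
  induction ht using Submodule.span_induction with
  | mem a ha =>
    obtain ⟨k, hk, rfl⟩ := ha
    refine ⟨Pi.single k 1, fun i hi => ?_, by simp [Pi.single_apply, ite_smul]⟩
    have : i ≠ k := fun hh => hi (hh ▸ hk)
    simp [this]
  | zero => exact ⟨0, fun _ _ => rfl, by simp⟩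
  | add a b _ _ ha hb =>
    obtain ⟨c, h1, h2⟩ := ha
    obtain ⟨d, h3, h4⟩ := hb
    refine ⟨c + d, fun k hk => by simp [h1 k hk, h3 k hk], ?_⟩
    rw [h2, h4, ← Finset.sum_add_distrib]
    exact Finset.sum_congr rfl fun k _ => by rw [Pi.add_apply, add_smul]
  | smul s a _ ha =>
    obtain ⟨c, h1, h2⟩ := ha
    refine ⟨s • c, fun k hk => by simp [h1 k hk], ?_⟩
    rw [h2, Finset.smul_sum]
    exact Finset.sum_congr rfl fun k _ => by rw [Pi.smul_apply, smul_assoc]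

lemma closure_coeff {S : Set κ} {t : E} (ht : t ∈ AddSubgroup.closure (u '' S)) :
    ∃ r : κ → ℤ, (∀ k, k ∉ S → r k = 0) ∧ t = ∑ k, r k • u k := by
  classical
  induction ht using AddSubgroup.closure_induction with
  | mem a ha =>
    obtain ⟨k, hk, rfl⟩ := ha
    refine ⟨Pi.single k 1, fun i hi => ?_, by simp [Pi.single_apply, ite_smul]⟩
    have : i ≠ k := fun hh => hi (hh ▸ hk)
    simp [this]
  | zero => exact ⟨0, fun _ _ => rfl, by simp⟩
  | add a b _ _ ha hb =>
    obtain ⟨c, h1, h2⟩ := ha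
    obtain ⟨d, h3, h4⟩ := hb
    refine ⟨c + d, fun k hk => by simp [h1 k hk, h3 k hk], ?_⟩
    rw [h2, h4, ← Finset.sum_add_distrib]
    exact Finset.sum_congr rfl fun k _ => by rw [Pi.add_apply, add_smul]
  | neg a _ ha =>
    obtain ⟨c, h1, h2⟩ := ha
    refine ⟨-c, fun k hk => by simp [h1 k hk], ?_⟩
    rw [h2, ← Finset.sum_neg_distrib]
    exact Finset.sum_congr rfl fun k _ => by rw [Pi.neg_apply, neg_smul]

lemma mem_closure_of_coeff {S : Set κ} (r : κ → ℤ) (h : ∀ k, k ∉ S → r k = 0) :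
    ∑ k, r k • u k ∈ AddSubgroup.closure (u '' S) := by
  apply AddSubgroup.sum_mem
  intro k _
  by_cases hk : k ∈ S
  · exact AddSubgroup.zsmul_mem _ (AddSubgroup.subset_closure (Set.mem_image_of_mem u hk)) _
  · rw [h k hk, zero_smul]; exact AddSubgroup.zero_mem _

lemma closure_le_span (P : Set E) {t : E} (ht : t ∈ AddSubgroup.closure P) :
    t ∈ Submodule.span ℝ P := by
  have : AddSubgroup.closure P ≤ (Submodule.span ℝ P).toAddSubgroup := by
    rw [AddSubgroup.closure_le]; exact Submodule.subset_span
  exact this ht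

lemma Aff.S1 [FiniteDimensional ℝ E] (h : RSys Φ) (hsp : Submodule.span ℝ Φ = ⊤)
    (hA : Aff Φ u m o) {P : Set E} (hP : P ⊆ Φ) {t : E}
    (ht : t ∈ AddSubgroup.closure Φ) {e : ℕ} (he : 2 ≤ e)
    (hord : ∀ k : ℤ, k • t ∈ AddSubgroup.closure P ↔ (e : ℤ) ∣ k) :
    ∃ (g : E ≃ₗᵢ[ℝ] E) (x : E) (J : Finset κ), (∀ a, g a ∈ Φ ↔ a ∈ Φ) ∧ o ∉ J ∧ J.Nonempty ∧
      (∀ j ∈ J, e ∣ m j) ∧ (∀ a ∈ P, g a ∈ AddSubgroup.closure (u '' {k | k ∉ J})) ∧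
      (∀ k, k ∉ J → u k ∈ Submodule.span ℝ (g '' P)) ∧
      (∀ s ∈ AddSubgroup.closure Φ, s ∈ Submodule.span ℝ P →
        (IsInt ⟪g s, x⟫_ℝ → g s ∈ AddSubgroup.closure (u '' {k | k ∉ J})) ∧
        ∀ j ∈ J, IsInt (m j * ⟪g s, x⟫_ℝ)) ∧
      (∀ k : ℤ, IsInt (k * ⟪g t, x⟫_ℝ) → (e : ℤ) ∣ k) ∧ (∀ k, k ∉ J → IsInt ⟪u k, x⟫_ℝ) := by
  classical
  obtain ⟨x1, hx1, hx1t⟩ := hA.stepa hP ht (by omega) hord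
  obtain ⟨x0, hx0, hx0g⟩ := stepb h P x1
  have htP : t ∈ Submodule.span ℝ P := by
    have h1 := closure_le_span P ((hord e).2 dvd_rfl)
    have h2 : t = (e : ℝ)⁻¹ • ((e : ℤ) • t) := by
      rw [← Int.cast_smul_eq_zsmul ℝ, smul_smul]
      push_cast
      rw [inv_mul_cancel₀ (by positivity), one_smul]
    rw [h2]; exact Submodule.smul_mem _ _ h1
  obtain ⟨g, x, hg, hgx, hx, hxo⟩ := hA.stepc h hsp x0
  have hPint : ∀ a ∈ P, IsInt ⟪g a, x⟫_ℝ := by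
    intro a ha
    have h1 := (hgx a (hP ha)).add (hx1 a ha)
    rw [hx0 a (Submodule.subset_span ha)] at h1
    convert h1 using 1; ring
  have hΛ : ∀ s ∈ AddSubgroup.closure Φ, IsInt (⟪g s, x⟫_ℝ - ⟪s, x0⟫_ℝ) := by
    intro s hs
    induction hs using AddSubgroup.closure_induction with
    | mem a ha => exact hgx a ha
    | zero => simp only [map_zero, inner_zero_left, sub_zero]; exact IsInt.zero
    | add a b _ _ ha hb =>
      rw [map_add, inner_add_left, inner_add_left]
      convert ha.add hb using 1; ring
    | neg a _ ha =>
      rw [map_neg, inner_neg_left, inner_neg_left]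
      convert ha.neg using 1; ring
  have hgt : ∀ k : ℤ, IsInt (k * ⟪g t, x⟫_ℝ) → (e : ℤ) ∣ k := by
    intro k hk
    apply hx1t k
    have := hk.sub ((IsInt.int k).mul (hΛ t ht))
    rw [hx0 t htP] at this
    convert this using 1; ring
  have hrel : ∑ k, (m k : ℝ) * ⟪u k, x⟫_ℝ = 0 := by
    have h0 : ⟪∑ i, m i • u i, x⟫_ℝ = 0 := by rw [hA.rel, inner_zero_left]
    rw [sum_nsmul_cast, sum_inner] at h0
    simpa only [real_inner_smul_left] using h0
  have hrel' : ∑ k ∈ Finset.univ.erase o, (m k : ℝ) * ⟪u k, x⟫_ℝ = - ⟪u o, x⟫_ℝ := by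
    rw [← Finset.add_sum_erase _ _ (Finset.mem_univ o), hA.mo] at hrel
    push_cast at hrel; linarith
  have hval : ∀ c : κ → ℤ, c o = 0 → ⟪∑ k, c k • u k, x⟫_ℝ =
      ∑ k ∈ Finset.univ.erase o, (c k : ℝ) * ⟪u k, x⟫_ℝ := by
    intro c hc
    rw [inner_zsum, ← Finset.add_sum_erase _ _ (Finset.mem_univ o), hc]; simp
  -- values of positive roots
  have hbd : ∀ c : κ → ℤ, c o = 0 → (∀ k, 0 ≤ c k ∧ c k ≤ m k) →
      0 ≤ ⟪∑ k, c k • u k, x⟫_ℝ ∧ ⟪∑ k, c k • u k, x⟫_ℝ ≤ - ⟪u o, x⟫_ℝ := by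
    intro c hc hcm
    rw [hval c hc, ← hrel']
    constructor
    · exact Finset.sum_nonneg fun k hk => mul_nonneg (by exact_mod_cast (hcm k).1)
        (hx k (Finset.ne_of_mem_erase hk))
    · exact Finset.sum_le_sum fun k hk => mul_le_mul_of_nonneg_right (by exact_mod_cast (hcm k).2)
        (hx k (Finset.ne_of_mem_erase hk))
  have hsgn : ∀ a ∈ Φ, ∃ c : κ → ℤ, c o = 0 ∧ (∀ k, 0 ≤ c k ∧ c k ≤ m k) ∧
      (a = ∑ k, c k • u k ∨ a = - ∑ k, c k • u k) := by
    intro a ha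
    obtain ⟨c, h1, h2, h3 | h3⟩ := hA.coef a ha
    · exact ⟨c, h1, h3, Or.inl h2⟩
    · refine ⟨-c, by simp [h1], fun k => ?_, Or.inr ?_⟩
      · have := h3 k; simp only [Pi.neg_apply]; omega
      · rw [h2, ← Finset.sum_neg_distrib]
        exact Finset.sum_congr rfl fun k _ => by rw [Pi.neg_apply, neg_smul, neg_neg]
  have hxo1 : ⟪u o, x⟫_ℝ = -1 := by
    by_contra hne
    have hlt : - ⟪u o, x⟫_ℝ < 1 := by
      rcases lt_or_eq_of_le hxo with hh | hh
      · linarith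
      · exact absurd hh.symm hne
    have hz : ∀ a ∈ P, ⟪g a, x⟫_ℝ = 0 := by
      intro a ha
      obtain ⟨n, hn⟩ := hPint a ha
      obtain ⟨c, h1, h2, h3⟩ := hsgn (g a) ((hg a).2 (hP ha))
      have h4 := hbd c h1 h2
      have habs : |(n : ℝ)| < 1 := by
        rw [← hn]
        rcases h3 with h3 | h3
        · rw [h3, abs_lt]; constructor <;> linarith
        · rw [h3, inner_neg_left, abs_lt]; constructor <;> linarith
      have : n = 0 := by
        have : |n| < 1 := by exact_mod_cast habs
        exact Int.abs_lt_one_iff.1 this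
      rw [hn, this]; simp
    have hz2 : ∀ s ∈ Submodule.span ℝ P, ⟪g s, x⟫_ℝ = 0 := by
      intro s hs
      induction hs using Submodule.span_induction with
      | mem a ha => exact hz a ha
      | zero => simp
      | add a b _ _ ha hb => rw [map_add, inner_add_left, ha, hb, add_zero]
      | smul c a _ ha => rw [map_smul, real_inner_smul_left, ha, mul_zero]
    have := hgt 1 (by rw [hz2 t htP, mul_zero]; exact IsInt.zero)
    have := Int.le_of_dvd one_pos this
    omega
  let J : Finset κ := Finset.univ.filter (fun k => k ≠ o ∧ ⟪u k, x⟫_ℝ ≠ 0)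
  have hJ : ∀ k, k ∈ J ↔ k ≠ o ∧ ⟪u k, x⟫_ℝ ≠ 0 := by intro k; simp [J]
  have hoJ : o ∉ J := by rw [hJ]; simp
  have hJpos : ∀ k ∈ J, 0 < ⟪u k, x⟫_ℝ := fun k hk =>
    lt_of_le_of_ne (hx k ((hJ k).1 hk).1) ((hJ k).1 hk).2.symm
  have hspan : ∀ k, k ∉ J → u k ∈ Submodule.span ℝ (g '' P) := by
    intro k hk
    have hi : IsInt ⟪u k, x⟫_ℝ := by
      by_cases hko : k = o
      · rw [hko, hxo1]; exact ⟨-1, by simp⟩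
      · have : ⟪u k, x⟫_ℝ = 0 := by
          by_contra hh; exact hk ((hJ k).2 ⟨hko, hh⟩)
        rw [this]; exact IsInt.zero
    have ha : g.symm (u k) ∈ Φ := by rw [← hg]; simpa using hA.mem k
    have h1 := hΛ _ (AddSubgroup.subset_closure ha)
    simp only [LinearIsometryEquiv.apply_symm_apply] at h1
    have h2 := hx0g _ ha (by convert hi.sub h1 using 1; ring)
    have h3 := Submodule.mem_map_of_mem (f := (g.toLinearEquiv : E →ₗ[ℝ] E)) h2
    rw [Submodule.map_span] at h3
    simpa using h3
  have hroot : ∀ a ∈ P, g a ∈ AddSubgroup.closure (u '' {k | k ∉ J}) := by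
    intro a ha
    obtain ⟨c, h1, h2, h3⟩ := hsgn (g a) ((hg a).2 (hP ha))
    have h4 := hbd c h1 h2
    have h5 : IsInt ⟪∑ k, c k • u k, x⟫_ℝ := by
      have := hPint a ha
      rcases h3 with h3 | h3
      · rwa [h3] at this
      · rw [h3, inner_neg_left] at this
        simpa using this.neg
    have hmem : ∑ k, c k • u k ∈ AddSubgroup.closure (u '' {k | k ∉ J}) := by
      obtain ⟨n, hn⟩ := h5
      rw [hn, hxo1, neg_neg] at h4
      have hn0 : 0 ≤ n := by exact_mod_cast h4.1
      have hn1 : n ≤ 1 := by exact_mod_cast h4.2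
      have hc : n = 0 ∨ n = 1 := by omega
      rw [hval c h1] at hn
      rcases hc with hc | hc
      · apply mem_closure_of_coeff
        intro k hk
        simp only [Set.mem_setOf_eq, not_not] at hk
        rw [hc, Int.cast_zero] at hn
        have := (Finset.sum_eq_zero_iff_of_nonneg (fun k hk => mul_nonneg (by exact_mod_cast (h2 k).1)
          (hx k (Finset.ne_of_mem_erase hk)))).1 hn k (by simp [((hJ k).1 hk).1])
        have := (mul_eq_zero.1 this).resolve_right (hJpos k hk).ne'
        exact_mod_cast this
      · have e1 : ∑ k, c k • u k = ∑ k, (c k - m k) • u k := by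
          simp only [sub_smul, Finset.sum_sub_distrib]
          have := hA.rel
          simp only [natCast_zsmul]
          rw [this, sub_zero]
        rw [e1]
        apply mem_closure_of_coeff
        intro k hk
        simp only [Set.mem_setOf_eq, not_not] at hk
        rw [hc, Int.cast_one] at hn
        have h6 : ∑ k ∈ Finset.univ.erase o, ((m k : ℝ) - c k) * ⟪u k, x⟫_ℝ = 0 := by
          simp only [sub_mul, Finset.sum_sub_distrib]
          rw [hrel', hn, hxo1]; ring
        have := (Finset.sum_eq_zero_iff_of_nonneg (fun k hk => mul_nonneg
          (by have := (h2 k).2; rw [sub_nonneg]; exact_mod_cast this)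
          (hx k (Finset.ne_of_mem_erase hk)))).1 h6 k (by simp [((hJ k).1 hk).1])
        have := (mul_eq_zero.1 this).resolve_right (hJpos k hk).ne'
        have h7 : (c k : ℝ) = m k := by linarith
        have h8 : c k = m k := by exact_mod_cast h7
        omega
    rcases h3 with h3 | h3
    · rw [h3]; exact hmem
    · rw [h3]; exact AddSubgroup.neg_mem _ hmem
  have hs : ∀ s ∈ AddSubgroup.closure Φ, s ∈ Submodule.span ℝ P →
        (IsInt ⟪g s, x⟫_ℝ → g s ∈ AddSubgroup.closure (u '' {k | k ∉ J})) ∧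
        ∀ j ∈ J, IsInt (m j * ⟪g s, x⟫_ℝ) := by
    intro s hs hsP
    have hgs : g s ∈ AddSubgroup.closure Φ := by
      have : AddSubgroup.closure Φ ≤ (AddSubgroup.closure Φ).comap (g.toLinearEquiv.toLinearMap.toAddMonoidHom) := by
        rw [AddSubgroup.closure_le]
        intro a ha
        exact AddSubgroup.subset_closure ((hg a).2 ha)
      exact this hs
    obtain ⟨c, hc0, hc⟩ := hA.latt hgs
    have hgsp : g s ∈ Submodule.span ℝ (u '' {k | k ∉ J}) := by
      have h3 := Submodule.mem_map_of_mem (f := (g.toLinearEquiv : E →ₗ[ℝ] E)) hsP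
      rw [Submodule.map_span] at h3
      have h4 : Submodule.span ℝ ((g.toLinearEquiv : E →ₗ[ℝ] E) '' P) ≤ Submodule.span ℝ (u '' {k | k ∉ J}) := by
        rw [Submodule.span_le]
        rintro _ ⟨a, ha, rfl⟩
        exact closure_le_span _ (hroot a ha)
      exact h4 h3
    obtain ⟨r, hr0, hr⟩ := span_coeff hgsp
    have hv : ⟪g s, x⟫_ℝ = - r o := by
      rw [hr, sum_inner, Finset.sum_eq_single o]
      · rw [real_inner_smul_left, hxo1]; ring
      · intro k _ hk
        rw [real_inner_smul_left]
        by_cases hkJ : k ∈ J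
        · rw [hr0 k (by simpa using hkJ), zero_mul]
        · have : ⟪u k, x⟫_ℝ = 0 := by
            by_contra hh; exact hkJ ((hJ k).2 ⟨hk, hh⟩)
          rw [this, mul_zero]
      · simp
    have hli := hA.li (fun k => c k - r k) (by
      simp only [sub_smul, Finset.sum_sub_distrib]
      rw [← sum_zsmul_cast, ← hc, ← hr, sub_self])
    have hli' : ∀ j ∈ J, (c j : ℝ) = m j * ⟪g s, x⟫_ℝ := by
      intro j hj
      have := hli j
      simp only [hc0, hr0 j (by simpa using hj)] at this
      rw [hv]; push_cast at this; linarith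
    refine ⟨?_, fun j hj => ⟨c j, (hli' j hj).symm⟩⟩
    rintro ⟨n, hn⟩
    have e1 : g s = ∑ k, (c k - n * m k) • u k := by
      simp only [sub_smul, Finset.sum_sub_distrib, mul_smul, ← Finset.smul_sum]
      have := hA.rel
      simp only [natCast_zsmul]
      rw [this, smul_zero, sub_zero]; exact hc
    rw [e1]
    apply mem_closure_of_coeff
    intro k hk
    simp only [Set.mem_setOf_eq, not_not] at hk
    have := hli' k hk
    rw [hn] at this
    have h8 : c k = m k * n := by exact_mod_cast this
    rw [h8]; ring
  have hlast : ∀ k, k ∉ J → IsInt ⟪u k, x⟫_ℝ := by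
    intro k hk
    by_cases hko : k = o
    · subst hko; rw [hxo1]; exact ⟨-1, by simp⟩
    · have : ⟪u k, x⟫_ℝ = 0 := by
        by_contra hh; exact hk ((hJ k).2 ⟨hko, hh⟩)
      rw [this]; exact IsInt.zero
  refine ⟨g, x, J, hg, hoJ, ?_, ?_, hroot, hspan, hs, hgt, hlast⟩
  · by_contra hne
    rw [Finset.not_nonempty_iff_eq_empty] at hne
    have : ∑ k ∈ Finset.univ.erase o, (m k : ℝ) * ⟪u k, x⟫_ℝ = 0 := by
      apply Finset.sum_eq_zero
      intro k hk
      have h1 : k ∉ J := by rw [hne]; simp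
      have : ⟪u k, x⟫_ℝ = 0 := by
        by_contra hh; exact h1 ((hJ k).2 ⟨Finset.ne_of_mem_erase hk, hh⟩)
      rw [this, mul_zero]
    rw [hrel', hxo1] at this
    norm_num at this
  · intro j hj
    have := hgt (m j) (by
      have := (hs t ht htP).2 j hj
      simpa using this)
    exact_mod_cast this

end G
end TS

namespace TS

structure Lab {κ : Type*} [Fintype κ] (n : κ → κ → ℕ) (m : κ → ℕ) (o : κ) (q : κ → ℝ) : Prop where
  qpos : ∀ j, 0 < q j
  sym : ∀ i j, n i j * q j = n j i * q i
  bal : ∀ j, ∑ i, m i * n i j = 2 * m j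
  diag : ∀ j, n j j = 0
  mo : m o = 1
  m1 : ∀ k, 1 ≤ m k
  long : ∀ j, q j ≤ q o
  conn : ∀ S : Set κ, o ∈ S → (∀ i ∈ S, ∀ j, j ∉ S → n i j = 0) → ∀ k, k ∈ S

section H
variable {κ : Type*} [Fintype κ] {n : κ → κ → ℕ} {m : κ → ℕ} {o : κ} {q : κ → ℝ}

def IsT (n : κ → κ → ℕ) (m : κ → ℕ) (o : κ) {d : ℕ} (M : Fin (d+1) → ℕ)
    (T : Fin (d+1) → Fin (d+1) → ℕ) : Prop :=
  ∃ e : Fin (d+1) ≃ κ, e 0 = o ∧ (∀ i, m (e i) = M i) ∧ ∀ i j, n (e i) (e j) = T i j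

lemma Lab.pos_symm (L : Lab n m o q) {i j : κ} (h : 1 ≤ n i j) : 1 ≤ n j i := by
  by_contra hc
  have h0 : n j i = 0 := by omega
  have := L.sym i j
  rw [h0] at this
  have h1 : (1:ℝ) ≤ n i j := by exact_mod_cast h
  have := L.qpos j
  push_cast at *
  nlinarith

lemma Lab.le (L : Lab n m o q) (S : Finset κ) (j : κ) : ∑ i ∈ S, m i * n i j ≤ 2 * m j := by
  rw [← L.bal j]
  exact Finset.sum_le_sum_of_subset (Finset.subset_univ _)

lemma Lab.le1 (L : Lab n m o q) (a j : κ) : m a * n a j ≤ 2 * m j := by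
  have := L.le {a} j; simpa using this

lemma Lab.le2 (L : Lab n m o q) {a b : κ} (hab : a ≠ b) (j : κ) : m a * n a j + m b * n b j ≤ 2 * m j := by
  classical
  have := L.le {a, b} j; rwa [Finset.sum_pair hab] at this

lemma Lab.le3 (L : Lab n m o q) {a b c : κ} (hab : a ≠ b) (hac : a ≠ c) (hbc : b ≠ c) (j : κ) :
    m a * n a j + m b * n b j + m c * n c j ≤ 2 * m j := by
  classical
  have := L.le {a, b, c} j
  rw [Finset.sum_insert (by simp [hab, hac]), Finset.sum_pair hbc] at this
  omega

lemma Lab.next (L : Lab n m o q) (S : Finset κ) (j : κ) (h : ∑ i ∈ S, m i * n i j < 2 * m j) :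
    ∃ w, w ∉ S ∧ 1 ≤ n w j ∧ 1 ≤ n j w := by
  by_contra hc
  push Not at hc
  rw [← L.bal j] at h
  apply h.ne
  apply Finset.sum_subset (Finset.subset_univ _)
  intro w _ hw
  have : n w j = 0 := by
    by_contra h0
    have h1 : 1 ≤ n w j := by omega
    have := hc w hw h1
    have := L.pos_symm h1
    omega
  rw [this, mul_zero]

lemma Lab.next0 (L : Lab n m o q) (j : κ) :
    ∃ w, 1 ≤ n w j ∧ 1 ≤ n j w ∧ m w * n w j ≤ 2 * m j ∧ m j * n j w ≤ 2 * m w := by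
  obtain ⟨w, _, h1, h2⟩ := L.next ∅ j (by have := L.m1 j; simp; omega)
  exact ⟨w, h1, h2, L.le1 _ _, L.le1 _ _⟩

lemma Lab.next1 (L : Lab n m o q) {a : κ} (j : κ) (h : m a * n a j < 2 * m j) :
    ∃ w, w ≠ a ∧ 1 ≤ n w j ∧ 1 ≤ n j w ∧ m a * n a j + m w * n w j ≤ 2 * m j ∧
      m j * n j w ≤ 2 * m w := by
  obtain ⟨w, h0, h1, h2⟩ := L.next {a} j (by simpa using h)
  simp at h0
  exact ⟨w, h0, h1, h2, L.le2 (Ne.symm h0) _, L.le1 _ _⟩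

lemma Lab.next2 (L : Lab n m o q) {a b : κ} (j : κ) (hab : a ≠ b)
    (h : m a * n a j + m b * n b j < 2 * m j) :
    ∃ w, w ≠ a ∧ w ≠ b ∧ 1 ≤ n w j ∧ 1 ≤ n j w ∧
      m a * n a j + m b * n b j + m w * n w j ≤ 2 * m j ∧ m j * n j w ≤ 2 * m w := by
  classical
  obtain ⟨w, h0, h1, h2⟩ := L.next {a, b} j (by rwa [Finset.sum_pair hab])
  simp at h0
  exact ⟨w, h0.1, h0.2, h1, h2, L.le3 hab (Ne.symm h0.1) (Ne.symm h0.2) _, L.le1 _ _⟩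

lemma Lab.assemble (L : Lab n m o q) {d : ℕ} (f : Fin (d+1) → κ) (hf : Function.Injective f)
    (h0 : f 0 = o) (M : Fin (d+1) → ℕ) (T : Fin (d+1) → Fin (d+1) → ℕ) (hM : ∀ i, m (f i) = M i)
    (hT : ∀ i j, T i j ≠ 0 → n (f i) (f j) = T i j)
    (hbal : ∀ j, ∑ i, M i * T i j = 2 * M j) : IsT n m o M T := by
  classical
  have key : ∀ j, (∀ i, n (f i) (f j) = T i j) ∧ ∀ k, k ∉ Set.range f → n k (f j) = 0 := by
    intro j
    have h1 : ∑ k ∈ Finset.univ.image f, m k * n k (f j) = ∑ i, m (f i) * n (f i) (f j) :=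
      Finset.sum_image (fun a _ b _ h => hf h)
    have hle : ∀ i ∈ Finset.univ, M i * T i j ≤ m (f i) * n (f i) (f j) := by
      intro i _
      rw [hM]
      by_cases h : T i j = 0
      · rw [h]; simp
      · rw [hT i j h]
    have h2 : ∑ i, M i * T i j ≤ ∑ i, m (f i) * n (f i) (f j) := Finset.sum_le_sum hle
    have h3 : ∑ k ∈ Finset.univ.image f, m k * n k (f j) ≤ 2 * m (f j) := L.le _ _
    rw [hM, h1, ← hbal j] at h3
    have h4 : ∑ i, M i * T i j = ∑ i, m (f i) * n (f i) (f j) := le_antisymm h2 h3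
    constructor
    · intro i
      have := (Finset.sum_eq_sum_iff_of_le hle).1 h4 i (Finset.mem_univ _)
      rw [hM] at this
      have hp : 0 < M i := by rw [← hM]; exact L.m1 _
      exact (Nat.eq_of_mul_eq_mul_left hp this).symm
    · intro k hk
      have hk' : k ∉ Finset.univ.image f := by simpa using hk
      have h5 := L.le (insert k (Finset.univ.image f)) (f j)
      rw [Finset.sum_insert hk', h1, ← h4, hbal, hM] at h5
      have : m k * n k (f j) = 0 := by omega
      rcases Nat.mul_eq_zero.1 this with h | h
      · have := L.m1 k; omega
      · exact h
  have hsurj : Function.Surjective f := by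
    apply L.conn (Set.range f) ⟨0, h0⟩
    rintro _ ⟨j, rfl⟩ k hk
    have := (key j).2 k hk
    by_contra hc
    have := L.pos_symm (i := f j) (j := k) (by omega)
    omega
  refine ⟨Equiv.ofBijective f ⟨hf, hsurj⟩, h0, hM, fun i j => (key j).1 i⟩

lemma Lab.chain (L : Lab n m o q) {a b : κ} (hb : 7 ≤ m b) (ha : m a + 1 = m b) (hab : 1 ≤ n a b) :
    ∃ c, 1 ≤ n b c ∧ m c = m b + 1 := by
  have h1 := L.le1 a b
  have hn : n a b ≤ 2 := by
    by_contra hc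
    have : m a * 3 ≤ m a * n a b := Nat.mul_le_mul_left _ (by omega)
    omega
  -- dichotomy for the neighbours
  have dich : ∀ c, 1 ≤ n b c → m c ≤ m b + 1 → 2 * m c = m b ∨ 2 * m b ≤ 3 * m c := by
    intro c hc hcm
    have h2 := L.le1 b c
    by_cases hge : m b ≤ m c
    · right; omega
    have hn1 : n b c = 1 := by
      by_contra hne
      have : m b * 2 ≤ m b * n b c := Nat.mul_le_mul_left _ (by omega)
      omega
    rw [hn1] at h2
    by_cases heq : 2 * m c = m b
    · exact Or.inl heq
    right
    obtain ⟨d, hd, hd1, hd2, hd3, hd4⟩ := L.next1 (a := b) c (by rw [hn1]; omega)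
    have h5 : m d * 1 ≤ m d * n d c := Nat.mul_le_mul_left _ hd1
    have h6 : m c * 1 ≤ m c * n c d := Nat.mul_le_mul_left _ hd2
    rw [hn1] at hd3
    omega
  have hbig : ∀ w, m b * n b w ≤ 2 * m w → 1 ≤ n b w → m b ≤ 2 * m w := by
    intro w h1 h2
    have : m b * 1 ≤ m b * n b w := Nat.mul_le_mul_left _ h2
    omega
  by_cases hn2 : n a b = 2
  · exfalso
    obtain ⟨w, hw, hw1, hw2, hw3, hw4⟩ := L.next1 (a := a) b (by rw [hn2]; omega)
    have h6 := hbig w hw4 hw2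
    have h5 : m w * 1 ≤ m w * n w b := Nat.mul_le_mul_left _ hw1
    rw [hn2] at hw3
    omega
  have hn1 : n a b = 1 := by omega
  obtain ⟨c, hc, hc1, hc2, hc3, hc4⟩ := L.next1 (a := a) b (by rw [hn1]; omega)
  rw [hn1] at hc3
  have h5 : m c * 1 ≤ m c * n c b := Nat.mul_le_mul_left _ hc1
  have hbc := hbig c hc4 hc2
  refine ⟨c, hc2, ?_⟩
  by_contra hne
  have hncb : n c b ≤ 2 := by
    by_contra hcc
    have : m c * 3 ≤ m c * n c b := Nat.mul_le_mul_left _ (by omega)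
    omega
  have hex : ∃ d, d ≠ a ∧ d ≠ c ∧ 1 ≤ n d b ∧ 1 ≤ n b d ∧
      m a * n a b + m c * n c b + m d * n d b ≤ 2 * m b ∧ m b * n b d ≤ 2 * m d := by
    apply L.next2 b (Ne.symm hc)
    rw [hn1]
    rcases dich c hc2 (by omega) with h | h
    · have h7 : n c b = 1 ∨ n c b = 2 := by omega
      rcases h7 with h7 | h7 <;> rw [h7] <;> omega
    · have h7 : n c b = 1 := by
        by_contra h8
        have h9 : n c b = 2 := by omega
        rw [h9] at hc3; omega
      rw [h7] at hc3 ⊢; omega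
  obtain ⟨d, hd0, hd00, hd1, hd2, hd3, hd4⟩ := hex
  have hbd := hbig d hd4 hd2
  have h6 : m d * 1 ≤ m d * n d b := Nat.mul_le_mul_left _ hd1
  rw [hn1] at hd3
  rcases dich c hc2 (by omega) with h | h
  · rcases dich d hd2 (by omega) with h' | h'
    · -- third neighbour
      have h7 : n c b = 1 := by
        by_contra h8
        have h9 : n c b = 2 := by omega
        rw [h9] at hd3; omega
      have h7' : n d b = 1 := by
        by_contra h8
        have : m d * 2 ≤ m d * n d b := Nat.mul_le_mul_left _ (by omega)
        rw [h7] at hd3; omega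
      classical
      obtain ⟨w, hw0, hw1, hw2⟩ := L.next {a, c, d} b (by
        rw [Finset.sum_insert (by simp [Ne.symm hc, Ne.symm hd0]), Finset.sum_pair (Ne.symm hd00), hn1, h7, h7']
        omega)
      have hw3 := hbig w (L.le1 _ _) hw2
      simp at hw0
      have h8 := L.le {w, a, c, d} b
      rw [Finset.sum_insert (by simp [hw0]),
        Finset.sum_insert (by simp [Ne.symm hc, Ne.symm hd0]), Finset.sum_pair (Ne.symm hd00), hn1, h7, h7'] at h8
      have : m w * 1 ≤ m w * n w b := Nat.mul_le_mul_left _ hw1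
      omega
    · have : m c * 1 ≤ m c * n c b := Nat.mul_le_mul_left _ hc1
      omega
  · have : m c * 1 ≤ m c * n c b := Nat.mul_le_mul_left _ hc1
    omega

lemma Lab.nochain (L : Lab n m o q) {a b : κ} (hb : 7 ≤ m b) (ha : m a + 1 = m b) (hab : 1 ≤ n a b) :
    False := by
  have key : ∀ k : ℕ, ∃ a b, 7 + k ≤ m b ∧ m a + 1 = m b ∧ 1 ≤ n a b := by
    intro k
    induction k with
    | zero => exact ⟨a, b, hb, ha, hab⟩
    | succ k ih =>
      obtain ⟨a, b, h1, h2, h3⟩ := ih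
      obtain ⟨c, h4, h5⟩ := L.chain (by omega) h2 h3
      exact ⟨b, c, by omega, by omega, h4⟩
  obtain ⟨a, b, h1, h2, h3⟩ := key (∑ k, m k)
  have := Finset.single_le_sum (f := m) (fun i _ => Nat.zero_le _) (Finset.mem_univ b)
  omega

end H
end TS

namespace TS

def MG2 : Fin (2+1) → ℕ := ![1,2,3]
def TG2 : Fin (2+1) → Fin (2+1) → ℕ := ![![0,1,0],![1,0,3],![0,1,0]]
def MBd : Fin (4+1) → ℕ := ![1,2,3,2,1]
def TBd : Fin (4+1) → Fin (4+1) → ℕ :=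
  ![![0,1,0,0,0],![1,0,2,0,0],![0,1,0,1,0],![0,0,1,0,1],![0,0,0,1,0]]
def MF4 : Fin (4+1) → ℕ := ![1,2,3,4,2]
def TF4 : Fin (4+1) → Fin (4+1) → ℕ :=
  ![![0,1,0,0,0],![1,0,1,0,0],![0,1,0,2,0],![0,0,1,0,1],![0,0,0,1,0]]
def ME6 : Fin (6+1) → ℕ := ![1,2,3,2,1,2,1]
def TE6 : Fin (6+1) → Fin (6+1) → ℕ :=
  ![![0,1,0,0,0,0,0],![1,0,1,0,0,0,0],![0,1,0,1,0,1,0],![0,0,1,0,1,0,0],![0,0,0,1,0,0,0],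
    ![0,0,1,0,0,0,1],![0,0,0,0,0,1,0]]
def ME7 : Fin (7+1) → ℕ := ![1,2,3,4,3,2,1,2]
def TE7 : Fin (7+1) → Fin (7+1) → ℕ :=
  ![![0,1,0,0,0,0,0,0],![1,0,1,0,0,0,0,0],![0,1,0,1,0,0,0,0],![0,0,1,0,1,0,0,1],
    ![0,0,0,1,0,1,0,0],![0,0,0,0,1,0,1,0],![0,0,0,0,0,1,0,0],![0,0,0,1,0,0,0,0]]
def ME8 : Fin (8+1) → ℕ := ![1,2,3,4,5,6,4,2,3]
def TE8 : Fin (8+1) → Fin (8+1) → ℕ :=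
  ![![0,1,0,0,0,0,0,0,0],![1,0,1,0,0,0,0,0,0],![0,1,0,1,0,0,0,0,0],![0,0,1,0,1,0,0,0,0],
    ![0,0,0,1,0,1,0,0,0],![0,0,0,0,1,0,1,0,1],![0,0,0,0,0,1,0,1,0],![0,0,0,0,0,0,1,0,0],
    ![0,0,0,0,0,1,0,0,0]]

section I
variable {κ : Type*} [Fintype κ] {n : κ → κ → ℕ} {m : κ → ℕ} {o : κ} {q : κ → ℝ}

lemma inj_of {d : ℕ} (f : Fin (d+1) → κ) (M : Fin (d+1) → ℕ) (hM : ∀ i, m (f i) = M i)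
    (h : ∀ i j, i < j → M i = M j → f i ≠ f j) : Function.Injective f := by
  intro i j hij
  have hMM : M i = M j := by rw [← hM, ← hM, hij]
  rcases lt_trichotomy i j with h1 | h1 | h1
  · exact absurd hij (h i j h1 hMM)
  · exact h1
  · exact absurd hij.symm (h j i h1 hMM.symm)

lemma le_mul1 {a b : ℕ} (h : 1 ≤ b) : a ≤ a * b := Nat.le_mul_of_pos_right _ h

lemma Lab.start (L : Lab n m o q) (h3 : ∃ k, 3 ≤ m k) : ∃ v1 v2, m v1 = 2 ∧ m v2 = 3 ∧
    n v1 o = 1 ∧ n o v1 = 1 ∧ n v2 v1 = 1 ∧ 1 ≤ n v1 v2 := by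
  obtain ⟨k0, hk0⟩ := h3
  obtain ⟨v1, h1, h2, h3, h4⟩ := L.next0 o
  have hmo := L.mo
  have hv1 : m v1 = 2 := by
    have hle : m v1 ≤ 2 := by have := le_mul1 (a := m v1) h1; omega
    have hge := L.m1 v1
    by_contra hne
    have hv : m v1 = 1 := by omega
    have := L.conn {k | m k = 1 ∧ ∃ j, 1 ≤ n j k ∧ m j = 1} ⟨hmo, v1, h1, hv⟩ (by
      rintro i ⟨hi, a, ha, hma⟩ j hj
      by_contra hc
      have hij : 1 ≤ n i j := by omega
      apply hj
      by_cases hja : a = j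
      · subst hja; exact ⟨hma, i, hij, hi⟩
      · have hji := L.pos_symm hij
        have e1 := L.le2 hja i
        have e2 := le_mul1 (a := m j) hji
        have e3 := le_mul1 (a := m a) ha
        have := L.m1 j
        exact ⟨by omega, i, hij, hi⟩) k0
    have := this.1
    omega
  have hn1 : n v1 o = 1 := by rw [hv1] at h3; omega
  have hex : ∃ v2, 1 ≤ n v2 v1 ∧ 3 ≤ m v2 := by
    by_contra hc
    push Not at hc
    have hc' : ∀ j, 1 ≤ n j v1 → m j ≤ 2 := fun j hj => by have := hc j hj; omega
    have := L.conn {k | k = o ∨ (m k = 2 ∧ ∀ j, 1 ≤ n j k → m j ≤ 2) ∨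
        (m k = 1 ∧ ∃ j, 1 ≤ n j k ∧ m j = 2 ∧ ∀ l, 1 ≤ n l j → m l ≤ 2)} (Or.inl rfl) (by
      intro i hi j hj
      by_contra hcc
      have hij : 1 ≤ n i j := by omega
      have hji := L.pos_symm hij
      have e2 := le_mul1 (a := m j) hji
      have m1 := L.m1 j
      apply hj
      rcases hi with rfl | ⟨hi, hi2⟩ | ⟨hi, a, ha, hma, ha2⟩
      · by_cases e : v1 = j
        · subst e; exact Or.inr (Or.inl ⟨hv1, hc'⟩)
        · have := L.le2 e i
          rw [hn1] at this; omega
      · have := hi2 j hji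
        by_cases e : m j = 1
        · exact Or.inr (Or.inr ⟨e, i, hij, hi, hi2⟩)
        · refine Or.inr (Or.inl ⟨by omega, ?_⟩)
          intro l hl
          by_cases e' : i = l
          · subst e'; omega
          · have f1 := L.le2 e' j
            have f2 := le_mul1 (a := m i) hij
            have f3 := le_mul1 (a := m l) hl
            omega
      · by_cases e : a = j
        · subst e; exact Or.inr (Or.inl ⟨hma, ha2⟩)
        · have f1 := L.le2 e i
          have f2 := le_mul1 (a := m a) ha
          omega) k0
    rcases this with h | h | h
    · rw [h] at hk0; omega
    · have := h.1; omega
    · have := h.1; omega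
  obtain ⟨v2, g1, g2⟩ := hex
  have hne : o ≠ v2 := by rintro rfl; omega
  have e1 := L.le2 hne v1
  have e2 := le_mul1 (a := m v2) g1
  rw [hmo, hv1] at e1
  have hm2 : m v2 = 3 := by omega
  rw [hm2] at e1
  exact ⟨v1, v2, hv1, hm2, hn1, by omega, by omega, L.pos_symm g1⟩

end I
end TS

namespace TS
section J
variable {κ : Type*} [Fintype κ] {n : κ → κ → ℕ} {m : κ → ℕ} {o : κ} {q : κ → ℝ}

/-- forced neighbour with exact remaining weight -/
lemma Lab.nb1 (L : Lab n m o q) {a j : κ} (s r : ℕ) (hs : m a * n a j = s) (hr : s < 2 * m j)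
    (hr2 : 2 * m j < s + r + r) (hj : r < m j) (h2r : 2 * r ≤ m j + 1) (h2r' : 2 * m j = s + r) (hrj : m j ≤ 2 * r) :
    ∃ w, w ≠ a ∧ m w = r ∧ n w j = 1 ∧ n j w = 1 := by
  obtain ⟨w, h0, h1, h2, h3, h4⟩ := L.next1 (a := a) j (by omega)
  have e1 := le_mul1 (a := m w) h1
  have e2 := le_mul1 (a := m j) h2
  have hm : m w = r := by omega
  rw [hm] at h3 h4 e1
  have f1 : n w j = 1 := by
    by_contra hc
    have : r * 2 ≤ r * n w j := Nat.mul_le_mul_left _ (by omega)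
    omega
  have f2 : n j w = 1 := by
    by_contra hc
    have : m j * 2 ≤ m j * n j w := Nat.mul_le_mul_left _ (by omega)
    omega
  exact ⟨w, h0, hm, f1, f2⟩

lemma Lab.full1 (L : Lab n m o q) {a j b : κ} (h : 2 * m j ≤ m a * n a j) (hb : 1 ≤ n b j) : a = b := by
  by_contra hc
  have := L.le2 hc j
  have := le_mul1 (a := m b) hb
  have := L.m1 b
  omega

lemma Lab.over2 (L : Lab n m o q) {a b j : κ} (hab : a ≠ b) (ha : 1 ≤ n a j) (hb : 1 ≤ n b j)
    (h : 2 * m j < m a + m b) : False := by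
  have := L.le2 hab j
  have := le_mul1 (a := m a) ha
  have := le_mul1 (a := m b) hb
  omega

lemma Lab.over3 (L : Lab n m o q) {a b c j : κ} (hab : a ≠ b) (hac : a ≠ c) (hbc : b ≠ c)
    (ha : 1 ≤ n a j) (hb : 1 ≤ n b j) (hc : 1 ≤ n c j)
    (h : 2 * m j < m a + m b + m c) : False := by
  have := L.le3 hab hac hbc j
  have := le_mul1 (a := m a) ha
  have := le_mul1 (a := m b) hb
  have := le_mul1 (a := m c) hc
  omega

lemma ne_of_m {a b : κ} (h : m a ≠ m b) : a ≠ b := fun e => h (by rw [e])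

lemma Lab.cG2 (L : Lab n m o q) {v1 v2 : κ} (m1 : m v1 = 2) (m2 : m v2 = 3)
    (a1 : n v1 o = 1) (a2 : n o v1 = 1) (a3 : n v2 v1 = 1) (a4 : n v1 v2 = 3) : IsT n m o MG2 TG2 := by
  have m0 := L.mo
  have hM : ∀ i, m (![o,v1,v2] i) = MG2 i := by
    intro i; fin_cases i <;> assumption
  refine L.assemble ![o,v1,v2] (inj_of _ _ hM ?_) rfl _ _ hM ?_ (by decide)
  · intro i j hij hMM
    exfalso; revert i j; decide
  · intro i j hT
    fin_cases i <;> fin_cases j <;> first | exact absurd rfl hT | assumption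

lemma Lab.cBd (L : Lab n m o q) {v1 v2 : κ} (m1 : m v1 = 2) (m2 : m v2 = 3)
    (a1 : n v1 o = 1) (a2 : n o v1 = 1) (a3 : n v2 v1 = 1) (a4 : n v1 v2 = 2) : IsT n m o MBd TBd := by
  have m0 := L.mo
  obtain ⟨w, hw, m3, b1, b2⟩ := L.nb1 (a := v1) (j := v2) 4 2 (by rw [m1, a4]) (by omega) (by omega) (by omega) (by omega) (by omega) (by omega)
  obtain ⟨z, hz, m4, c1, c2⟩ := L.nb1 (a := v2) (j := w) 3 1 (by rw [m2, b2]) (by omega) (by omega) (by omega) (by omega) (by omega) (by omega)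
  have hzo : o ≠ z := by
    rintro rfl
    exact L.over2 hw c2.ge a1.ge (by omega)
  have hM : ∀ i, m (![o,v1,v2,w,z] i) = MBd i := by
    intro i; fin_cases i <;> assumption
  refine L.assemble ![o,v1,v2,w,z] (inj_of _ _ hM ?_) rfl _ _ hM ?_ (by decide)
  · intro i j hij hMM
    fin_cases i <;> fin_cases j <;> first | exact absurd hij (by decide) | exact absurd hMM (by decide) | exact hzo | exact hw.symm
  · intro i j hT
    fin_cases i <;> fin_cases j <;> first | exact absurd rfl hT | assumption

lemma Lab.cF4 (L : Lab n m o q) {v1 v2 v3 : κ} (m1 : m v1 = 2) (m2 : m v2 = 3) (m3 : m v3 = 4)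
    (a1 : n v1 o = 1) (a2 : n o v1 = 1) (a3 : n v2 v1 = 1) (a4 : n v1 v2 = 1)
    (a5 : n v3 v2 = 1) (a6 : n v2 v3 = 2) : IsT n m o MF4 TF4 := by
  have m0 := L.mo
  obtain ⟨w, hw, m4, b1, b2⟩ := L.nb1 (a := v2) (j := v3) 6 2 (by rw [m2, a6]) (by omega) (by omega) (by omega) (by omega) (by omega) (by omega)
  have hw1 : v1 ≠ w := by
    rintro rfl
    exact L.over2 (a := v2) (b := v3) (ne_of_m (m := m) (by omega)) a3.ge b2.ge (by omega)
  have hM : ∀ i, m (![o,v1,v2,v3,w] i) = MF4 i := by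
    intro i; fin_cases i <;> assumption
  refine L.assemble ![o,v1,v2,v3,w] (inj_of _ _ hM ?_) rfl _ _ hM ?_ (by decide)
  · intro i j hij hMM
    fin_cases i <;> fin_cases j <;> first | exact absurd hij (by decide) | exact absurd hMM (by decide) | exact hw1
  · intro i j hT
    fin_cases i <;> fin_cases j <;> first | exact absurd rfl hT | assumption

lemma Lab.cE6 (L : Lab n m o q) {v1 v2 w w' : κ} (m1 : m v1 = 2) (m2 : m v2 = 3)
    (a1 : n v1 o = 1) (a2 : n o v1 = 1) (a3 : n v2 v1 = 1) (a4 : n v1 v2 = 1)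
    (m3 : m w = 2) (m3' : m w' = 2) (h1 : v1 ≠ w) (h2 : v1 ≠ w') (h3 : w ≠ w')
    (b1 : n w v2 = 1) (b2 : n v2 w = 1) (b1' : n w' v2 = 1) (b2' : n v2 w' = 1) :
    IsT n m o ME6 TE6 := by
  have m0 := L.mo
  obtain ⟨z, hz, m4, c1, c2⟩ := L.nb1 (a := v2) (j := w) 3 1 (by rw [m2, b2]) (by omega) (by omega) (by omega) (by omega) (by omega) (by omega)
  obtain ⟨z', hz', m4', c1', c2'⟩ := L.nb1 (a := v2) (j := w') 3 1 (by rw [m2, b2']) (by omega) (by omega) (by omega) (by omega) (by omega) (by omega)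
  have hzo : o ≠ z := by
    rintro rfl
    exact L.over2 h1 a1.ge c2.ge (by omega)
  have hzo' : o ≠ z' := by
    rintro rfl
    exact L.over2 h2 a1.ge c2'.ge (by omega)
  have hzz : z ≠ z' := by
    rintro rfl
    exact L.over2 h3 c2.ge c2'.ge (by omega)
  have hM : ∀ i, m (![o,v1,v2,w,z,w',z'] i) = ME6 i := by
    intro i; fin_cases i <;> assumption
  refine L.assemble ![o,v1,v2,w,z,w',z'] (inj_of _ _ hM ?_) rfl _ _ hM ?_ (by decide)
  · intro i j hij hMM
    fin_cases i <;> fin_cases j <;> first | exact absurd hij (by decide) | exact absurd hMM (by decide) | exact h1 | exact h2 | exact h3 | exact hzo | exact hzo' | exact hzz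
  · intro i j hT
    fin_cases i <;> fin_cases j <;> first | exact absurd rfl hT | assumption

lemma Lab.cE7 (L : Lab n m o q) {v1 v2 v3 w w' : κ} (m1 : m v1 = 2) (m2 : m v2 = 3) (m3 : m v3 = 4)
    (a1 : n v1 o = 1) (a2 : n o v1 = 1) (a3 : n v2 v1 = 1) (a4 : n v1 v2 = 1)
    (a5 : n v3 v2 = 1) (a6 : n v2 v3 = 1)
    (m4 : m w = 2) (m4' : m w' = 3) (hv : w' ≠ v2)
    (b1 : n w v3 = 1) (b2 : n v3 w = 1) (b1' : n w' v3 = 1) (b2' : n v3 w' = 1) :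
    IsT n m o ME7 TE7 := by
  have m0 := L.mo
  obtain ⟨x, hx, m5, c1, c2⟩ := L.nb1 (a := v3) (j := w') 4 2 (by rw [m3, b2']) (by omega) (by omega) (by omega) (by omega) (by omega) (by omega)
  obtain ⟨y, hy, m6, d1, d2⟩ := L.nb1 (a := w') (j := x) 3 1 (by rw [m4', c2]) (by omega) (by omega) (by omega) (by omega) (by omega) (by omega)
  have h1 : v1 ≠ w := by
    rintro rfl
    exact L.over2 (a := v2) (b := v3) (ne_of_m (m := m) (by omega)) a3.ge b2.ge (by omega)
  have h2 : v1 ≠ x := by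
    rintro rfl
    exact L.over3 (a := o) (b := v2) (c := w') (ne_of_m (m := m) (by omega)) (ne_of_m (m := m) (by omega)) hv.symm a2.ge a3.ge c2.ge (by omega)
  have h3 : x ≠ w := by
    rintro rfl
    exact L.over2 (a := w') (b := v3) (ne_of_m (m := m) (by omega)) c2.ge b2.ge (by omega)
  have h4 : o ≠ y := by
    rintro rfl
    exact L.over2 h2 a1.ge d2.ge (by omega)
  have hM : ∀ i, m (![o,v1,v2,v3,w',x,y,w] i) = ME7 i := by
    intro i; fin_cases i <;> assumption
  refine L.assemble ![o,v1,v2,v3,w',x,y,w] (inj_of _ _ hM ?_) rfl _ _ hM ?_ (by decide)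
  · intro i j hij hMM
    fin_cases i <;> fin_cases j <;> first | exact absurd hij (by decide) | exact absurd hMM (by decide) | exact h1 | exact h2 | exact h3 | exact h4 | exact hv.symm
  · intro i j hT
    fin_cases i <;> fin_cases j <;> first | exact absurd rfl hT | assumption

lemma Lab.cE8 (L : Lab n m o q) {v1 v2 v3 v4 v5 w w' : κ} (m1 : m v1 = 2) (m2 : m v2 = 3) (m3 : m v3 = 4)
    (m4 : m v4 = 5) (m5 : m v5 = 6)
    (a1 : n v1 o = 1) (a2 : n o v1 = 1) (a3 : n v2 v1 = 1) (a4 : n v1 v2 = 1)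
    (a5 : n v3 v2 = 1) (a6 : n v2 v3 = 1) (a7 : n v4 v3 = 1) (a8 : n v3 v4 = 1)
    (a9 : n v5 v4 = 1) (a10 : n v4 v5 = 1)
    (m6 : m w = 3) (m6' : m w' = 4)
    (b1 : n w v5 = 1) (b2 : n v5 w = 1) (b1' : n w' v5 = 1) (b2' : n v5 w' = 1) :
    IsT n m o ME8 TE8 := by
  have m0 := L.mo
  obtain ⟨x, hx, m7, c1, c2⟩ := L.nb1 (a := v5) (j := w') 6 2 (by rw [m5, b2']) (by omega) (by omega) (by omega) (by omega) (by omega) (by omega)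
  have h1 : v1 ≠ x := by
    rintro rfl
    exact L.over2 (a := v2) (b := w') (ne_of_m (m := m) (by omega)) a3.ge c2.ge (by omega)
  have h2 : v2 ≠ w := by
    rintro rfl
    exact L.over2 (a := v3) (b := v5) (ne_of_m (m := m) (by omega)) a5.ge b2.ge (by omega)
  have h3 : v3 ≠ w' := by
    rintro rfl
    exact L.over2 (a := v4) (b := v5) (ne_of_m (m := m) (by omega)) a7.ge b2'.ge (by omega)
  have hM : ∀ i, m (![o,v1,v2,v3,v4,v5,w',x,w] i) = ME8 i := by
    intro i; fin_cases i <;> assumption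
  refine L.assemble ![o,v1,v2,v3,v4,v5,w',x,w] (inj_of _ _ hM ?_) rfl _ _ hM ?_ (by decide)
  · intro i j hij hMM
    fin_cases i <;> fin_cases j <;> first | exact absurd hij (by decide) | exact absurd hMM (by decide) | exact h1 | exact h2 | exact h3
  · intro i j hT
    fin_cases i <;> fin_cases j <;> first | exact absurd rfl hT | assumption

end J
end TS

namespace TS
section K
variable {κ : Type*} [Fintype κ] {n : κ → κ → ℕ} {m : κ → ℕ} {o : κ} {q : κ → ℝ}

lemma mul_bd {a b c : ℕ} (ha : 1 ≤ a) (k : ℕ) (h : a * b ≤ c) (hk : c < a * (k+1)) : b ≤ k := by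
  by_contra hc
  have : a * (k+1) ≤ a * b := Nat.mul_le_mul_left _ (by omega)
  omega

lemma Lab.cl8 (L : Lab n m o q) {v1 v2 v3 v4 : κ} (m1 : m v1 = 2) (m2 : m v2 = 3) (m3 : m v3 = 4)
    (m4 : m v4 = 5)
    (a1 : n v1 o = 1) (a2 : n o v1 = 1) (a3 : n v2 v1 = 1) (a4 : n v1 v2 = 1)
    (a5 : n v3 v2 = 1) (a6 : n v2 v3 = 1) (a7 : n v4 v3 = 1) :
    IsT n m o ME8 TE8 := by
  have p1 := L.pos_symm a7.ge
  have p2 := L.le1 v3 v4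
  have p3 := mul_bd (L.m1 v3) 2 p2 (by omega)
  have a8 : n v3 v4 = 1 := by
    by_contra hc
    have hc : n v3 v4 = 2 := by omega
    obtain ⟨w, h0, h1, h2, h3, h4⟩ := L.next1 (a := v3) v4 (by rw [m3, m4, hc]; omega)
    have e1 := le_mul1 (a := m w) h1
    have e2 := le_mul1 (a := m v4) h2
    rw [m3, hc] at h3
    omega
  obtain ⟨v5, h0, h1, h2, h3, h4⟩ := L.next1 (a := v3) v4 (by rw [m3, m4, a8]; omega)
  have e1 := le_mul1 (a := m v5) h1
  have e2 := le_mul1 (a := m v4) h2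
  rw [m3, a8] at h3
  have q1 := mul_bd (L.m1 v5) 2 (b := n v5 v4) (c := 6) (by omega) (by omega)
  have q2 := mul_bd (L.m1 v4) 2 (b := n v4 v5) (c := 12) (by omega) (by omega)
  have m5 : m v5 = 6 := by
    by_contra hc
    have : m v5 = 3 ∨ m v5 = 4 ∨ m v5 = 5 := by omega
    have hn := L.pos_symm h1
    rcases this with hm | hm | hm
    · have a10 : n v4 v5 = 1 := by rw [m4, hm] at h4; omega
      obtain ⟨w, i0, i1, i2, i3, i4⟩ := L.next1 (a := v4) v5 (by rw [m4, a10]; omega)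
      have f1 := le_mul1 (a := m w) i1
      have f2 := le_mul1 (a := m v5) i2
      rw [m4, a10] at i3
      omega
    · have a9 : n v5 v4 = 1 := by rw [hm] at h3; omega
      obtain ⟨w, i00, i0, i1, i2, i3, i4⟩ := L.next2 (a := v3) (b := v5) v4 h0.symm (by rw [m3, a8, a9]; omega)
      have f1 := le_mul1 (a := m w) i1
      have f2 := le_mul1 (a := m v4) i2
      rw [m3, a8, a9] at i3
      omega
    · have a9 : n v5 v4 = 1 := by rw [hm] at h3; omega
      obtain ⟨w, i00, i0, i1, i2, i3, i4⟩ := L.next2 (a := v3) (b := v5) v4 h0.symm (by rw [m3, a8, a9]; omega)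
      have f1 := le_mul1 (a := m w) i1
      have f2 := le_mul1 (a := m v4) i2
      rw [m3, a8, a9] at i3
      omega
  have a9 : n v5 v4 = 1 := by rw [m5] at h3; omega
  have a10 : n v4 v5 = 1 := by
    by_contra hc
    have hc : n v4 v5 = 2 := by omega
    obtain ⟨w, i0, i1, i2, i3, i4⟩ := L.next1 (a := v4) v5 (by rw [m4, m5, hc]; omega)
    have f1 := le_mul1 (a := m w) i1
    have f2 := le_mul1 (a := m v5) i2
    rw [m4, hc] at i3
    omega
  obtain ⟨w, i0, i1, i2, i3, i4⟩ := L.next1 (a := v4) v5 (by rw [m4, m5, a10]; omega)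
  have f1 := le_mul1 (a := m w) i1
  have f2 := le_mul1 (a := m v5) i2
  rw [m4, a10] at i3
  have r1 := mul_bd (L.m1 w) 2 (b := n w v5) (c := 7) (by omega) (by omega)
  have r2 := mul_bd (L.m1 v5) 2 (b := n v5 w) (c := 14) (by omega) (by omega)
  by_cases m6 : m w = 7
  · exact (L.nochain (a := v5) (b := w) (by omega) (by omega) i2).elim
  have hlt : m v4 * n v4 v5 + m w * n w v5 < 2 * m v5 := by
    rw [m4, a10]
    have hr : n w v5 = 1 ∨ n w v5 = 2 := by omega
    rcases hr with hr | hr <;> rw [hr] at i3 ⊢ <;> omega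
  obtain ⟨w', j00, j0, j1, j2, j3, j4⟩ := L.next2 (a := v4) (b := w) v5 i0.symm hlt
  have g1 := le_mul1 (a := m w') j1
  have g2 := le_mul1 (a := m v5) j2
  rw [m4, a10] at j3
  have hw : m w = 3 ∨ m w = 4 := by omega
  have hw' : m w' = 3 ∨ m w' = 4 := by omega
  have b1 : n w v5 = 1 := by
    by_contra hc
    have hc : n w v5 = 2 := by omega
    rw [hc] at j3; omega
  have b2 : n v5 w = 1 := by
    by_contra hc
    have hc : n v5 w = 2 := by omega
    rw [hc] at i4; omega
  have b1' : n w' v5 = 1 := by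
    rcases hw' with h | h <;> rw [h] at j3 <;> omega
  have b2' : n v5 w' = 1 := by
    rw [m5] at j4; omega
  rw [b1, b1'] at j3
  rcases hw with h | h <;> rcases hw' with h' | h'
  · exfalso
    classical
    obtain ⟨z, k0, k1, k2⟩ := L.next {v4, w, w'} v5 (by
      rw [Finset.sum_insert (by simp [i0.symm, j00.symm]), Finset.sum_pair j0.symm, a10, b1, b1']
      omega)
    simp at k0
    have k3 := L.le {z, v4, w, w'} v5
    rw [Finset.sum_insert (by simp [k0]), Finset.sum_insert (by simp [i0.symm, j00.symm]), Finset.sum_pair j0.symm, a10, b1, b1'] at k3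
    have k4 := le_mul1 (a := m z) k1
    have k5 := le_mul1 (a := m v5) k2
    have := L.le1 v5 z
    omega
  · exact L.cE8 m1 m2 m3 m4 m5 a1 a2 a3 a4 a5 a6 a7 a8 a9 a10 h h' b1 b2 b1' b2'
  · exact L.cE8 m1 m2 m3 m4 m5 a1 a2 a3 a4 a5 a6 a7 a8 a9 a10 h' h b1' b2' b1 b2
  · omega

lemma Lab.cl7 (L : Lab n m o q) {v1 v2 v3 : κ} (m1 : m v1 = 2) (m2 : m v2 = 3) (m3 : m v3 = 4)
    (a1 : n v1 o = 1) (a2 : n o v1 = 1) (a3 : n v2 v1 = 1) (a4 : n v1 v2 = 1)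
    (a5 : n v3 v2 = 1) (a6 : n v2 v3 = 1) :
    IsT n m o ME7 TE7 ∨ IsT n m o ME8 TE8 := by
  obtain ⟨w, i0, i1, i2, i3, i4⟩ := L.next1 (a := v2) v3 (by rw [m2, m3, a6]; omega)
  have f1 := le_mul1 (a := m w) i1
  have f2 := le_mul1 (a := m v3) i2
  rw [m2, a6] at i3
  have r1 := mul_bd (L.m1 w) 2 (b := n w v3) (c := 5) (by omega) (by omega)
  have r2 := mul_bd (L.m1 v3) 2 (b := n v3 w) (c := 10) (by omega) (by omega)
  by_cases m6 : m w = 5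
  · right
    exact L.cl8 m1 m2 m3 m6 a1 a2 a3 a4 a5 a6 (by rw [m6] at i3; omega)
  left
  have hlt : m v2 * n v2 v3 + m w * n w v3 < 2 * m v3 := by
    rw [m2, a6]
    have hr : n w v3 = 1 ∨ n w v3 = 2 := by omega
    rcases hr with hr | hr <;> rw [hr] at i3 ⊢ <;> omega
  obtain ⟨w', j00, j0, j1, j2, j3, j4⟩ := L.next2 (a := v2) (b := w) v3 i0.symm hlt
  have g1 := le_mul1 (a := m w') j1
  have g2 := le_mul1 (a := m v3) j2
  rw [m2, a6] at j3
  have hw : m w = 2 ∨ m w = 3 := by omega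
  have hw' : m w' = 2 ∨ m w' = 3 := by omega
  have b1 : n w v3 = 1 := by
    by_contra hc
    have hc : n w v3 = 2 := by omega
    rw [hc] at j3; omega
  have b2 : n v3 w = 1 := by
    by_contra hc
    have hc : n v3 w = 2 := by omega
    rw [hc] at i4; omega
  have b1' : n w' v3 = 1 := by
    rcases hw' with h | h <;> rw [h] at j3 <;> omega
  have b2' : n v3 w' = 1 := by
    rw [m3] at j4; omega
  rw [b1, b1'] at j3
  rcases hw with h | h <;> rcases hw' with h' | h'
  · exfalso
    classical
    obtain ⟨z, k0, k1, k2⟩ := L.next {v2, w, w'} v3 (by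
      rw [Finset.sum_insert (by simp [i0.symm, j00.symm]), Finset.sum_pair j0.symm, a6, b1, b1']
      omega)
    simp at k0
    have k3 := L.le {z, v2, w, w'} v3
    rw [Finset.sum_insert (by simp [k0]), Finset.sum_insert (by simp [i0.symm, j00.symm]), Finset.sum_pair j0.symm, a6, b1, b1'] at k3
    have k4 := le_mul1 (a := m z) k1
    have k5 := le_mul1 (a := m v3) k2
    have := L.le1 v3 z
    omega
  · exact L.cE7 m1 m2 m3 a1 a2 a3 a4 a5 a6 h h' j00 b1 b2 b1' b2'
  · exact L.cE7 m1 m2 m3 a1 a2 a3 a4 a5 a6 h' h i0 b1' b2' b1 b2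
  · omega

lemma Lab.classify (L : Lab n m o q) (h3 : ∃ k, 3 ≤ m k) :
    IsT n m o MG2 TG2 ∨ IsT n m o MBd TBd ∨ IsT n m o MF4 TF4 ∨ IsT n m o ME6 TE6 ∨
    IsT n m o ME7 TE7 ∨ IsT n m o ME8 TE8 := by
  obtain ⟨v1, v2, m1, m2, a1, a2, a3, a4'⟩ := L.start h3
  have p2 := L.le1 v1 v2
  rw [m1, m2] at p2
  have : n v1 v2 = 3 ∨ n v1 v2 = 2 ∨ n v1 v2 = 1 := by omega
  rcases this with a4 | a4 | a4
  · exact Or.inl (L.cG2 m1 m2 a1 a2 a3 a4)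
  · exact Or.inr (Or.inl (L.cBd m1 m2 a1 a2 a3 a4))
  right; right
  have hq1 := L.sym o v1
  have hq2 := L.sym v1 v2
  rw [a1, a2] at hq1
  rw [a3, a4] at hq2
  obtain ⟨w, i0, i1, i2, i3, i4⟩ := L.next1 (a := v1) v2 (by rw [m1, m2, a4]; omega)
  have f1 := le_mul1 (a := m w) i1
  have f2 := le_mul1 (a := m v2) i2
  rw [m1, a4] at i3
  have r1 := mul_bd (L.m1 w) 2 (b := n w v2) (c := 4) (by omega) (by omega)
  have r2 := mul_bd (L.m1 v2) 2 (b := n v2 w) (c := 8) (by omega) (by omega)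
  have : m w = 2 ∨ m w = 3 ∨ m w = 4 := by omega
  rcases this with hm | hm | hm
  · have b2 : n v2 w = 1 := by rw [m2, hm] at i4; omega
    have b1 : n w v2 = 1 := by
      by_contra hc
      have hc : n w v2 = 2 := by omega
      have := L.sym w v2
      rw [hc, b2] at this
      have := L.long w
      have := L.qpos w
      push_cast at *
      linarith
    obtain ⟨w', j00, j0, j1, j2, j3, j4⟩ := L.next2 (a := v1) (b := w) v2 i0.symm (by rw [a4, b1]; omega)
    have g1 := le_mul1 (a := m w') j1
    have g2 := le_mul1 (a := m v2) j2
    rw [m1, a4, b1, hm] at j3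
    have hm' : m w' = 2 := by omega
    refine Or.inr (Or.inl (L.cE6 m1 m2 a1 a2 a3 a4 hm hm' i0.symm j00.symm j0.symm b1 b2 ?_ ?_))
    · rw [hm'] at j3; omega
    · rw [m2, hm'] at j4; omega
  · exfalso
    have b1 : n w v2 = 1 := by rw [hm] at i3; omega
    obtain ⟨w', j00, j0, j1, j2, j3, j4⟩ := L.next2 (a := v1) (b := w) v2 i0.symm (by rw [a4, b1]; omega)
    have g1 := le_mul1 (a := m w') j1
    have g2 := le_mul1 (a := m v2) j2
    rw [m1, a4, b1] at j3
    omega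
  · have b1 : n w v2 = 1 := by rw [hm] at i3; omega
    have : n v2 w = 1 ∨ n v2 w = 2 := by omega
    rcases this with b2 | b2
    · exact Or.inr (Or.inr (L.cl7 m1 m2 hm a1 a2 a3 a4 b1 b2))
    · exact Or.inl (L.cF4 m1 m2 hm a1 a2 a3 a4 b1 b2)

end K
end TS

namespace TS
open scoped InnerProductSpace
section L
variable {E : Type*} [NormedAddCommGroup E] [InnerProductSpace ℝ E] {Φ : Set E}
variable {κ : Type*} [Fintype κ] {u : κ → E} {m : κ → ℕ} {o : κ}

def Car (u : κ → E) (n : κ → κ → ℕ) : Prop :=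
  ∀ i j, i ≠ j → 2 * ⟪u i, u j⟫_ℝ = -(n i j) * ⟪u j, u j⟫_ℝ

def HasT {d : ℕ} (Φ : Set E) (M : Fin (d+1) → ℕ) (T : Fin (d+1) → Fin (d+1) → ℕ) : Prop :=
  ∃ u : Fin (d+1) → E, Aff Φ u M 0 ∧ Car u T

lemma Aff.lab (h : RSys Φ) (hA : Aff Φ u m o) :
    ∃ n : κ → κ → ℕ, Car u n ∧ Lab n m o (fun j => ⟪u j, u j⟫_ℝ) := by
  classical
  have h1 : ∀ i j, ∃ n : ℕ, (i ≠ j → 2 * ⟪u i, u j⟫_ℝ = -n * ⟪u j, u j⟫_ℝ) ∧ (i = j → n = 0) := by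
    intro i j
    by_cases hij : i = j
    · exact ⟨0, fun h => absurd hij h, fun _ => rfl⟩
    obtain ⟨n, hn, -⟩ := h.refl _ (hA.mem i) _ (hA.mem j)
    have hp := h.pos (hA.mem j)
    have ho := hA.obt i j hij
    have hn0 : n ≤ 0 := by
      by_contra hc
      have : (1:ℝ) ≤ n := by exact_mod_cast (by omega : 1 ≤ n)
      nlinarith
    refine ⟨n.natAbs, fun _ => ?_, fun h => absurd h hij⟩
    have : ((n.natAbs : ℕ) : ℝ) = -n := by
      have : ((n.natAbs : ℕ) : ℤ) = -n := by omega
      rw [← Int.cast_natCast, this]; push_cast; rfl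
    rw [hn, this]; ring
  choose n hn hd using h1
  refine ⟨n, fun i j => hn i j, ?_⟩
  refine ⟨fun j => h.pos (hA.mem j), ?_, ?_, fun j => hd j j rfl, hA.mo, hA.m1, fun j => hA.long _ (hA.mem j), ?_⟩
  · intro i j
    by_cases hij : i = j
    · subst hij; rfl
    have e1 := hn i j hij
    have e2 := hn j i (Ne.symm hij)
    rw [real_inner_comm] at e2
    linarith
  · intro j
    have hp := h.pos (hA.mem j)
    have e : ∑ i, (m i : ℝ) * ⟪u i, u j⟫_ℝ = 0 := by
      have := congrArg (fun v => ⟪v, u j⟫_ℝ) hA.rel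
      rw [sum_nsmul_cast] at this
      simpa [sum_inner, real_inner_smul_left] using this
    have e2 : ∀ i, (m i : ℝ) * (2 * ⟪u i, u j⟫_ℝ) = (if i = j then 2 * m j * ⟪u j, u j⟫_ℝ else 0) - (m i * n i j) * ⟪u j, u j⟫_ℝ := by
      intro i
      by_cases hij : i = j
      · subst hij; simp [hd i i rfl]; ring
      · rw [hn i j hij]; simp [hij]; ring
    have e3 : ∑ i, (m i : ℝ) * (2 * ⟪u i, u j⟫_ℝ) = 0 := by
      rw [← mul_zero (2:ℝ), ← e, Finset.mul_sum]
      exact Finset.sum_congr rfl fun i _ => by ring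
    rw [Finset.sum_congr rfl fun i _ => e2 i, Finset.sum_sub_distrib, ← Finset.sum_mul] at e3
    simp only [Finset.sum_ite_eq', Finset.mem_univ, if_true] at e3
    have e4 : (2 * m j - ∑ i, (m i : ℝ) * n i j) * ⟪u j, u j⟫_ℝ = 0 := by linarith
    rcases mul_eq_zero.1 e4 with e5 | e5
    · have : (∑ i, (m i : ℝ) * n i j) = 2 * m j := by linarith
      exact_mod_cast this
    · exact absurd e5 hp.ne'
  · intro S ho hS
    apply hA.conn S ho
    intro i hi j hj
    have hij : i ≠ j := by rintro rfl; exact hj hi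
    have := hn i j hij
    rw [hS i hi j hj] at this
    simp at this
    exact this

lemma IsT.has {n : κ → κ → ℕ} {d : ℕ} {M : Fin (d+1) → ℕ} {T : Fin (d+1) → Fin (d+1) → ℕ}
    (hA : Aff Φ u m o) (hn : Car u n) (hT : IsT n m o M T) : HasT Φ M T := by
  obtain ⟨e, h0, hM, hT⟩ := hT
  have := hA.reindex e
  have e1 : m ∘ e = M := funext hM
  have e2 : e.symm o = 0 := by rw [← h0]; simp
  rw [e1, e2] at this
  refine ⟨u ∘ e, this, fun i j hij => ?_⟩
  have := hn (e i) (e j) (fun h => hij (e.injective h))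
  rw [hT] at this
  exact this

lemma RSys.refl' (h : RSys Φ) {a b : E} (ha : a ∈ Φ) (hb : b ∈ Φ) (n : ℤ)
    (hn : 2 * ⟪a, b⟫_ℝ = n * ⟪b, b⟫_ℝ) : a - n • b ∈ Φ := by
  obtain ⟨n', hn', hm⟩ := h.refl a ha b hb
  have : (n : ℝ) = n' := mul_right_cancel₀ (h.pos hb).ne' (hn.symm.trans hn')
  have : n = n' := by exact_mod_cast this
  rwa [this]

lemma not_bad (h : RSys Φ) (hT : HasT Φ MBd TBd) : False := by
  obtain ⟨u, hA, hC⟩ := hT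
  have c01 := hC 0 1 (by decide)
  have c02 := hC 0 2 (by decide)
  have c03 := hC 0 3 (by decide)
  have c04 := hC 0 4 (by decide)
  have c12 := hC 1 2 (by decide)
  have c13 := hC 1 3 (by decide)
  have c14 := hC 1 4 (by decide)
  have c23 := hC 2 3 (by decide)
  have c24 := hC 2 4 (by decide)
  have c34 := hC 3 4 (by decide)
  simp [TBd] at c01 c02 c03 c04 c12 c13 c14 c23 c24 c34
  simp only [← real_inner_self_eq_norm_sq] at c01 c12 c23 c34
  have p0 := h.neg (hA.mem 0)
  have p1 := h.refl' p0 (hA.mem 1) 1 (by simp only [inner_neg_left]; push_cast; linarith)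
  have p2 := h.refl' p1 (hA.mem 2) 2 (by
    simp only [inner_neg_left, inner_sub_left, ← Int.cast_smul_eq_zsmul ℝ, real_inner_smul_left, c02]; push_cast; linarith)
  have p3 := h.refl' p2 (hA.mem 3) 2 (by
    simp only [inner_neg_left, inner_sub_left, ← Int.cast_smul_eq_zsmul ℝ, real_inner_smul_left, c03, c13]; push_cast; linarith)
  have p4 := h.refl' p3 (hA.mem 4) 2 (by
    simp only [inner_neg_left, inner_sub_left, ← Int.cast_smul_eq_zsmul ℝ, real_inner_smul_left, c04, c14, c24]; push_cast; linarith)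
  obtain ⟨c, hc0, hc, hs⟩ := hA.coef _ p4
  have key := hA.li (fun k => (c k : ℝ) + (![1,1,2,2,2] : Fin 5 → ℝ) k) (by
    simp only [add_smul, Finset.sum_add_distrib]
    rw [← sum_zsmul_cast, ← hc]
    have h5 : ∀ f : Fin (4+1) → E, ∑ k, f k = f 0 + f 1 + f 2 + f 3 + f 4 := fun f => Fin.sum_univ_five f
    rw [h5]
    simp only [← Int.cast_smul_eq_zsmul ℝ]
    simp)
  have k1 := key 1
  have k4 := key 4
  simp [hc0, MBd] at k1 k4
  have k1' : (c 1 : ℝ) = 1 := by linarith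
  have k4' : (c 4 : ℝ) = -1 := by linarith
  norm_cast at k1'
  have k4'' : c 4 = -1 := by exact_mod_cast k4'
  rcases hs with hs | hs
  · have := (hs 4).1; omega
  · have := (hs 1).2; omega

lemma Aff.classify (h : RSys Φ) (hA : Aff Φ u m o) (h3 : ∃ k, 3 ≤ m k) :
    HasT Φ MG2 TG2 ∨ HasT Φ MF4 TF4 ∨ HasT Φ ME6 TE6 ∨ HasT Φ ME7 TE7 ∨ HasT Φ ME8 TE8 := by
  obtain ⟨n, hn, L⟩ := hA.lab h
  rcases L.classify h3 with hT | hT | hT | hT | hT | hT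
  · exact Or.inl (hT.has hA hn)
  · exact (not_bad h (hT.has hA hn)).elim
  · exact Or.inr (Or.inl (hT.has hA hn))
  · exact Or.inr (Or.inr (Or.inl (hT.has hA hn)))
  · exact Or.inr (Or.inr (Or.inr (Or.inl (hT.has hA hn))))
  · exact Or.inr (Or.inr (Or.inr (Or.inr (hT.has hA hn))))

end L
end TS

namespace TS
open scoped InnerProductSpace
section M
variable {E : Type*} [NormedAddCommGroup E] [InnerProductSpace ℝ E] {Φ : Set E}
variable {κ : Type*} [Fintype κ] [DecidableEq κ] {u : κ → E} {m : κ → ℕ} {o : κ}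

def dd (p : κ → κ) (c : κ → ℤ) (i : κ) : ℤ := c i - ∑ l, if p l = i then c l else 0

lemma dd_sum (p : κ → κ) (c : κ → ℤ) (f : κ → E) :
    ∑ i, dd p c i • f i = ∑ l, c l • (f l - f (p l)) := by
  simp only [dd, sub_smul, Finset.sum_smul, smul_sub, Finset.sum_sub_distrib]
  congr 1
  rw [Finset.sum_comm]
  refine Finset.sum_congr rfl fun l _ => ?_
  simp [ite_smul]

lemma dd_sum' (p : κ → κ) (c : κ → ℤ) (f : κ → ℤ) :
    ∑ i, dd p c i * f i = ∑ l, c l * (f l - f (p l)) := by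
  simp only [dd, sub_mul, Finset.sum_mul, mul_sub, Finset.sum_sub_distrib]
  congr 1
  rw [Finset.sum_comm]
  refine Finset.sum_congr rfl fun l _ => ?_
  simp [ite_mul]

/-- an integer vector of sum zero and square norm at most two is a difference of basis vectors -/
lemma short_vec (d : κ → ℤ) (h0 : ∑ i, d i = 0) (h2 : ∑ i, d i ^ 2 ≤ 2) :
    (∀ i, d i = 0) ∨ ∃ a b, a ≠ b ∧ d a = 1 ∧ d b = -1 ∧ ∀ i, i ≠ a → i ≠ b → d i = 0 := by
  by_cases hz : ∀ i, d i = 0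
  · exact Or.inl hz
  right
  push Not at hz
  have hex : ∃ a, 0 < d a := by
    by_contra hc
    push Not at hc
    obtain ⟨i, hi⟩ := hz
    have := (Finset.sum_eq_zero_iff_of_nonpos (fun i _ => hc i)).1 h0 i (Finset.mem_univ _)
    exact hi this
  have hex' : ∃ a, d a < 0 := by
    by_contra hc
    push Not at hc
    obtain ⟨i, hi⟩ := hz
    have := (Finset.sum_eq_zero_iff_of_nonneg (fun i _ => hc i)).1 h0 i (Finset.mem_univ _)
    exact hi this
  obtain ⟨a, ha⟩ := hex
  obtain ⟨b, hb⟩ := hex'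
  have hab : a ≠ b := by rintro rfl; omega
  have hle : ∀ S : Finset κ, ∑ i ∈ S, d i ^ 2 ≤ 2 := fun S =>
    (Finset.sum_le_sum_of_subset_of_nonneg (Finset.subset_univ _) (fun i _ _ => sq_nonneg _)).trans h2
  have e1 := hle {a, b}
  rw [Finset.sum_pair hab] at e1
  refine ⟨a, b, hab, by nlinarith, by nlinarith, fun i hia hib => ?_⟩
  have e2 := hle {i, a, b}
  rw [Finset.sum_insert (by simp [hia, hib]), Finset.sum_pair hab] at e2
  have : d i ^ 2 ≤ 0 := by nlinarith
  nlinarith [sq_nonneg (d i), pow_eq_zero_iff (two_ne_zero) (a := d i) |>.1 (le_antisymm this (sq_nonneg _))]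

lemma Aff.uniqj (hA : Aff Φ u m o) {j : κ} {c d : κ → ℤ} (hc : c j = 0) (hd : d j = 0)
    (h : ∑ k, c k • u k = ∑ k, d k • u k) : c = d := by
  rw [sum_zsmul_cast, sum_zsmul_cast, ← sub_eq_zero, ← Finset.sum_sub_distrib] at h
  have := hA.li (fun k => (c k : ℝ) - d k) (by simpa only [sub_smul] using h)
  have hj := this j
  simp only [hc, hd, Int.cast_zero, sub_zero] at hj
  have hmj : (m j : ℝ) ≠ 0 := by have := hA.m1 j; exact_mod_cast (by omega)
  have ho : (c o : ℝ) - d o = 0 := by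
    rcases mul_eq_zero.1 hj.symm with h | h
    · exact h
    · exact absurd h hmj
  funext k
  have := this k
  simp only [ho, zero_mul] at this
  have : (c k : ℝ) = d k := by linarith
  exact_mod_cast this

lemma Aff.LA (hA : Aff Φ u m o) (j : κ) (p : κ → κ) (s : κ → E)
    (hs : ∀ k, k ≠ j → u k = s k - s (p k))
    (hQ : ∀ c : κ → ℤ, c j = 0 → ⟪∑ k, c k • u k, ∑ k, c k • u k⟫_ℝ ≤ ⟪u o, u o⟫_ℝ →
      ∑ i, dd p c i ^ 2 ≤ 2)
    {P : Set E} (hP : P ⊆ Φ) (hPj : ∀ a ∈ P, a ∈ AddSubgroup.closure (u '' {k | k ≠ j}))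
    {t : E} (ht : t ∈ AddSubgroup.closure (u '' {k | k ≠ j})) {n : ℤ} (hn : n ≠ 0)
    (hnt : n • t ∈ AddSubgroup.closure P) : t ∈ AddSubgroup.closure P := by
  classical
  set Q := AddSubgroup.closure P with hQdef
  have hsum : ∀ c : κ → ℤ, c j = 0 → ∑ k, c k • u k = ∑ i, dd p c i • s i := by
    intro c hc
    rw [dd_sum]
    refine Finset.sum_congr rfl fun l _ => ?_
    by_cases hl : l = j
    · rw [hl, hc]; simp
    · rw [hs l hl]
  let st : Setoid κ := ⟨fun a b => s a - s b ∈ Q, fun a => by simp [Q.zero_mem],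
    fun {a b} h => by have := Q.neg_mem h; rwa [neg_sub] at this,
    fun {a b c} h h' => by have := Q.add_mem h h'; rwa [sub_add_sub_cancel] at this⟩
  let r : κ → κ := fun a => (Quotient.mk st a).out
  have hr : ∀ a, s a - s (r a) ∈ Q := fun a => by
    have := Quotient.mk_out (s := st) a
    exact st.symm' this
  have hr' : ∀ a b, s a - s b ∈ Q → r a = r b := by
    intro a b h
    have : Quotient.mk st a = Quotient.mk st b := Quotient.sound h
    simp only [r, this]
  -- class sums
  have key : ∀ y ∈ Q, ∃ c : κ → ℤ, c j = 0 ∧ y = ∑ k, c k • u k ∧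
      ∀ x, ∑ i, dd p c i * (if r i = x then 1 else 0) = 0 := by
    intro y hy
    induction hy using AddSubgroup.closure_induction with
    | mem a ha =>
      obtain ⟨c, hc, hac⟩ := closure_coeff (hPj a ha)
      have hcj : c j = 0 := hc j (by simp)
      refine ⟨c, hcj, hac, fun x => ?_⟩
      have h2 := hQ c hcj (by rw [← hac]; exact hA.long a (hP ha))
      have h0 : ∑ i, dd p c i = 0 := by
        have := dd_sum' p c (fun _ => 1)
        simpa using this
      rcases short_vec _ h0 h2 with hz | ⟨v, w, hvw, hv, hw, hz⟩
      · simp [hz]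
      · have ha' : a = s v - s w := by
          rw [hac, hsum c hcj, ← Finset.sum_subset (Finset.subset_univ {v, w}), Finset.sum_pair hvw, hv, hw]
          · simp [sub_eq_add_neg]
          · intro i _ hi
            simp at hi
            rw [hz i hi.1 hi.2, zero_smul]
        have hvw' := hr' v w (by rw [← ha']; exact AddSubgroup.subset_closure ha)
        rw [← Finset.sum_subset (Finset.subset_univ {v, w}), Finset.sum_pair hvw, hv, hw, hvw']
        · ring
        · intro i _ hi
          simp at hi
          rw [hz i hi.1 hi.2, zero_mul]
    | zero => exact ⟨0, rfl, by simp, fun x => by simp [dd]⟩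
    | add y z _ _ hy hz =>
      obtain ⟨c, c1, c2, c3⟩ := hy
      obtain ⟨d, d1, d2, d3⟩ := hz
      refine ⟨c + d, by simp [c1, d1], by simp [add_smul, Finset.sum_add_distrib, c2, d2], fun x => ?_⟩
      have e1 := c3 x
      have e2 := d3 x
      rw [dd_sum'] at e1 e2 ⊢
      simp only [Pi.add_apply, add_mul, Finset.sum_add_distrib, e1, e2, add_zero]
    | neg y _ hy =>
      obtain ⟨c, c1, c2, c3⟩ := hy
      refine ⟨-c, by simp [c1], by simp [c2], fun x => ?_⟩
      have e1 := c3 x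
      rw [dd_sum'] at e1 ⊢
      simp only [Pi.neg_apply, neg_mul, Finset.sum_neg_distrib, e1, neg_zero]
  obtain ⟨c, hc, htc⟩ := closure_coeff ht
  have hcj : c j = 0 := hc j (by simp)
  obtain ⟨d, hd, hnd, hd3⟩ := key _ hnt
  have hcd : n • c = d := by
    apply hA.uniqj (j := j) (by simp [hcj]) hd
    rw [← hnd, htc, Finset.smul_sum]
    exact Finset.sum_congr rfl fun k _ => by simp [mul_smul]
  have hcl : ∀ x, ∑ i, dd p c i * (if r i = x then 1 else 0) = 0 := by
    intro x
    have e1 := hd3 x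
    rw [← hcd, dd_sum'] at e1
    rw [dd_sum']
    simp only [Pi.smul_apply, smul_eq_mul, mul_assoc, ← Finset.mul_sum] at e1
    exact (mul_eq_zero.1 e1).resolve_left hn
  have h1 : t = ∑ i, dd p c i • (s i - s (r i)) + ∑ i, dd p c i • s (r i) := by
    rw [htc, hsum c hcj, ← Finset.sum_add_distrib]
    exact Finset.sum_congr rfl fun i _ => by rw [← smul_add, sub_add_cancel]
  have h2 : ∑ i, dd p c i • s (r i) = 0 := by
    have : ∀ i, dd p c i • s (r i) = ∑ x, (dd p c i * (if r i = x then 1 else 0)) • s x := by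
      intro i
      simp [ite_smul, mul_ite]
    rw [Finset.sum_congr rfl fun i _ => this i, Finset.sum_comm]
    refine Finset.sum_eq_zero fun x _ => ?_
    rw [← Finset.sum_smul, hcl, zero_smul]
  rw [h1, h2, add_zero]
  exact Q.sum_mem fun i _ => Q.zsmul_mem (hr i) _

end M
end TS

namespace TS
open scoped InnerProductSpace

def QF {d : ℕ} (T : Fin (d+1) → Fin (d+1) → ℕ) (c : Fin (d+1) → ℤ) : ℤ :=
  ∑ i, (2 * c i ^ 2 - c i * ∑ k, (T i k : ℤ) * c k)

section N
variable {E : Type*} [NormedAddCommGroup E] [InnerProductSpace ℝ E] {Φ : Set E}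

lemma sum9 {A : Type*} [AddCommMonoid A] (f : Fin (8+1) → A) :
    ∑ k, f k = f 0 + f 1 + f 2 + f 3 + f 4 + f 5 + f 6 + f 7 + f 8 := by
  rw [Fin.sum_univ_castSucc, Fin.sum_univ_eight]; rfl
lemma sum8 {A : Type*} [AddCommMonoid A] (f : Fin (7+1) → A) :
    ∑ k, f k = f 0 + f 1 + f 2 + f 3 + f 4 + f 5 + f 6 + f 7 := Fin.sum_univ_eight f
lemma sum7 {A : Type*} [AddCommMonoid A] (f : Fin (6+1) → A) :
    ∑ k, f k = f 0 + f 1 + f 2 + f 3 + f 4 + f 5 + f 6 := Fin.sum_univ_seven f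
lemma sum5 {A : Type*} [AddCommMonoid A] (f : Fin (4+1) → A) :
    ∑ k, f k = f 0 + f 1 + f 2 + f 3 + f 4 := Fin.sum_univ_five f
lemma sum3 {A : Type*} [AddCommMonoid A] (f : Fin (2+1) → A) :
    ∑ k, f k = f 0 + f 1 + f 2 := Fin.sum_univ_three f

lemma QE8 (c : Fin (8+1) → ℤ) : QF TE8 c = 2*(c 0^2+c 1^2+c 2^2+c 3^2+c 4^2+c 5^2+c 6^2+c 7^2+c 8^2)
   - 2*(c 0*c 1+c 1*c 2+c 2*c 3+c 3*c 4+c 4*c 5+c 5*c 6+c 6*c 7+c 5*c 8) := by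
  simp only [QF, sum9]
  simp [TE8]
  ring
lemma QE7 (c : Fin (7+1) → ℤ) : QF TE7 c = 2*(c 0^2+c 1^2+c 2^2+c 3^2+c 4^2+c 5^2+c 6^2+c 7^2)
   - 2*(c 0*c 1+c 1*c 2+c 2*c 3+c 3*c 4+c 4*c 5+c 5*c 6+c 3*c 7) := by
  simp only [QF, sum8]
  simp [TE7]
  ring
lemma QE6 (c : Fin (6+1) → ℤ) : QF TE6 c = 2*(c 0^2+c 1^2+c 2^2+c 3^2+c 4^2+c 5^2+c 6^2)
   - 2*(c 0*c 1+c 1*c 2+c 2*c 3+c 3*c 4+c 2*c 5+c 5*c 6) := by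
  simp only [QF, sum7]
  simp [TE6]
  ring

def NoTor {κ : Type*} (Φ : Set E) (u : κ → E) (j : κ) : Prop :=
  ∀ P ⊆ Φ, (∀ a ∈ P, a ∈ AddSubgroup.closure (u '' {k | k ≠ j})) →
    ∀ t ∈ AddSubgroup.closure (u '' {k | k ≠ j}), ∀ n : ℤ, n ≠ 0 →
      n • t ∈ AddSubgroup.closure P → t ∈ AddSubgroup.closure P

lemma sqp (x : ℤ) : x ≤ x^2 := by nlinarith [Int.le_self_sq x]
lemma sqn (x : ℤ) : -x ≤ x^2 := by have := sqp (-x); rwa [neg_sq] at this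

lemma comb3 (X Y Z a b c : ℤ) (h1 : a ≤ X) (h2 : -a ≤ X) (h3 : b ≤ Y) (h4 : -b ≤ Y) (h5 : c ≤ Z)
    (h6 : -c ≤ Z) (h : X + Y + Z + a^2 + b^2 + c^2 ≤ 2) : X + Y + Z + (a + b + c)^2 ≤ 2 := by
  have a1 := sqp a
  have a2 := sqn a
  have b1 := sqp b
  have b2 := sqn b
  have c1 := sqp c
  have c2 := sqn c
  have ha : -1 ≤ a := by linarith
  have ha' : a ≤ 1 := by linarith
  have hb : -1 ≤ b := by linarith
  have hb' : b ≤ 1 := by linarith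
  have hc : -1 ≤ c := by linarith
  have hc' : c ≤ 1 := by linarith
  interval_cases a <;> interval_cases b <;> interval_cases c <;> omega

lemma q_edge {κ : Type*} {u : κ → E} {T : κ → κ → ℕ} (hC : Car u T) (i j : κ) (hij : i ≠ j)
    (h1 : T i j = 1) (h2 : T j i = 1) : ⟪u i, u i⟫_ℝ = ⟪u j, u j⟫_ℝ := by
  have e1 := hC i j hij
  have e2 := hC j i hij.symm
  rw [h1] at e1
  rw [h2, real_inner_comm] at e2
  push_cast at *
  linarith

lemma inner_sl {d : ℕ} {u : Fin (d+1) → E} {T : Fin (d+1) → Fin (d+1) → ℕ} (hC : Car u T)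
    (hq : ∀ i, ⟪u i, u i⟫_ℝ = ⟪u 0, u 0⟫_ℝ) (hT : ∀ i, T i i = 0) (c : Fin (d+1) → ℤ) :
    2 * ⟪∑ k, c k • u k, ∑ k, c k • u k⟫_ℝ = QF T c * ⟪u 0, u 0⟫_ℝ := by
  have hg : ∀ i k, 2 * ⟪u i, u k⟫_ℝ = ((if i = k then 2 else 0) - T i k) * ⟪u 0, u 0⟫_ℝ := by
    intro i k
    by_cases hik : i = k
    · subst hik; rw [hq]; simp [hT]
    · rw [hC i k hik, hq]; simp [hik]
  rw [inner_zsum, QF]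
  push_cast
  rw [Finset.mul_sum, Finset.sum_mul]
  refine Finset.sum_congr rfl fun i _ => ?_
  rw [real_inner_comm, inner_zsum]
  have : ∑ k, (c k : ℝ) * ⟪u k, u i⟫_ℝ * 2 = (2 * c i - ∑ k, (T i k : ℝ) * c k) * ⟪u 0, u 0⟫_ℝ := by
    have e : ∀ k, (c k : ℝ) * ⟪u k, u i⟫_ℝ * 2 = ((if i = k then 2 * (c k : ℝ) else 0) - T i k * c k) * ⟪u 0, u 0⟫_ℝ := by
      intro k
      have := hg i k
      rw [real_inner_comm (u i) (u k)]
      by_cases hik : i = k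
      · simp only [hik, if_true] at this ⊢; linear_combination (c k : ℝ) * this
      · simp only [hik, if_false] at this ⊢; linear_combination (c k : ℝ) * this
    rw [Finset.sum_congr rfl fun k _ => e k, ← Finset.sum_mul, Finset.sum_sub_distrib]
    simp
  rw [← Finset.sum_mul] at this
  linear_combination (c i : ℝ) * this

lemma noTor_sl (h : RSys Φ) {d : ℕ} {u : Fin (d+1) → E} {M : Fin (d+1) → ℕ} {T : Fin (d+1) → Fin (d+1) → ℕ}
    (hA : Aff Φ u M 0) (hq : ∀ i, ⟪u i, u i⟫_ℝ = ⟪u 0, u 0⟫_ℝ) (hC : Car u T) (hT : ∀ i, T i i = 0)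
    (j : Fin (d+1)) (p : Fin (d+1) → Fin (d+1)) (s : Fin (d+1) → E)
    (hs : ∀ k, k ≠ j → u k = s k - s (p k))
    (hQ : ∀ c : Fin (d+1) → ℤ, c j = 0 → QF T c ≤ 2 → ∑ i, dd p c i ^ 2 ≤ 2) : NoTor Φ u j := by
  intro P hP hPj t ht n hn hnt
  refine hA.LA j p s hs ?_ hP hPj ht hn hnt
  intro c hc hle
  apply hQ c hc
  have h1 := inner_sl hC hq hT c
  have h2 := h.pos (hA.mem 0)
  have : (QF T c : ℝ) ≤ 2 := by
    by_contra hcon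
    push Not at hcon
    nlinarith
  exact_mod_cast this

lemma qE8 (h : RSys Φ) {u : Fin (8+1) → E} (hA : Aff Φ u ME8 0) (hC : Car u TE8) (i : Fin (8+1)) :
    ⟪u i, u i⟫_ℝ = ⟪u 0, u 0⟫_ℝ := by
  have e1 := q_edge hC 0 1 (by decide) rfl rfl
  have e2 := q_edge hC 1 2 (by decide) rfl rfl
  have e3 := q_edge hC 2 3 (by decide) rfl rfl
  have e4 := q_edge hC 3 4 (by decide) rfl rfl
  have e5 := q_edge hC 4 5 (by decide) rfl rfl
  have e6 := q_edge hC 5 6 (by decide) rfl rfl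
  have e7 := q_edge hC 6 7 (by decide) rfl rfl
  have e8 := q_edge hC 5 8 (by decide) rfl rfl
  fin_cases i <;> simp only [Fin.mk_one, Fin.zero_eta, Fin.reduceFinMk] <;> linarith

lemma qE7 (h : RSys Φ) {u : Fin (7+1) → E} (hA : Aff Φ u ME7 0) (hC : Car u TE7) (i : Fin (7+1)) :
    ⟪u i, u i⟫_ℝ = ⟪u 0, u 0⟫_ℝ := by
  have e1 := q_edge hC 0 1 (by decide) rfl rfl
  have e2 := q_edge hC 1 2 (by decide) rfl rfl
  have e3 := q_edge hC 2 3 (by decide) rfl rfl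
  have e4 := q_edge hC 3 4 (by decide) rfl rfl
  have e5 := q_edge hC 4 5 (by decide) rfl rfl
  have e6 := q_edge hC 5 6 (by decide) rfl rfl
  have e7 := q_edge hC 3 7 (by decide) rfl rfl
  fin_cases i <;> simp only [Fin.mk_one, Fin.zero_eta, Fin.reduceFinMk] <;> linarith

lemma qE6 (h : RSys Φ) {u : Fin (6+1) → E} (hA : Aff Φ u ME6 0) (hC : Car u TE6) (i : Fin (6+1)) :
    ⟪u i, u i⟫_ℝ = ⟪u 0, u 0⟫_ℝ := by
  have e1 := q_edge hC 0 1 (by decide) rfl rfl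
  have e2 := q_edge hC 1 2 (by decide) rfl rfl
  have e3 := q_edge hC 2 3 (by decide) rfl rfl
  have e4 := q_edge hC 3 4 (by decide) rfl rfl
  have e5 := q_edge hC 2 5 (by decide) rfl rfl
  have e6 := q_edge hC 5 6 (by decide) rfl rfl
  fin_cases i <;> simp only [Fin.mk_one, Fin.zero_eta, Fin.reduceFinMk] <;> linarith

lemma noE8_4 (h : RSys Φ) {u : Fin (8+1) → E} (hA : Aff Φ u ME8 0) (hC : Car u TE8) : NoTor Φ u 4 := by
  refine noTor_sl h hA (qE8 h hA hC) hC (by decide) 4 ![1,2,3,4,4,8,5,6,4]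
    ![u 0 + (u 1 + (u 2 + (u 3))), u 1 + (u 2 + (u 3)), u 2 + (u 3), u 3, 0, u 5 + (u 8), u 6 + (u 5 + (u 8)), u 7 + (u 6 + (u 5 + (u 8))), u 8] ?_ ?_
  · intro k hk
    fin_cases k <;> first | exact absurd rfl hk | simp
  · intro c hc hQ
    rw [QE8] at hQ
    have key := comb3 (c 0^2 + (c 1 - c 0)^2 + (c 2 - c 1)^2 + (c 3 - c 2)^2) (c 7^2 + (c 6 - c 7)^2 + (c 5 - c 6)^2 + (c 8 - c 5)^2) 0 (c 3) (c 8) 0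
      (by linarith [sqp (c 0), sqp ((c 1 - c 0)), sqp ((c 2 - c 1)), sqp ((c 3 - c 2))]) (by linarith [sqn (c 0), sqn ((c 1 - c 0)), sqn ((c 2 - c 1)), sqn ((c 3 - c 2))]) (by linarith [sqp (c 7), sqp ((c 6 - c 7)), sqp ((c 5 - c 6)), sqp ((c 8 - c 5))]) (by linarith [sqn (c 7), sqn ((c 6 - c 7)), sqn ((c 5 - c 6)), sqn ((c 8 - c 5))]) (by norm_num) (by norm_num)
      (by rw [hc] at hQ; linarith)
    simp only [dd, sum9]
    simp [hc]
    linarith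

lemma noE8_5 (h : RSys Φ) {u : Fin (8+1) → E} (hA : Aff Φ u ME8 0) (hC : Car u TE8) : NoTor Φ u 5 := by
  refine noTor_sl h hA (qE8 h hA hC) hC (by decide) 5 ![1,2,3,4,5,5,5,6,5]
    ![u 0 + (u 1 + (u 2 + (u 3 + (u 4)))), u 1 + (u 2 + (u 3 + (u 4))), u 2 + (u 3 + (u 4)), u 3 + (u 4), u 4, 0, u 6, u 7 + (u 6), u 8] ?_ ?_
  · intro k hk
    fin_cases k <;> first | exact absurd rfl hk | simp
  · intro c hc hQ
    rw [QE8] at hQ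
    have key := comb3 (c 0^2 + (c 1 - c 0)^2 + (c 2 - c 1)^2 + (c 3 - c 2)^2 + (c 4 - c 3)^2) (c 7^2 + (c 6 - c 7)^2) (c 8^2) (c 4) (c 6) (c 8)
      (by linarith [sqp (c 0), sqp ((c 1 - c 0)), sqp ((c 2 - c 1)), sqp ((c 3 - c 2)), sqp ((c 4 - c 3))]) (by linarith [sqn (c 0), sqn ((c 1 - c 0)), sqn ((c 2 - c 1)), sqn ((c 3 - c 2)), sqn ((c 4 - c 3))]) (by linarith [sqp (c 7), sqp ((c 6 - c 7))]) (by linarith [sqn (c 7), sqn ((c 6 - c 7))]) (by linarith [sqp (c 8)]) (by linarith [sqn (c 8)])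
      (by rw [hc] at hQ; linarith)
    simp only [dd, sum9]
    simp [hc]
    linarith

lemma noE8_6 (h : RSys Φ) {u : Fin (8+1) → E} (hA : Aff Φ u ME8 0) (hC : Car u TE8) : NoTor Φ u 6 := by
  refine noTor_sl h hA (qE8 h hA hC) hC (by decide) 6 ![1,2,3,4,5,8,6,6,6]
    ![u 0 + (u 1 + (u 2 + (u 3 + (u 4 + (u 5 + (u 8)))))), u 1 + (u 2 + (u 3 + (u 4 + (u 5 + (u 8))))), u 2 + (u 3 + (u 4 + (u 5 + (u 8)))), u 3 + (u 4 + (u 5 + (u 8))), u 4 + (u 5 + (u 8)), u 5 + (u 8), 0, u 7, u 8] ?_ ?_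
  · intro k hk
    fin_cases k <;> first | exact absurd rfl hk | simp
  · intro c hc hQ
    rw [QE8] at hQ
    have key := comb3 (c 0^2 + (c 1 - c 0)^2 + (c 2 - c 1)^2 + (c 3 - c 2)^2 + (c 4 - c 3)^2 + (c 5 - c 4)^2 + (c 8 - c 5)^2) (c 7^2) 0 (c 8) (c 7) 0
      (by linarith [sqp (c 0), sqp ((c 1 - c 0)), sqp ((c 2 - c 1)), sqp ((c 3 - c 2)), sqp ((c 4 - c 3)), sqp ((c 5 - c 4)), sqp ((c 8 - c 5))]) (by linarith [sqn (c 0), sqn ((c 1 - c 0)), sqn ((c 2 - c 1)), sqn ((c 3 - c 2)), sqn ((c 4 - c 3)), sqn ((c 5 - c 4)), sqn ((c 8 - c 5))]) (by linarith [sqp (c 7)]) (by linarith [sqn (c 7)]) (by norm_num) (by norm_num)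
      (by rw [hc] at hQ; linarith)
    simp only [dd, sum9]
    simp [hc]
    linarith

lemma noE8_8 (h : RSys Φ) {u : Fin (8+1) → E} (hA : Aff Φ u ME8 0) (hC : Car u TE8) : NoTor Φ u 8 := by
  refine noTor_sl h hA (qE8 h hA hC) hC (by decide) 8 ![1,2,3,4,5,6,7,8,8]
    ![u 0 + (u 1 + (u 2 + (u 3 + (u 4 + (u 5 + (u 6 + (u 7))))))), u 1 + (u 2 + (u 3 + (u 4 + (u 5 + (u 6 + (u 7)))))), u 2 + (u 3 + (u 4 + (u 5 + (u 6 + (u 7))))), u 3 + (u 4 + (u 5 + (u 6 + (u 7)))), u 4 + (u 5 + (u 6 + (u 7))), u 5 + (u 6 + (u 7)), u 6 + (u 7), u 7, 0] ?_ ?_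
  · intro k hk
    fin_cases k <;> first | exact absurd rfl hk | simp
  · intro c hc hQ
    rw [QE8] at hQ
    have key := comb3 (c 0^2 + (c 1 - c 0)^2 + (c 2 - c 1)^2 + (c 3 - c 2)^2 + (c 4 - c 3)^2 + (c 5 - c 4)^2 + (c 6 - c 5)^2 + (c 7 - c 6)^2) 0 0 (c 7) 0 0
      (by linarith [sqp (c 0), sqp ((c 1 - c 0)), sqp ((c 2 - c 1)), sqp ((c 3 - c 2)), sqp ((c 4 - c 3)), sqp ((c 5 - c 4)), sqp ((c 6 - c 5)), sqp ((c 7 - c 6))]) (by linarith [sqn (c 0), sqn ((c 1 - c 0)), sqn ((c 2 - c 1)), sqn ((c 3 - c 2)), sqn ((c 4 - c 3)), sqn ((c 5 - c 4)), sqn ((c 6 - c 5)), sqn ((c 7 - c 6))]) (by norm_num) (by norm_num) (by norm_num) (by norm_num)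
      (by rw [hc] at hQ; linarith)
    simp only [dd, sum9]
    simp [hc]
    linarith

lemma noE7_2 (h : RSys Φ) {u : Fin (7+1) → E} (hA : Aff Φ u ME7 0) (hC : Car u TE7) : NoTor Φ u 2 := by
  refine noTor_sl h hA (qE7 h hA hC) hC (by decide) 2 ![1,2,2,4,5,6,2,3]
    ![u 0 + (u 1), u 1, 0, u 3 + (u 4 + (u 5 + (u 6))), u 4 + (u 5 + (u 6)), u 5 + (u 6), u 6, u 7 + (u 3 + (u 4 + (u 5 + (u 6))))] ?_ ?_
  · intro k hk
    fin_cases k <;> first | exact absurd rfl hk | simp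
  · intro c hc hQ
    rw [QE7] at hQ
    have key := comb3 (c 0^2 + (c 1 - c 0)^2) (c 7^2 + (c 3 - c 7)^2 + (c 4 - c 3)^2 + (c 5 - c 4)^2 + (c 6 - c 5)^2) 0 (c 1) (c 6) 0
      (by linarith [sqp (c 0), sqp ((c 1 - c 0))]) (by linarith [sqn (c 0), sqn ((c 1 - c 0))]) (by linarith [sqp (c 7), sqp ((c 3 - c 7)), sqp ((c 4 - c 3)), sqp ((c 5 - c 4)), sqp ((c 6 - c 5))]) (by linarith [sqn (c 7), sqn ((c 3 - c 7)), sqn ((c 4 - c 3)), sqn ((c 5 - c 4)), sqn ((c 6 - c 5))]) (by norm_num) (by norm_num)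
      (by rw [hc] at hQ; linarith)
    simp only [dd, sum8]
    simp [hc]
    linarith

lemma noE7_4 (h : RSys Φ) {u : Fin (7+1) → E} (hA : Aff Φ u ME7 0) (hC : Car u TE7) : NoTor Φ u 4 := by
  refine noTor_sl h hA (qE7 h hA hC) hC (by decide) 4 ![1,2,3,7,4,4,5,4]
    ![u 0 + (u 1 + (u 2 + (u 3 + (u 7)))), u 1 + (u 2 + (u 3 + (u 7))), u 2 + (u 3 + (u 7)), u 3 + (u 7), 0, u 5, u 6 + (u 5), u 7] ?_ ?_
  · intro k hk
    fin_cases k <;> first | exact absurd rfl hk | simp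
  · intro c hc hQ
    rw [QE7] at hQ
    have key := comb3 (c 0^2 + (c 1 - c 0)^2 + (c 2 - c 1)^2 + (c 3 - c 2)^2 + (c 7 - c 3)^2) (c 6^2 + (c 5 - c 6)^2) 0 (c 7) (c 5) 0
      (by linarith [sqp (c 0), sqp ((c 1 - c 0)), sqp ((c 2 - c 1)), sqp ((c 3 - c 2)), sqp ((c 7 - c 3))]) (by linarith [sqn (c 0), sqn ((c 1 - c 0)), sqn ((c 2 - c 1)), sqn ((c 3 - c 2)), sqn ((c 7 - c 3))]) (by linarith [sqp (c 6), sqp ((c 5 - c 6))]) (by linarith [sqn (c 6), sqn ((c 5 - c 6))]) (by norm_num) (by norm_num)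
      (by rw [hc] at hQ; linarith)
    simp only [dd, sum8]
    simp [hc]
    linarith

lemma noE7_3 (h : RSys Φ) {u : Fin (7+1) → E} (hA : Aff Φ u ME7 0) (hC : Car u TE7) : NoTor Φ u 3 := by
  refine noTor_sl h hA (qE7 h hA hC) hC (by decide) 3 ![1,2,3,3,3,4,5,3]
    ![u 0 + (u 1 + (u 2)), u 1 + (u 2), u 2, 0, u 4, u 5 + (u 4), u 6 + (u 5 + (u 4)), u 7] ?_ ?_
  · intro k hk
    fin_cases k <;> first | exact absurd rfl hk | simp
  · intro c hc hQ
    rw [QE7] at hQ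
    have key := comb3 (c 0^2 + (c 1 - c 0)^2 + (c 2 - c 1)^2) (c 6^2 + (c 5 - c 6)^2 + (c 4 - c 5)^2) (c 7^2) (c 2) (c 4) (c 7)
      (by linarith [sqp (c 0), sqp ((c 1 - c 0)), sqp ((c 2 - c 1))]) (by linarith [sqn (c 0), sqn ((c 1 - c 0)), sqn ((c 2 - c 1))]) (by linarith [sqp (c 6), sqp ((c 5 - c 6)), sqp ((c 4 - c 5))]) (by linarith [sqn (c 6), sqn ((c 5 - c 6)), sqn ((c 4 - c 5))]) (by linarith [sqp (c 7)]) (by linarith [sqn (c 7)])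
      (by rw [hc] at hQ; linarith)
    simp only [dd, sum8]
    simp [hc]
    linarith

lemma noE6_2 (h : RSys Φ) {u : Fin (6+1) → E} (hA : Aff Φ u ME6 0) (hC : Car u TE6) : NoTor Φ u 2 := by
  refine noTor_sl h hA (qE6 h hA hC) hC (by decide) 2 ![1,2,2,2,3,2,5]
    ![u 0 + (u 1), u 1, 0, u 3, u 4 + (u 3), u 5, u 6 + (u 5)] ?_ ?_
  · intro k hk
    fin_cases k <;> first | exact absurd rfl hk | simp
  · intro c hc hQ
    rw [QE6] at hQ
    have key := comb3 (c 0^2 + (c 1 - c 0)^2) (c 4^2 + (c 3 - c 4)^2) (c 6^2 + (c 5 - c 6)^2) (c 1) (c 3) (c 5)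
      (by linarith [sqp (c 0), sqp ((c 1 - c 0))]) (by linarith [sqn (c 0), sqn ((c 1 - c 0))]) (by linarith [sqp (c 4), sqp ((c 3 - c 4))]) (by linarith [sqn (c 4), sqn ((c 3 - c 4))]) (by linarith [sqp (c 6), sqp ((c 5 - c 6))]) (by linarith [sqn (c 6), sqn ((c 5 - c 6))])
      (by rw [hc] at hQ; linarith)
    simp only [dd, sum7]
    simp [hc]
    linarith


end N
end TS

namespace TS
open scoped InnerProductSpace
section O
variable {E : Type*} [NormedAddCommGroup E] [InnerProductSpace ℝ E] {Φ : Set E}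

lemma inner_F4 (h : RSys Φ) {u : Fin (4+1) → E} (hA : Aff Φ u MF4 0) (hC : Car u TF4) (c : Fin (4+1) → ℤ) 
    (hle : ⟪∑ k, c k • u k, ∑ k, c k • u k⟫_ℝ ≤ ⟪u 0, u 0⟫_ℝ) :
    2 * (c 0^2 + c 1^2 + c 2^2 - c 0 * c 1 - c 1 * c 2) + c 3^2 + c 4^2 - 2 * c 2 * c 3 - c 3 * c 4 ≤ 2 := by
  have c01 := hC 0 1 (by decide)
  have c02 := hC 0 2 (by decide)
  have c03 := hC 0 3 (by decide)
  have c04 := hC 0 4 (by decide)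
  have c12 := hC 1 2 (by decide)
  have c13 := hC 1 3 (by decide)
  have c14 := hC 1 4 (by decide)
  have c23 := hC 2 3 (by decide)
  have c32 := hC 3 2 (by decide)
  have c24 := hC 2 4 (by decide)
  have c34 := hC 3 4 (by decide)
  have e1 := q_edge hC 0 1 (by decide) rfl rfl
  have e2 := q_edge hC 1 2 (by decide) rfl rfl
  have e3 := q_edge hC 3 4 (by decide) rfl rfl
  rw [real_inner_comm] at c32
  have hp := h.pos (hA.mem 0)
  simp only [TF4, Matrix.cons_val] at c01 c02 c03 c04 c12 c13 c14 c23 c24 c34 c32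
  norm_num [-real_inner_self_eq_norm_sq] at c01 c02 c03 c04 c12 c13 c14 c23 c24 c34 c32
  simp only [← real_inner_self_eq_norm_sq] at c01 c12 c23 c34 c32
  generalize hN : ⟪u 0, u 0⟫_ℝ = N at *
  have f1 : ⟪u 1, u 1⟫_ℝ = N := by linarith
  have f2 : ⟪u 2, u 2⟫_ℝ = N := by linarith
  have f3 : ⟪u 3, u 3⟫_ℝ = N / 2 := by linarith
  have f4 : ⟪u 4, u 4⟫_ℝ = N / 2 := by linarith
  have g01 : ⟪u 0, u 1⟫_ℝ = -N / 2 := by linarith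
  have g12 : ⟪u 1, u 2⟫_ℝ = -N / 2 := by linarith
  have g23 : ⟪u 2, u 3⟫_ℝ = -N / 2 := by linarith
  have g34 : ⟪u 3, u 4⟫_ℝ = -N / 4 := by linarith
  simp only [sum_zsmul_cast, sum5, inner_add_left, inner_add_right, real_inner_smul_left, real_inner_smul_right,
    real_inner_comm (u 0) (u 1), real_inner_comm (u 0) (u 2), real_inner_comm (u 0) (u 3), real_inner_comm (u 0) (u 4),
    real_inner_comm (u 1) (u 2), real_inner_comm (u 1) (u 3), real_inner_comm (u 1) (u 4), real_inner_comm (u 2) (u 3),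
    real_inner_comm (u 2) (u 4), real_inner_comm (u 3) (u 4), hN, f1, f2, f3, f4, g01, g12, g23, g34, c02, c03, c04, c13, c14, c24] at hle
  have : (2 * ((c 0:ℝ)^2 + c 1^2 + c 2^2 - c 0 * c 1 - c 1 * c 2) + c 3^2 + c 4^2 - 2 * c 2 * c 3 - c 3 * c 4) ≤ 2 := by
    by_contra hcon
    push Not at hcon
    nlinarith
  exact_mod_cast this

lemma auxF (a b c d : ℤ) (h : 2 * (a^2 + b^2 - a*b) + (c^2 + d^2 - c*d) ≤ 2) :
    (a^2 + b^2 - a*b) + (c^2 + d^2 - c*d) ≤ 1 := by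
  have hA : 0 ≤ a^2 + b^2 - a*b := by nlinarith [sq_nonneg (2*a - b), sq_nonneg b]
  have hB : 0 ≤ c^2 + d^2 - c*d := by nlinarith [sq_nonneg (2*c - d), sq_nonneg d]
  have h2 : c^2 + d^2 - c*d ≠ 2 := by
    intro h2
    have h3 : d ≤ 1 := by nlinarith [sq_nonneg (2*c - d)]
    have h4 : -1 ≤ d := by nlinarith [sq_nonneg (2*c - d)]
    have h5 : c ≤ 1 := by nlinarith [sq_nonneg (2*d - c)]
    have h6 : -1 ≤ c := by nlinarith [sq_nonneg (2*d - c)]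
    interval_cases c <;> interval_cases d <;> omega
  omega

lemma auxF' (a b c d : ℤ) (h : 2 * (a^2 + b^2 + c^2 - a*b - b*c) + d^2 ≤ 2) :
    (a^2 + b^2 + c^2 - a*b - b*c) + d^2 ≤ 1 := by
  have hA : 0 ≤ a^2 + b^2 + c^2 - a*b - b*c := by nlinarith [sq_nonneg (a - b), sq_nonneg (b - c), sq_nonneg a, sq_nonneg c]
  have h3 : d ≤ 1 := by nlinarith
  have h4 : -1 ≤ d := by nlinarith
  interval_cases d <;> omega

lemma noF4_2 (h : RSys Φ) {u : Fin (4+1) → E} (hA : Aff Φ u MF4 0) (hC : Car u TF4) : NoTor Φ u 2 := by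
  intro P hP hPj t ht n hn hnt
  refine hA.LA 2 ![1,2,2,4,2] ![u 0 + u 1, u 1, 0, u 3 + u 4, u 4] ?_ ?_ hP hPj ht hn hnt
  · intro k hk
    fin_cases k <;> first | exact absurd rfl hk | simp
  · intro c hc hQ
    have hQ := inner_F4 h hA hC c hQ
    rw [hc] at hQ
    have hB := auxF (c 0) (c 1) (c 3) (c 4) (by linarith)
    have key := comb3 (c 0^2 + (c 1 - c 0)^2) (c 3^2 + (c 4 - c 3)^2) 0 (c 1) (c 4) 0
      (by linarith [sqp (c 0), sqp (c 1 - c 0)]) (by linarith [sqn (c 0), sqn (c 1 - c 0)])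
      (by linarith [sqp (c 3), sqp (c 4 - c 3)]) (by linarith [sqn (c 3), sqn (c 4 - c 3)])
      (by norm_num) (by norm_num)
      (by linarith)
    simp only [dd, sum5]
    simp [hc]
    linarith

lemma noF4_3 (h : RSys Φ) {u : Fin (4+1) → E} (hA : Aff Φ u MF4 0) (hC : Car u TF4) : NoTor Φ u 3 := by
  intro P hP hPj t ht n hn hnt
  refine hA.LA 3 ![1,2,3,3,3] ![u 0 + (u 1 + u 2), u 1 + u 2, u 2, 0, u 4] ?_ ?_ hP hPj ht hn hnt
  · intro k hk
    fin_cases k <;> first | exact absurd rfl hk | simp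
  · intro c hc hQ
    have hQ := inner_F4 h hA hC c hQ
    rw [hc] at hQ
    have hB := auxF' (c 0) (c 1) (c 2) (c 4) (by linarith)
    have key := comb3 (c 0^2 + (c 1 - c 0)^2 + (c 2 - c 1)^2) (c 4^2) 0 (c 2) (c 4) 0
      (by linarith [sqp (c 0), sqp (c 1 - c 0), sqp (c 2 - c 1)]) (by linarith [sqn (c 0), sqn (c 1 - c 0), sqn (c 2 - c 1)])
      (sqp _) (sqn _)
      (by norm_num) (by norm_num)
      (by linarith)
    simp only [dd, sum5]
    simp [hc]
    linarith

lemma noG2_2 (h : RSys Φ) {u : Fin (2+1) → E} (hA : Aff Φ u MG2 0) (hC : Car u TG2) : NoTor Φ u 2 := by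
  intro P hP hPj t ht n hn hnt
  refine hA.LA 2 ![1,2,2] ![u 0 + u 1, u 1, 0] ?_ ?_ hP hPj ht hn hnt
  · intro k hk
    fin_cases k <;> first | exact absurd rfl hk | simp
  · intro c hc hle
    have c01 := hC 0 1 (by decide)
    have e1 := q_edge hC 0 1 (by decide) rfl rfl
    have hp := h.pos (hA.mem 0)
    rw [show TG2 0 1 = 1 from rfl] at c01
    generalize hN : ⟪u 0, u 0⟫_ℝ = N at *
    have f1 : ⟪u 1, u 1⟫_ℝ = N := by linarith
    have g01 : ⟪u 0, u 1⟫_ℝ = -N / 2 := by push_cast at c01; linarith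
    simp only [sum_zsmul_cast, sum3, hc, Int.cast_zero, zero_smul, add_zero, inner_add_left, inner_add_right, real_inner_smul_left, real_inner_smul_right,
      real_inner_comm (u 0) (u 1), hN, f1, g01] at hle
    have : ((c 0:ℝ)^2 + c 1^2 - c 0 * c 1) ≤ 1 := by
      by_contra hcon
      push Not at hcon
      nlinarith
    have hQ : c 0^2 + c 1^2 - c 0 * c 1 ≤ 1 := by exact_mod_cast this
    simp only [dd, sum3]
    simp [hc]
    linarith

end O
end TS

namespace TS
open scoped InnerProductSpace
section Q

lemma cyc1 {e : ℕ} (he : 0 < e) {a b : ℝ} (ha : ∀ k : ℤ, IsInt (k * a) → (e : ℤ) ∣ k)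
    (hae : IsInt (e * a)) (hb : IsInt (e * b)) : ∃ k : ℤ, IsInt (b - k * a) := by
  obtain ⟨A, hA⟩ := hae
  obtain ⟨B, hB⟩ := hb
  have heR : (e : ℝ) ≠ 0 := by positivity
  have ha' : a = A / e := by field_simp; linarith
  have hb' : b = B / e := by field_simp; linarith
  have hcop : IsCoprime A (e : ℤ) := by
    rw [Int.isCoprime_iff_gcd_eq_one]
    have h1 : ((Int.gcd A e : ℕ) : ℤ) ∣ A := Int.gcd_dvd_left ..
    have h2 : ((Int.gcd A e : ℕ) : ℤ) ∣ e := Int.gcd_dvd_right ..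
    obtain ⟨A', hA'⟩ := h1
    obtain ⟨e', he'⟩ := h2
    have h3 := ha e' ⟨A', by
      rw [ha']
      field_simp
      have h1 : (A : ℝ) = (Int.gcd A e : ℕ) * A' := by exact_mod_cast hA'
      have h2 : (e : ℝ) = (Int.gcd A e : ℕ) * e' := by exact_mod_cast he'
      linear_combination (e' : ℝ) * h1 - (A' : ℝ) * h2⟩
    rw [he'] at h3
    have he0 : e' ≠ 0 := by rintro rfl; simp at he'; omega
    have h4 : ((Int.gcd A e : ℕ) : ℤ) ∣ 1 := by
      obtain ⟨q, hq⟩ := h3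
      refine ⟨q, ?_⟩
      have : e' * 1 = e' * ((Int.gcd A e : ℕ) * q) := by rw [mul_one]; nth_rw 1 [hq]; ring
      exact mul_left_cancel₀ he0 this
    exact_mod_cast Int.eq_one_of_dvd_one (by positivity) h4
  obtain ⟨x, y, hxy⟩ := hcop
  refine ⟨B * x, B * y, ?_⟩
  have hxy' : (x : ℝ) * A + y * e = 1 := by exact_mod_cast hxy
  rw [ha', hb']
  push_cast
  field_simp
  linear_combination (-(B : ℝ)) * hxy'

variable {E : Type*} [NormedAddCommGroup E] [InnerProductSpace ℝ E] {Φ : Set E}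

def Concl (Φ P : Set E) (t : E) (e : ℕ) : Prop :=
  ∃ w ∈ AddSubgroup.closure Φ, ∃ p : ℕ, p • w ∈ AddSubgroup.closure P ∧
    (∀ s ∈ AddSubgroup.closure Φ, (∃ n : ℤ, n ≠ 0 ∧ n • s ∈ AddSubgroup.closure P) →
      ∃ k l : ℤ, s - k • t - l • w ∈ AddSubgroup.closure P) ∧
    (∀ k l : ℤ, k • t + l • w ∈ AddSubgroup.closure P → (e : ℤ) ∣ k ∧ (p : ℤ) ∣ l) ∧
    (p = 1 ∧ (e = 3 ∨ e = 4 ∨ e = 5 ∨ e = 6) ∨ p = 2 ∧ e = 4 ∨ p = 3 ∧ e = 3)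

lemma isInt_hom {P : Set E} (χ : E →+ ℝ) (h : ∀ a ∈ P, IsInt (χ a)) {t : E}
    (ht : t ∈ AddSubgroup.closure P) : IsInt (χ t) := by
  induction ht using AddSubgroup.closure_induction with
  | mem a ha => exact h a ha
  | zero => rw [map_zero]; exact IsInt.zero
  | add a b _ _ ha hb => rw [map_add]; exact ha.add hb
  | neg a _ ha => rw [map_neg]; exact ha.neg

lemma concl_of {P : Set E} {t : E} {e : ℕ} (he : 3 ≤ e)
    (hord : ∀ k : ℤ, k • t ∈ AddSubgroup.closure P ↔ (e : ℤ) ∣ k)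
    (hP : P ⊆ Φ) (ht : t ∈ AddSubgroup.closure Φ)
    (hexp : ∀ s ∈ AddSubgroup.closure Φ, (∃ n : ℤ, n ≠ 0 ∧ n • s ∈ AddSubgroup.closure P) →
      (e : ℤ) • s ∈ AddSubgroup.closure P)
    (χ : E →+ ℝ) (hχt : ∀ k : ℤ, IsInt (k * χ t) → (e : ℤ) ∣ k) (hχP : ∀ a ∈ P, IsInt (χ a))
    (w : E) (hw : w ∈ AddSubgroup.closure Φ) (hχw : IsInt (χ w)) (p : ℕ)
    (hwp : ∀ l : ℤ, l • w ∈ AddSubgroup.closure P ↔ (p : ℤ) ∣ l)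
    (hker : ∀ s ∈ AddSubgroup.closure Φ, (∃ n : ℤ, n ≠ 0 ∧ n • s ∈ AddSubgroup.closure P) → IsInt (χ s) →
      ∃ l : ℤ, s - l • w ∈ AddSubgroup.closure P)
    (hfin : p = 1 ∧ (e = 3 ∨ e = 4 ∨ e = 5 ∨ e = 6) ∨ p = 2 ∧ e = 4 ∨ p = 3 ∧ e = 3) :
    Concl Φ P t e := by
  have hz : ∀ (k : ℤ) (s : E), χ (k • s) = k * χ s := by intro k s; rw [map_zsmul]; simp
  refine ⟨w, hw, p, ?_, ?_, ?_, hfin⟩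
  · have := (hwp p).2 dvd_rfl
    simpa using this
  · intro s hs hsn
    have h1 := isInt_hom χ hχP (hexp s hs hsn)
    have h2 := isInt_hom χ hχP ((hord e).2 dvd_rfl)
    rw [hz] at h1 h2
    obtain ⟨k, hk⟩ := cyc1 (by omega : 0 < e) hχt (by simpa using h2) (by simpa using h1)
    obtain ⟨l, hl⟩ := hker (s - k • t) (sub_mem hs (zsmul_mem ht k)) ⟨e, by omega, by
      rw [smul_sub]
      refine sub_mem (hexp s hs hsn) ?_
      rw [smul_comm]; exact zsmul_mem ((hord e).2 dvd_rfl) k⟩ (by rw [map_sub, hz]; exact hk)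
    exact ⟨k, l, hl⟩
  · intro k l hkl
    have h1 := isInt_hom χ hχP hkl
    rw [map_add, hz, hz] at h1
    have h2 := h1.sub ((IsInt.int l).mul hχw)
    have h3 := hχt k (by simpa using h2)
    refine ⟨h3, (hwp l).1 ?_⟩
    have := sub_mem hkl ((hord k).2 h3)
    simpa using this

lemma map_cl (g : E ≃ₗᵢ[ℝ] E) (P : Set E) (s : E) :
    g s ∈ AddSubgroup.closure (g '' P) ↔ s ∈ AddSubgroup.closure P := by
  have : AddSubgroup.closure (g '' P) = (AddSubgroup.closure P).map (g : E →+ E) := by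
    rw [AddMonoidHom.map_closure]; rfl
  rw [this, AddSubgroup.mem_map]
  constructor
  · rintro ⟨x, hx, hxs⟩
    have : x = s := g.injective hxs
    rwa [← this]
  · intro hs; exact ⟨s, hs, rfl⟩

lemma map_phi (g : E ≃ₗᵢ[ℝ] E) (hg : ∀ a, g a ∈ Φ ↔ a ∈ Φ) (s : E) :
    g s ∈ AddSubgroup.closure Φ ↔ s ∈ AddSubgroup.closure Φ := by
  have : g '' Φ = Φ := by
    ext a; constructor
    · rintro ⟨b, hb, rfl⟩; exact (hg b).2 hb
    · intro ha; exact ⟨g.symm a, (hg _).1 (by simpa using ha), by simp⟩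
  nth_rw 1 [← this]
  exact map_cl g Φ s

lemma ker_mem {κ : Type*} {u : κ → E} {P : Set E} (hP : P ⊆ Φ) (g : E ≃ₗᵢ[ℝ] E) (hg : ∀ a, g a ∈ Φ ↔ a ∈ Φ)
    (J : Finset κ) (j : κ) (hj : j ∈ J) (hPJ : ∀ a ∈ P, g a ∈ AddSubgroup.closure (u '' {k | k ∉ J}))
    (hN : NoTor Φ u j) {s : E} (hs : g s ∈ AddSubgroup.closure (u '' {k | k ∉ J}))
    (hns : ∃ n : ℤ, n ≠ 0 ∧ n • s ∈ AddSubgroup.closure P) : s ∈ AddSubgroup.closure P := by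
  have hmono : AddSubgroup.closure (u '' {k | k ∉ J}) ≤ AddSubgroup.closure (u '' {k | k ≠ j}) :=
    AddSubgroup.closure_mono (Set.image_mono fun k hk => by rintro rfl; exact hk hj)
  obtain ⟨n, hn, hns⟩ := hns
  rw [← map_cl g P]
  refine hN (g '' P) ?_ ?_ (g s) (hmono hs) n hn ?_
  · rintro _ ⟨a, ha, rfl⟩; exact (hg a).2 (hP ha)
  · rintro _ ⟨a, ha, rfl⟩; exact hmono (hPJ a ha)
  · rw [← map_zsmul, map_cl]; exact hns

/-- the functional of S1 -/
def chi (g : E ≃ₗᵢ[ℝ] E) (x : E) : E →+ ℝ where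
  toFun s := ⟪g s, x⟫_ℝ
  map_zero' := by simp
  map_add' a b := by rw [map_add, inner_add_left]

lemma span_of_tor {P : Set E} {s : E} (hns : ∃ n : ℤ, n ≠ 0 ∧ n • s ∈ AddSubgroup.closure P) :
    s ∈ Submodule.span ℝ P := by
  obtain ⟨n, hn, hns⟩ := hns
  have h1 := closure_le_span P hns
  have h2 : s = (n : ℝ)⁻¹ • (n • s) := by
    rw [← Int.cast_smul_eq_zsmul ℝ, smul_smul, inv_mul_cancel₀ (by exact_mod_cast hn), one_smul]
  rw [h2]; exact Submodule.smul_mem _ _ h1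

end Q
end TS

namespace TS
open scoped InnerProductSpace
section R
variable {E : Type*} [NormedAddCommGroup E] [InnerProductSpace ℝ E] {Φ : Set E}

lemma QE8_split (c : Fin (8+1) → ℤ) (j : Fin (8+1)) (hj : j = 2 ∨ j = 3) (hc : c j = 0) :
    QF TE8 c = QF TE8 (fun k => if j < k then c k else 0) + QF TE8 (fun k => if k < j then c k else 0) := by
  rw [QE8, QE8, QE8]
  rcases hj with rfl | rfl
  · simp [hc]; ring
  · simp [hc]; ring

lemma E8_split (h : RSys Φ) {u : Fin (8+1) → E} (hA : Aff Φ u ME8 0) (hC : Car u TE8)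
    (j : Fin (8+1)) (hj : j = 2 ∨ j = 3) {a : E} (ha : a ∈ Φ)
    (haj : a ∈ AddSubgroup.closure (u '' {k | k ≠ j})) :
    a ∈ AddSubgroup.closure (u '' {k | j < k}) ∨ a ∈ AddSubgroup.closure (u '' {k | k < j}) := by
  obtain ⟨c, hc, rfl⟩ := closure_coeff haj
  have hcj : c j = 0 := hc j (by simp)
  have hp := h.pos (hA.mem 0)
  have hT : ∀ i, TE8 i i = 0 := by decide
  set c1 : Fin (8+1) → ℤ := fun k => if j < k then c k else 0 with hc1
  set c2 : Fin (8+1) → ℤ := fun k => if k < j then c k else 0 with hc2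
  have hsum : ∑ k, c k • u k = ∑ k, c1 k • u k + ∑ k, c2 k • u k := by
    rw [← Finset.sum_add_distrib]
    refine Finset.sum_congr rfl fun k _ => ?_
    rw [← add_smul]
    congr 1
    simp only [hc1, hc2]
    rcases lt_trichotomy k j with h1 | h1 | h1
    · simp [h1, h1.le, not_lt.2 h1.le]
    · subst h1; simp [hcj]
    · simp [h1, not_lt.2 h1.le]
  have hQ := QE8_split c j hj hcj
  have q0 := inner_sl hC (qE8 h hA hC) hT c
  have q1 := inner_sl hC (qE8 h hA hC) hT c1
  have q2 := inner_sl hC (qE8 h hA hC) hT c2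
  have hl := hA.long _ ha
  have hle : QF TE8 c ≤ 2 := by
    have : (QF TE8 c : ℝ) ≤ 2 := by
      by_contra hcon
      push Not at hcon
      nlinarith
    exact_mod_cast this
  have hge : ∀ d : Fin (8+1) → ℤ, ∑ k, d k • u k ≠ 0 → 2 ≤ QF TE8 d := by
    intro d hd
    have q := inner_sl hC (qE8 h hA hC) hT d
    have hp' : 0 < ⟪∑ k, d k • u k, ∑ k, d k • u k⟫_ℝ := real_inner_self_pos.2 hd
    have : (0 : ℝ) < QF TE8 d := by
      by_contra hcon
      push Not at hcon
      nlinarith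
    have h0 : 0 < QF TE8 d := by exact_mod_cast this
    rw [QE8] at h0 ⊢
    omega
  by_cases h1 : ∑ k, c1 k • u k = 0
  · right
    rw [hsum, h1, zero_add]
    exact mem_closure_of_coeff _ fun k hk => if_neg hk
  · left
    have h2 : ∑ k, c2 k • u k = 0 := by
      by_contra h2
      have := hge _ h1
      have := hge _ h2
      change QF TE8 c = QF TE8 c1 + QF TE8 c2 at hQ
      omega
    rw [hsum, h2, add_zero]
    exact mem_closure_of_coeff _ fun k hk => if_neg hk

lemma li_compl {κ : Type*} [Fintype κ] {u : κ → E} {m : κ → ℕ} {o : κ} (hA : Aff Φ u m o) {J : Finset κ} {j : κ} (hj : j ∈ J) :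
    LinearIndependent ℝ (fun k : {k // k ∉ J} => u k) := by
  classical
  rw [Fintype.linearIndependent_iff]
  intro c hc
  have h1 := hA.li (fun k => if hk : k ∉ J then c ⟨k, hk⟩ else 0) (by
    rw [← hc]
    rw [← Fintype.sum_subtype_add_sum_subtype (fun k => k ∉ J)]
    have e1 : ∑ i : {k // ¬ k ∉ J}, (if hk : (i : κ) ∉ J then c ⟨i, hk⟩ else 0) • u i = 0 :=
      Finset.sum_eq_zero fun i _ => by rw [dif_neg i.2, zero_smul]
    rw [e1, add_zero]
    exact Finset.sum_congr rfl fun i _ => by rw [dif_pos i.2])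
  have h2 := h1 j
  have hmj : (m j : ℝ) ≠ 0 := by have := hA.m1 j; exact_mod_cast (by omega)
  simp only [hj, not_true_eq_false, dite_false] at h2
  rcases mul_eq_zero.1 h2.symm with h3 | h3
  · intro k
    have := h1 k
    rw [h3, zero_mul] at this
    simpa [k.2] using this
  · exact absurd h3 hmj

lemma E8sub [FiniteDimensional ℝ E] (h : RSys Φ) (hsp : Submodule.span ℝ Φ = ⊤) {u : Fin (8+1) → E} (hA : Aff Φ u ME8 0) (hC : Car u TE8)
    (p : ℕ) (b : ℕ) (hpb : p = 2 ∧ b = 5 ∨ p = 3 ∧ b = 6) (B : Finset (Fin (8+1))) (hB : B.card = b)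
    {P : Set E} (hP : P ⊆ Φ) (hPB : ∀ a ∈ P, a ∈ AddSubgroup.closure (u '' B))
    {t : E} (ht : t ∈ AddSubgroup.closure Φ) (hord : ∀ k : ℤ, k • t ∈ AddSubgroup.closure P ↔ (p : ℤ) ∣ k)
    {s : E} (hs : s ∈ AddSubgroup.closure Φ) (hns : ∃ n : ℤ, n ≠ 0 ∧ n • s ∈ AddSubgroup.closure P) :
    ∃ l : ℤ, s - l • t ∈ AddSubgroup.closure P := by
  classical
  obtain ⟨g, x, J, hg, hoJ, ⟨j0, hj0⟩, hdv, hPJ, hspan, hint, hx, hlast⟩ := hA.S1 h hsp hP ht (by omega) hord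
  have hcard : 9 ≤ b + J.card := by
    have hli := li_compl hA hj0
    have hm : Submodule.span ℝ (Set.range (fun k : {k // k ∉ J} => u k)) ≤ Submodule.span ℝ (g '' P) := by
      rw [Submodule.span_le]
      rintro _ ⟨k, rfl⟩; exact hspan k k.2
    have h1 : Module.finrank ℝ (Submodule.span ℝ (Set.range (fun k : {k // k ∉ J} => u k))) = 9 - J.card := by
      rw [finrank_span_eq_card hli]
      rw [Fintype.card_subtype_compl]; simp
    have h2 := Submodule.finrank_mono hm
    have h3 : Submodule.span ℝ (g '' P) = (Submodule.span ℝ P).map (g.toLinearEquiv : E →ₗ[ℝ] E) := by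
      rw [Submodule.map_span]; rfl
    have h4 : Module.finrank ℝ (Submodule.span ℝ P) ≤ B.card := by
      have : Submodule.span ℝ P ≤ Submodule.span ℝ ((B.image u : Finset E) : Set E) := by
        rw [Submodule.span_le]
        intro a ha
        have := closure_le_span _ (hPB a ha)
        simpa using this
      refine (Submodule.finrank_mono this).trans ((finrank_span_finset_le_card _).trans Finset.card_image_le)
    have h5 : Module.finrank ℝ ((Submodule.span ℝ P).map (g.toLinearEquiv : E →ₗ[ℝ] E)) = Module.finrank ℝ (Submodule.span ℝ P) :=
      LinearEquiv.finrank_map_eq g.toLinearEquiv _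
    rw [h3, h5] at h2
    omega
  have hJJ : (5 ∈ J ∨ 6 ∈ J) ∧ ∃ j ∈ J, ME8 j = p := by
    rcases hpb with ⟨rfl, rfl⟩ | ⟨rfl, rfl⟩
    · have hsub : J ⊆ {1, 3, 5, 6, 7} := by
        intro j hj
        have := hdv j hj
        clear hj; revert this; revert j; decide
      constructor
      · by_contra hcon
        push Not at hcon
        have h1 : J ⊆ {1, 3, 7} := by
          intro j hj
          have h2 := hsub hj
          simp only [Finset.mem_insert, Finset.mem_singleton] at h2 ⊢
          rcases h2 with rfl | rfl | rfl | rfl | rfl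
          · simp
          · simp
          · exact absurd hj hcon.1
          · exact absurd hj hcon.2
          · simp
        have h2 := Finset.card_le_card h1
        have h3 : ({1, 3, 7} : Finset (Fin (8+1))).card = 3 := by decide
        omega
      · by_contra hcon
        push Not at hcon
        have h1 : J ⊆ {3, 5, 6} := by
          intro j hj
          have h2 := hsub hj
          simp only [Finset.mem_insert, Finset.mem_singleton] at h2 ⊢
          rcases h2 with rfl | rfl | rfl | rfl | rfl
          · exact absurd rfl (hcon _ hj)
          · simp
          · simp
          · simp
          · exact absurd rfl (hcon _ hj)
        have h2 := Finset.card_le_card h1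
        have h3 : ({3, 5, 6} : Finset (Fin (8+1))).card = 3 := by decide
        omega
    · have hsub : J ⊆ {2, 5, 8} := by
        intro j hj
        have := hdv j hj
        clear hj; revert this; revert j; decide
      have : J = {2, 5, 8} := Finset.eq_of_subset_of_card_le hsub (by simp; omega)
      subst this
      decide
  obtain ⟨hJ56, j1, hj1, hm1⟩ := hJJ
  have hPint : ∀ a ∈ P, IsInt (chi g x a) := by
    intro a ha
    refine isInt_closure ?_ (hPJ a ha)
    rintro _ ⟨k, hk, rfl⟩; exact hlast k hk
  have hz : ∀ (k : ℤ) (s : E), chi g x (k • s) = k * chi g x s := by intro k s; rw [map_zsmul]; simp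
  have hpt := isInt_hom _ hPint ((hord p).2 dvd_rfl)
  rw [hz] at hpt
  have hps := (hint s hs (span_of_tor hns)).2 j1 hj1
  rw [hm1] at hps
  obtain ⟨l, hl⟩ := cyc1 (by omega : 0 < p) (a := chi g x t) (b := chi g x s) hx (by simpa using hpt) hps
  refine ⟨l, ?_⟩
  have hn' : ∃ n : ℤ, n ≠ 0 ∧ n • (s - l • t) ∈ AddSubgroup.closure P := by
    obtain ⟨n, hn, hns⟩ := hns
    refine ⟨p * n, mul_ne_zero (by omega) hn, ?_⟩
    rw [smul_sub]
    refine sub_mem ?_ ?_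
    · rw [mul_smul]; exact zsmul_mem hns _
    · rw [smul_smul]; exact (hord _).2 (Dvd.intro _ (mul_assoc _ _ _).symm)
  have hmem := (hint (s - l • t) (sub_mem hs (zsmul_mem ht l)) (span_of_tor hn')).1 (by
    have : IsInt (chi g x (s - l • t)) := by rw [map_sub, hz]; exact hl
    exact this)
  rcases hJ56 with h5 | h6
  · exact ker_mem hP g hg J 5 h5 hPJ (noE8_5 h hA hC) hmem hn'
  · exact ker_mem hP g hg J 6 h6 hPJ (noE8_6 h hA hC) hmem hn'

end R
end TS

namespace TS
open scoped InnerProductSpace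
section S
variable {E : Type*} [NormedAddCommGroup E] [InnerProductSpace ℝ E] {Φ : Set E}

lemma ord_prime {A : Type*} [AddCommGroup A] (B : AddSubgroup A) {t : A} {p : ℕ} (hp : p.Prime)
    (h1 : (p : ℤ) • t ∈ B) (h2 : t ∉ B) (k : ℤ) : k • t ∈ B ↔ (p : ℤ) ∣ k := by
  constructor
  · intro hk
    by_contra hd
    have hc : IsCoprime (p : ℤ) k := (Nat.prime_iff_prime_int.1 hp).coprime_iff_not_dvd.2 hd
    obtain ⟨a, b, hab⟩ := hc
    apply h2
    have : t = a • ((p : ℤ) • t) + b • (k • t) := by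
      rw [smul_smul, smul_smul, ← add_smul, hab, one_smul]
    rw [this]
    exact add_mem (zsmul_mem h1 _) (zsmul_mem hk _)
  · rintro ⟨q, rfl⟩
    rw [mul_comm, mul_smul]; exact zsmul_mem h1 _

lemma E8ker [FiniteDimensional ℝ E] (h : RSys Φ) (hsp : Submodule.span ℝ Φ = ⊤) {u : Fin (8+1) → E}
    (hA : Aff Φ u ME8 0) (hC : Car u TE8) (j : Fin (8+1)) (p e : ℕ)
    (hjp : p = 2 ∧ j = 3 ∧ e = 4 ∨ p = 3 ∧ j = 2 ∧ e = 3) {P : Set E} (hP : P ⊆ Φ)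
    (hPj : ∀ a ∈ P, a ∈ AddSubgroup.closure (u '' {k | k ≠ j}))
    (hexp : ∀ s ∈ AddSubgroup.closure (u '' {k | k ≠ j}), (∃ n : ℤ, n ≠ 0 ∧ n • s ∈ AddSubgroup.closure P) →
      (e : ℤ) • s ∈ AddSubgroup.closure P) :
    ∃ w ∈ AddSubgroup.closure (u '' {k | k ≠ j}), ∃ p' : ℕ, (p' = 1 ∨ p' = p) ∧
      (∀ l : ℤ, l • w ∈ AddSubgroup.closure P ↔ (p' : ℤ) ∣ l) ∧
      ∀ s ∈ AddSubgroup.closure (u '' {k | k ≠ j}), (∃ n : ℤ, n ≠ 0 ∧ n • s ∈ AddSubgroup.closure P) →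
        ∃ l : ℤ, s - l • w ∈ AddSubgroup.closure P := by
  have hj : j = 2 ∨ j = 3 := by tauto
  have hpp : p.Prime := by rcases hjp with ⟨rfl, -⟩ | ⟨rfl, -⟩ <;> norm_num
  set L1 := AddSubgroup.closure (u '' {k | j < k}) with hL1
  set L2 := AddSubgroup.closure (u '' {k | k < j}) with hL2
  set P1 : Set E := {a | a ∈ P ∧ a ∈ L1} with hP1
  set P2 : Set E := {a | a ∈ P ∧ a ∈ L2} with hP2
  have hL1j : L1 ≤ AddSubgroup.closure (u '' {k | k ≠ j}) :=
    AddSubgroup.closure_mono (Set.image_mono fun k hk => ne_of_gt hk)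
  have hLΦ : AddSubgroup.closure (u '' {k | k ≠ j}) ≤ AddSubgroup.closure Φ :=
    AddSubgroup.closure_mono (by rintro _ ⟨k, _, rfl⟩; exact hA.mem k)
  have hc1 : AddSubgroup.closure P1 ≤ AddSubgroup.closure P := AddSubgroup.closure_mono fun a ha => ha.1
  have hc2 : AddSubgroup.closure P2 ≤ AddSubgroup.closure P := AddSubgroup.closure_mono fun a ha => ha.1
  have hd1 : AddSubgroup.closure P1 ≤ L1 := by rw [AddSubgroup.closure_le]; exact fun a ha => ha.2
  have hd2 : AddSubgroup.closure P2 ≤ L2 := by rw [AddSubgroup.closure_le]; exact fun a ha => ha.2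
  have hsup : AddSubgroup.closure P ≤ AddSubgroup.closure P1 ⊔ AddSubgroup.closure P2 := by
    rw [AddSubgroup.closure_le]
    intro a ha
    rcases E8_split h hA hC j hj (hP ha) (hPj a ha) with h1 | h1
    · exact AddSubgroup.mem_sup_left (AddSubgroup.subset_closure ⟨ha, h1⟩)
    · exact AddSubgroup.mem_sup_right (AddSubgroup.subset_closure ⟨ha, h1⟩)
  have hdec : AddSubgroup.closure (u '' {k | k ≠ j}) ≤ L1 ⊔ L2 := by
    rw [AddSubgroup.closure_le]
    rintro _ ⟨k, hk, rfl⟩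
    rcases lt_or_gt_of_ne hk with h1 | h1
    · exact AddSubgroup.mem_sup_right (AddSubgroup.subset_closure ⟨k, h1, rfl⟩)
    · exact AddSubgroup.mem_sup_left (AddSubgroup.subset_closure ⟨k, h1, rfl⟩)
  have hdis : ∀ v, v ∈ L1 → v ∈ L2 → v = 0 := by
    intro v h1 h2
    obtain ⟨r1, hr1, e1⟩ := closure_coeff h1
    obtain ⟨r2, hr2, e2⟩ := closure_coeff h2
    have := hA.uniqj (j := j) (hr1 j (by simp)) (hr2 j (by simp)) (e1.symm.trans e2)
    rw [e1]
    refine Finset.sum_eq_zero fun k _ => ?_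
    by_cases hk : j < k
    · rw [this, hr2 k (by simp [hk.le]), zero_smul]
    · rw [hr1 k hk, zero_smul]
  have hind : ∀ s1 ∈ L1, ∀ s2 ∈ L2, s1 + s2 ∈ AddSubgroup.closure P →
      s1 ∈ AddSubgroup.closure P1 ∧ s2 ∈ AddSubgroup.closure P2 := by
    intro s1 h1 s2 h2 h3
    obtain ⟨y1, hy1, y2, hy2, hy⟩ := AddSubgroup.mem_sup.1 (hsup h3)
    have e0 : s1 - y1 = y2 - s2 := by rw [sub_eq_sub_iff_add_eq_add, ← hy]; abel
    have e1 := hdis (s1 - y1) (sub_mem h1 (hd1 hy1)) (by rw [e0]; exact sub_mem (hd2 hy2) h2)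
    have e2 : s1 = y1 := sub_eq_zero.1 e1
    rw [e1] at e0
    have e3 : y2 = s2 := sub_eq_zero.1 e0.symm
    exact ⟨e2 ▸ hy1, e3 ▸ hy2⟩
  have hind1 : ∀ s1 ∈ L1, s1 ∈ AddSubgroup.closure P → s1 ∈ AddSubgroup.closure P1 := fun s1 h1 h2 =>
    (hind s1 h1 0 (zero_mem _) (by simpa using h2)).1
  have hno2 : ∀ s2 ∈ L2, (∃ n : ℤ, n ≠ 0 ∧ n • s2 ∈ AddSubgroup.closure P2) → s2 ∈ AddSubgroup.closure P2 := by
    rintro s2 h2 ⟨n, hn, hns⟩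
    have hm : L2 ≤ AddSubgroup.closure (u '' {k | k ≠ 4}) :=
      AddSubgroup.closure_mono (Set.image_mono fun k hk => by
        rintro rfl
        rcases hj with rfl | rfl <;> exact absurd hk (by decide))
    exact noE8_4 h hA hC P2 (fun a ha => hP ha.1) (fun a ha => hm ha.2) s2 (hm h2) n hn hns
  have hred : ∀ s ∈ AddSubgroup.closure (u '' {k | k ≠ j}), (∃ n : ℤ, n ≠ 0 ∧ n • s ∈ AddSubgroup.closure P) →
      ∃ s1 ∈ L1, (∃ n : ℤ, n ≠ 0 ∧ n • s1 ∈ AddSubgroup.closure P1) ∧ s - s1 ∈ AddSubgroup.closure P := by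
    rintro s hs ⟨n, hn, hns⟩
    obtain ⟨s1, hs1, s2, hs2, rfl⟩ := AddSubgroup.mem_sup.1 (hdec hs)
    rw [smul_add] at hns
    obtain ⟨h1, h2⟩ := hind _ (zsmul_mem hs1 n) _ (zsmul_mem hs2 n) hns
    refine ⟨s1, hs1, ⟨n, hn, h1⟩, ?_⟩
    rw [add_sub_cancel_left]
    exact hc2 (hno2 s2 hs2 ⟨n, hn, h2⟩)
  by_cases hall : ∀ s1 ∈ L1, (∃ n : ℤ, n ≠ 0 ∧ n • s1 ∈ AddSubgroup.closure P1) → s1 ∈ AddSubgroup.closure P1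
  · refine ⟨0, zero_mem _, 1, Or.inl rfl, fun l => by simp, fun s hs hns => ⟨0, ?_⟩⟩
    obtain ⟨s1, h1, h2, h3⟩ := hred s hs hns
    have := add_mem h3 (hc1 (hall s1 h1 h2))
    simpa using this
  · push Not at hall
    obtain ⟨s0, hs0, ⟨n, hn, hns⟩, hs0n⟩ := hall
    have hes := hind1 _ (zsmul_mem hs0 _) (hexp s0 (hL1j hs0) ⟨n, hn, hc1 hns⟩)
    obtain ⟨t, ht, htp, htn⟩ : ∃ t ∈ L1, (p : ℤ) • t ∈ AddSubgroup.closure P1 ∧ t ∉ AddSubgroup.closure P1 := by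
      rcases hjp with ⟨rfl, -, rfl⟩ | ⟨rfl, -, rfl⟩
      · by_cases h2 : (2 : ℤ) • s0 ∈ AddSubgroup.closure P1
        · exact ⟨s0, hs0, h2, hs0n⟩
        · refine ⟨(2 : ℤ) • s0, zsmul_mem hs0 _, ?_, h2⟩
          rw [smul_smul]; exact hes
      · exact ⟨s0, hs0, hes, hs0n⟩
    have hord := ord_prime _ hpp htp htn
    refine ⟨t, hL1j ht, p, Or.inr rfl, fun l => ?_, fun s hs hns => ?_⟩
    · rw [← hord]
      exact ⟨fun h1 => hind1 _ (zsmul_mem ht l) h1, fun h1 => hc1 h1⟩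
    · obtain ⟨s1, h1, h2, h3⟩ := hred s hs hns
      obtain ⟨l, hl⟩ := E8sub h hsp hA hC p (if j = 3 then 5 else 6)
        (by rcases hjp with ⟨rfl, rfl, rfl⟩ | ⟨rfl, rfl, rfl⟩ <;> simp)
        (Finset.univ.filter fun k => j < k)
        (by rcases hjp with ⟨rfl, rfl, rfl⟩ | ⟨rfl, rfl, rfl⟩ <;> decide)
        (P := P1) (fun a ha => hP ha.1) (fun a ha => by simpa using ha.2) (hLΦ (hL1j ht)) hord
        (hLΦ (hL1j h1)) h2
      refine ⟨l, ?_⟩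
      have := add_mem h3 (hc1 hl)
      simpa using this

theorem root_main [FiniteDimensional ℝ E] (h : RSys Φ) (hsp : Submodule.span ℝ Φ = ⊤) (hI : Irr Φ) {P : Set E} (hP : P ⊆ Φ)
    {t : E} (ht : t ∈ AddSubgroup.closure Φ) {e : ℕ} (he : 3 ≤ e)
    (hord : ∀ k : ℤ, k • t ∈ AddSubgroup.closure P ↔ (e : ℤ) ∣ k)
    (hexp : ∀ s ∈ AddSubgroup.closure Φ, (∃ n : ℤ, n ≠ 0 ∧ n • s ∈ AddSubgroup.closure P) →
      (e : ℤ) • s ∈ AddSubgroup.closure P) : Concl Φ P t e := by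
  have hint' : ∀ {κ : Type} {u : κ → E} {J : Finset κ} {g : E ≃ₗᵢ[ℝ] E} {x : E},
      (∀ k, k ∉ J → IsInt ⟪u k, x⟫_ℝ) → ∀ a, g a ∈ AddSubgroup.closure (u '' {k | k ∉ J}) → IsInt (chi g x a) := by
    intro κ u J g x hlast a ha
    refine isInt_closure ?_ ha
    rintro _ ⟨k, hk, rfl⟩; exact hlast k hk
  have fin1 : ∀ {d : ℕ} {u : Fin (d+1) → E} {M : Fin (d+1) → ℕ} (hA : Aff Φ u M 0)
      (hN : ∀ j, e ∣ M j → (e = 3 ∨ e = 4 ∨ e = 5 ∨ e = 6) ∧ NoTor Φ u j), Concl Φ P t e := by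
    intro d u M hA hN
    obtain ⟨g, x, J, hg, hoJ, ⟨j0, hj0⟩, hdv, hPJ, hspan, hint, hx, hlast⟩ := hA.S1 h hsp hP ht (by omega) hord
    obtain ⟨he', hNj⟩ := hN j0 (hdv j0 hj0)
    refine concl_of he hord hP ht hexp (chi g x) hx (fun a ha => hint' hlast a (hPJ a ha)) 0 (zero_mem _)
      (by rw [map_zero]; exact IsInt.zero) 1 (by simp) ?_ (Or.inl ⟨rfl, he'⟩)
    intro s hs hns hsi
    refine ⟨0, ?_⟩
    rw [zero_smul, sub_zero]
    exact ker_mem hP g hg J j0 hj0 hPJ hNj ((hint s hs (span_of_tor hns)).1 hsi) hns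
  obtain ⟨κ, _, u, hB⟩ := exists_base h
  obtain ⟨u', m, hA⟩ := hB.exists_aff h hI
  by_cases h3 : ∃ k, 3 ≤ m k
  swap
  · obtain ⟨g, x, J, hg, hoJ, ⟨j0, hj0⟩, hdv, -⟩ := hA.S1 h hsp hP ht (by omega) hord
    have := Nat.le_of_dvd (hA.m1 j0) (hdv j0 hj0)
    exact absurd ⟨j0, le_trans he this⟩ h3
  rcases hA.classify h h3 with ⟨v, hv, hC⟩ | ⟨v, hv, hC⟩ | ⟨v, hv, hC⟩ | ⟨v, hv, hC⟩ | ⟨v, hv, hC⟩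
  · refine fin1 hv fun j hj => ?_
    have : j = 2 ∧ (e = 3 ∨ e = 4 ∨ e = 5 ∨ e = 6) := by
      have hle := Nat.le_of_dvd (hv.m1 j) hj
      clear hA h3 m fin1
      fin_cases j <;> simp [MG2] at hj hle ⊢ <;> interval_cases e <;> omega
    obtain ⟨rfl, he'⟩ := this
    exact ⟨he', noG2_2 h hv hC⟩
  · refine fin1 hv fun j hj => ?_
    have : (j = 2 ∨ j = 3) ∧ (e = 3 ∨ e = 4 ∨ e = 5 ∨ e = 6) := by
      have hle := Nat.le_of_dvd (hv.m1 j) hj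
      clear hA h3 m fin1
      fin_cases j <;> simp [MF4] at hj hle ⊢ <;> interval_cases e <;> omega
    obtain ⟨rfl | rfl, he'⟩ := this
    · exact ⟨he', noF4_2 h hv hC⟩
    · exact ⟨he', noF4_3 h hv hC⟩
  · refine fin1 hv fun j hj => ?_
    have : j = 2 ∧ (e = 3 ∨ e = 4 ∨ e = 5 ∨ e = 6) := by
      have hle := Nat.le_of_dvd (hv.m1 j) hj
      clear hA h3 m fin1
      fin_cases j <;> simp [ME6] at hj hle ⊢ <;> interval_cases e <;> omega
    obtain ⟨rfl, he'⟩ := this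
    exact ⟨he', noE6_2 h hv hC⟩
  · refine fin1 hv fun j hj => ?_
    have : (j = 2 ∨ j = 3 ∨ j = 4) ∧ (e = 3 ∨ e = 4 ∨ e = 5 ∨ e = 6) := by
      have hle := Nat.le_of_dvd (hv.m1 j) hj
      clear hA h3 m fin1
      fin_cases j <;> simp [ME7] at hj hle ⊢ <;> interval_cases e <;> omega
    obtain ⟨rfl | rfl | rfl, he'⟩ := this
    · exact ⟨he', noE7_2 h hv hC⟩
    · exact ⟨he', noE7_3 h hv hC⟩
    · exact ⟨he', noE7_4 h hv hC⟩
  · obtain ⟨g, x, J, hg, hoJ, ⟨j0, hj0⟩, hdv, hPJ, hspan, hint, hx, hlast⟩ := hv.S1 h hsp hP ht (by omega) hord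
    have hcl : ∀ j, e ∣ ME8 j → (e = 3 ∧ j = 2 ∨ e = 4 ∧ j = 3) ∨
        ((e = 3 ∨ e = 4 ∨ e = 5 ∨ e = 6) ∧ (j = 4 ∨ j = 5 ∨ j = 6 ∨ j = 8)) := by
      intro j hj
      have hle := Nat.le_of_dvd (hv.m1 j) hj
      clear * - hj hle he
      fin_cases j <;> simp [ME8] at hj hle ⊢ <;> interval_cases e <;> omega
    by_cases hex : ∃ j ∈ J, j = 4 ∨ j = 5 ∨ j = 6 ∨ j = 8
    · obtain ⟨j, hj, hj'⟩ := hex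
      have he' : e = 3 ∨ e = 4 ∨ e = 5 ∨ e = 6 := by
        rcases hcl j (hdv j hj) with h1 | h1
        · tauto
        · exact h1.1
      have hNj : NoTor Φ v j := by
        rcases hj' with rfl | rfl | rfl | rfl
        · exact noE8_4 h hv hC
        · exact noE8_5 h hv hC
        · exact noE8_6 h hv hC
        · exact noE8_8 h hv hC
      refine concl_of he hord hP ht hexp (chi g x) hx (fun a ha => hint' hlast a (hPJ a ha)) 0 (zero_mem _)
        (by rw [map_zero]; exact IsInt.zero) 1 (by simp) ?_ (Or.inl ⟨rfl, he'⟩)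
      intro s hs hns hsi
      refine ⟨0, ?_⟩
      rw [zero_smul, sub_zero]
      exact ker_mem hP g hg J j hj hPJ hNj ((hint s hs (span_of_tor hns)).1 hsi) hns
    · have hall : ∀ j ∈ J, e = 3 ∧ j = 2 ∨ e = 4 ∧ j = 3 := by
        intro j hj
        rcases hcl j (hdv j hj) with h1 | h1
        · exact h1
        · exact absurd ⟨j, hj, h1.2⟩ hex
      have hJ : J = {j0} := by
        ext k
        rw [Finset.mem_singleton]
        constructor
        · intro hk
          rcases hall k hk with ⟨h1, h2⟩ | ⟨h1, h2⟩ <;> rcases hall j0 hj0 with ⟨h3, h4⟩ | ⟨h3, h4⟩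
          · rw [h2, h4]
          · omega
          · omega
          · rw [h2, h4]
        · rintro rfl; exact hj0
      have hset : {k | k ∉ J} = {k | k ≠ j0} := by ext k; simp [hJ]
      obtain ⟨p, hjp⟩ : ∃ p, p = 2 ∧ j0 = 3 ∧ e = 4 ∨ p = 3 ∧ j0 = 2 ∧ e = 3 := by
        rcases hall j0 hj0 with ⟨h1, h2⟩ | ⟨h1, h2⟩
        · exact ⟨3, Or.inr ⟨rfl, h2, h1⟩⟩
        · exact ⟨2, Or.inl ⟨rfl, h2, h1⟩⟩
      have hLΦ : AddSubgroup.closure (v '' {k | k ≠ j0}) ≤ AddSubgroup.closure Φ :=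
        AddSubgroup.closure_mono (by rintro _ ⟨k, _, rfl⟩; exact hv.mem k)
      have hiff : ∀ (n : ℤ) (s : E), n • s ∈ AddSubgroup.closure (g '' P) ↔ n • g.symm s ∈ AddSubgroup.closure P := by
        intro n s
        rw [← map_cl g P, map_zsmul]; simp
      obtain ⟨w, hw, p', hp', hwl, hker⟩ := E8ker h hsp hv hC j0 p e hjp (P := g '' P)
        (by rintro _ ⟨a, ha, rfl⟩; exact (hg a).2 (hP ha))
        (by rintro _ ⟨a, ha, rfl⟩; rw [← hset]; exact hPJ a ha)
        (by
          rintro s hs ⟨n, hn, hns⟩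
          rw [hiff] at hns ⊢
          exact hexp _ ((map_phi g hg _).1 (by simpa using hLΦ hs)) ⟨n, hn, hns⟩)
      refine concl_of he hord hP ht hexp (chi g x) hx (fun a ha => hint' hlast a (hPJ a ha)) (g.symm w)
        ((map_phi g hg _).1 (by simpa using hLΦ hw)) (hint' hlast _ (by rw [hset]; simpa using hw)) p'
        (fun l => by rw [← hwl l, hiff]) ?_ ?_
      · rintro s hs ⟨n, hn, hns⟩ hsi
        have h1 := (hint s hs (span_of_tor ⟨n, hn, hns⟩)).1 hsi
        rw [hset] at h1
        obtain ⟨l, hl⟩ := hker (g s) h1 ⟨n, hn, by rw [hiff]; simpa using hns⟩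
        refine ⟨l, ?_⟩
        rw [← map_cl g P, map_sub, map_zsmul]
        simpa using hl
      · rcases hjp with ⟨rfl, -, rfl⟩ | ⟨rfl, -, rfl⟩ <;> rcases hp' with rfl | rfl <;> simp

end S
end TS

namespace TS
section U

def TorConcl (T : Type*) [AddCommGroup T] : Prop :=
  (∃ ι : Type, Nonempty (T ≃+ DirectSum ι (fun _ => ZMod 2))) ∨
    Nonempty (T ≃+ ZMod 3) ∨ Nonempty (T ≃+ ZMod 4) ∨ Nonempty (T ≃+ ZMod 5) ∨
    Nonempty (T ≃+ (ZMod 2 × ZMod 3)) ∨ Nonempty (T ≃+ (ZMod 2 × ZMod 4)) ∨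
    Nonempty (T ≃+ (ZMod 3 × ZMod 3))

lemma equivOf {T : Type*} [AddCommGroup T] (t w : T) (e p : ℕ) (h1 : ∀ s, ∃ k l : ℤ, s = k • t + l • w)
    (h2 : ∀ k l : ℤ, k • t + l • w = 0 ↔ (e : ℤ) ∣ k ∧ (p : ℤ) ∣ l) : Nonempty (T ≃+ ZMod e × ZMod p) := by
  have ht : zmultiplesHom T t e = 0 := by
    have := (h2 e 0).2 ⟨dvd_rfl, dvd_zero _⟩
    simpa using this
  have hw : zmultiplesHom T w p = 0 := by
    have := (h2 0 p).2 ⟨dvd_zero _, dvd_rfl⟩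
    simpa using this
  let f : ZMod e × ZMod p →+ T := (ZMod.lift e ⟨zmultiplesHom T t, ht⟩).coprod (ZMod.lift p ⟨zmultiplesHom T w, hw⟩)
  have hf : ∀ k l : ℤ, f ((k : ZMod e), (l : ZMod p)) = k • t + l • w := by
    intro k l
    simp [f]
  refine ⟨(AddEquiv.ofBijective f ⟨?_, ?_⟩).symm⟩
  · rw [injective_iff_map_eq_zero]
    rintro ⟨a, b⟩ hab
    obtain ⟨k, rfl⟩ := ZMod.intCast_surjective a
    obtain ⟨l, rfl⟩ := ZMod.intCast_surjective b
    rw [hf, h2] at hab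
    rw [Prod.mk_eq_zero, ZMod.intCast_zmod_eq_zero_iff_dvd, ZMod.intCast_zmod_eq_zero_iff_dvd]
    exact hab
  · intro s
    obtain ⟨k, l, rfl⟩ := h1 s
    exact ⟨_, hf k l⟩

lemma tc2 {T : Type*} [AddCommGroup T] [Finite T] (h : ∀ x : T, 2 • x = 0) : TorConcl T := by
  left
  letI : Module (ZMod 2) T := AddCommGroup.zmodModule h
  haveI : Module.Finite (ZMod 2) T := Module.Finite.of_finite
  haveI : Fact (Nat.Prime 2) := ⟨Nat.prime_two⟩
  let b := Module.finBasis (ZMod 2) T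
  exact ⟨Fin (Module.finrank (ZMod 2) T), ⟨(b.repr.trans (finsuppLEquivDirectSum (ZMod 2) (ZMod 2) _)).toAddEquiv⟩⟩

lemma tcg {T : Type*} [AddCommGroup T] {e p : ℕ} (h : Nonempty (T ≃+ ZMod e × ZMod p))
    (hc : p = 1 ∧ (e = 3 ∨ e = 4 ∨ e = 5 ∨ e = 6) ∨ p = 2 ∧ e = 4 ∨ p = 3 ∧ e = 3) : TorConcl T := by
  obtain ⟨f⟩ := h
  right
  rcases hc with ⟨rfl, hc⟩ | ⟨rfl, rfl⟩ | ⟨rfl, rfl⟩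
  · haveI : Unique (ZMod 1) := inferInstanceAs (Unique (Fin 1))
    have f' := f.trans (AddEquiv.prodUnique (M := ZMod e) (N := ZMod 1))
    rcases hc with rfl | rfl | rfl | rfl
    · exact Or.inl ⟨f'⟩
    · exact Or.inr (Or.inl ⟨f'⟩)
    · exact Or.inr (Or.inr (Or.inl ⟨f'⟩))
    · exact Or.inr (Or.inr (Or.inr (Or.inl ⟨f'.trans (ZMod.chineseRemainder (by norm_num : Nat.Coprime 2 3)).toAddEquiv⟩)))
  · exact Or.inr (Or.inr (Or.inr (Or.inr (Or.inl ⟨f.trans AddEquiv.prodComm⟩))))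
  · exact Or.inr (Or.inr (Or.inr (Or.inr (Or.inr ⟨f⟩))))

def ConclA {M : Type*} [AddCommGroup M] (A B : AddSubgroup M) (t : M) (e : ℕ) : Prop :=
  ∃ w ∈ A, ∃ p : ℕ, p • w ∈ B ∧
    (∀ s ∈ A, (∃ n : ℤ, n ≠ 0 ∧ n • s ∈ B) → ∃ k l : ℤ, s - k • t - l • w ∈ B) ∧
    (∀ k l : ℤ, k • t + l • w ∈ B → (e : ℤ) ∣ k ∧ (p : ℤ) ∣ l) ∧
    (p = 1 ∧ (e = 3 ∨ e = 4 ∨ e = 5 ∨ e = 6) ∨ p = 2 ∧ e = 4 ∨ p = 3 ∧ e = 3)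

lemma group_final {M : Type*} [AddCommGroup M] (A B : AddSubgroup M) (hfg : A.FG)
    (H : ∀ t ∈ A, ∀ e : ℕ, 3 ≤ e → (∀ k : ℤ, k • t ∈ B ↔ (e : ℤ) ∣ k) →
      (∀ s ∈ A, (∃ n : ℤ, n ≠ 0 ∧ n • s ∈ B) → (e : ℤ) • s ∈ B) → ConclA A B t e) :
    TorConcl (AddCommGroup.torsion (A ⧸ B.addSubgroupOf A)) := by
  set G := A ⧸ B.addSubgroupOf A with hG
  have hmk : ∀ a : A, ((a : A ⧸ B.addSubgroupOf A) = 0 ↔ (a : M) ∈ B) := by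
    intro a; rw [QuotientAddGroup.eq_zero_iff, AddSubgroup.mem_addSubgroupOf]
  have htor : ∀ g : G, g ∈ AddCommGroup.torsion G ↔ ∃ n : ℤ, n ≠ 0 ∧ n • g = 0 := by
    intro g
    change IsOfFinAddOrder g ↔ _
    rw [isOfFinAddOrder_iff_zsmul_eq_zero]
  haveI : AddGroup.FG A := (AddGroup.fg_iff_addSubgroup_fg A).2 hfg
  haveI : AddGroup.FG G := QuotientAddGroup.fg _
  haveI : Module.Finite ℤ G := Module.Finite.iff_addGroup_fg.2 inferInstance
  haveI : Finite (AddCommGroup.torsion G) := by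
    haveI : Module.Finite ℤ (AddSubgroup.toIntSubmodule (AddCommGroup.torsion G)) := inferInstance
    haveI : Module.Finite ℤ (AddCommGroup.torsion G) := this
    haveI : AddGroup.FG (AddCommGroup.torsion G) := Module.Finite.iff_addGroup_fg.1 inferInstance
    exact AddCommGroup.finite_of_fg_torsion _ (fun x => AddSubmonoid.isOfFinAddOrder_coe.1 x.2)
  set T := AddCommGroup.torsion G with hT
  obtain ⟨τ, hτ⟩ := AddMonoid.exists_addOrderOf_eq_exponent (G := T) AddMonoid.ExponentExists.of_finite
  set e := AddMonoid.exponent T with he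
  have hexp : ∀ x : T, (e : ℤ) • x = 0 := by
    intro x
    have := AddMonoid.exponent_nsmul_eq_zero (G := T) x
    simpa using this
  have he0 : e ≠ 0 := AddMonoid.exponent_ne_zero_of_finite
  by_cases he3 : 3 ≤ e
  swap
  · apply tc2
    intro x
    have h1 := hexp x
    have : e = 1 ∨ e = 2 := by omega
    rcases this with h2 | h2
    · rw [h2] at h1
      simp only [Nat.cast_one, one_smul] at h1
      rw [h1, smul_zero]
    · rw [h2] at h1; exact_mod_cast h1
  obtain ⟨a, ha⟩ := QuotientAddGroup.mk_surjective (τ : G)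
  have hlift : ∀ s ∈ A, (∃ n : ℤ, n ≠ 0 ∧ n • s ∈ B) → ∃ x : T, ∃ b : A, (b : M) = s ∧ (x : G) = (b : A ⧸ B.addSubgroupOf A) := by
    rintro s hs ⟨n, hn, hns⟩
    refine ⟨⟨((⟨s, hs⟩ : A) : A ⧸ B.addSubgroupOf A), (htor _).2 ⟨n, hn, ?_⟩⟩, ⟨s, hs⟩, rfl, rfl⟩
    exact (hmk (n • ⟨s, hs⟩)).2 hns
  have hτk : ∀ k : ℤ, k • (a : M) ∈ B ↔ (e : ℤ) ∣ k := by
    intro k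
    rw [← hτ, addOrderOf_dvd_iff_zsmul_eq_zero, ← Subtype.coe_inj]
    rw [AddSubgroup.coe_zsmul, ← ha]
    exact (hmk (k • a)).symm
  obtain ⟨w, hw, p, hpw, h1, h2, h3⟩ := H a a.2 e he3 hτk (by
    intro s hs hns
    obtain ⟨x, b, rfl, hx⟩ := hlift s hs hns
    have h1 := congrArg Subtype.val (hexp x)
    rw [AddSubgroup.coe_zsmul, hx] at h1
    exact (hmk ((e : ℤ) • b)).1 h1)
  have hp0 : p ≠ 0 := by omega
  obtain ⟨ω, b, hb, hω⟩ := hlift w hw ⟨p, by exact_mod_cast hp0, by simpa using hpw⟩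
  subst hb
  refine tcg (equivOf τ ω e p ?_ ?_) h3
  · rintro ⟨s, hs⟩
    obtain ⟨c, rfl⟩ := QuotientAddGroup.mk_surjective s
    obtain ⟨n, hn, hns⟩ := (htor _).1 hs
    obtain ⟨k, l, hkl⟩ := h1 c c.2 ⟨n, hn, (hmk (n • c)).1 hns⟩
    refine ⟨k, l, ?_⟩
    rw [← Subtype.coe_inj, AddSubgroup.coe_add, AddSubgroup.coe_zsmul, AddSubgroup.coe_zsmul, hω, ← ha]
    have := (hmk (c - k • a - l • b)).2 hkl
    rw [QuotientAddGroup.mk_sub, QuotientAddGroup.mk_sub, QuotientAddGroup.mk_zsmul, QuotientAddGroup.mk_zsmul] at this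
    rw [sub_sub, sub_eq_zero] at this
    exact this
  · intro k l
    rw [← Subtype.coe_inj, AddSubgroup.coe_add, AddSubgroup.coe_zsmul, AddSubgroup.coe_zsmul, hω, ← ha]
    have hh := hmk (k • a + l • b)
    rw [QuotientAddGroup.mk_add, QuotientAddGroup.mk_zsmul, QuotientAddGroup.mk_zsmul] at hh
    refine hh.trans ⟨h2 k l, ?_⟩
    rintro ⟨hk, q, rfl⟩
    have h4 := (hτk k).2 hk
    refine add_mem h4 ?_
    have : ((p : ℤ) * q) • (b : M) = q • (p • (b : M)) := by rw [mul_comm, mul_smul]; simp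
    change ((p : ℤ) * q) • (b : M) ∈ B
    rw [this]; exact zsmul_mem hpw q

end U
end TS

namespace TS
open scoped InnerProductSpace
section V
variable {F : Type*} [NormedAddCommGroup F] [InnerProductSpace ℝ F]

lemma mem_closure_val (W : Submodule ℝ F) (X : Set F) (hX : X ⊆ W) (x : W) :
    x ∈ AddSubgroup.closure (Subtype.val ⁻¹' X : Set W) ↔ (x : F) ∈ AddSubgroup.closure X := by
  have h1 : (AddSubgroup.closure (Subtype.val ⁻¹' X : Set W)).map W.subtype.toAddMonoidHom =
      AddSubgroup.closure X := by
    rw [AddMonoidHom.map_closure]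
    congr 1
    ext y
    constructor
    · rintro ⟨z, hz, rfl⟩; exact hz
    · intro hy; exact ⟨⟨y, hX hy⟩, hy, rfl⟩
  rw [← h1]
  constructor
  · intro h; exact ⟨x, h, rfl⟩
  · rintro ⟨z, hz, hzx⟩
    have : z = x := Subtype.ext hzx
    rwa [← this]

lemma root_main' [FiniteDimensional ℝ F] {Φ : Set F} (h : RSys Φ) (hI : Irr Φ) {P : Set F} (hP : P ⊆ Φ)
    {t : F} (ht : t ∈ AddSubgroup.closure Φ) {e : ℕ} (he : 3 ≤ e)
    (hord : ∀ k : ℤ, k • t ∈ AddSubgroup.closure P ↔ (e : ℤ) ∣ k)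
    (hexp : ∀ s ∈ AddSubgroup.closure Φ, (∃ n : ℤ, n ≠ 0 ∧ n • s ∈ AddSubgroup.closure P) →
      (e : ℤ) • s ∈ AddSubgroup.closure P) :
    ConclA (AddSubgroup.closure Φ) (AddSubgroup.closure P) t e := by
  set W := Submodule.span ℝ Φ with hW
  have hΦW : Φ ⊆ W := Submodule.subset_span
  have hPW : P ⊆ W := hP.trans hΦW
  have cΦ := mem_closure_val W Φ hΦW
  have cP := mem_closure_val W P hPW
  have hcl : ∀ x ∈ AddSubgroup.closure Φ, x ∈ W := by
    intro x hx
    have : AddSubgroup.closure Φ ≤ W.toAddSubgroup := (AddSubgroup.closure_le _).2 hΦW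
    exact this hx
  have h' : RSys (Subtype.val ⁻¹' Φ : Set W) := by
    refine ⟨h.fin.preimage Subtype.val_injective.injOn, ?_, ?_⟩
    · intro a ha h0
      exact h.nz _ ha (by simp [h0])
    · intro a ha b hb
      obtain ⟨n, h1, h2⟩ := h.refl _ ha _ hb
      refine ⟨n, h1, ?_⟩
      simpa using h2
  have hI' : Irr (Subtype.val ⁻¹' Φ : Set W) := by
    obtain ⟨⟨x, hx⟩, h2⟩ := hI
    refine ⟨⟨⟨x, hΦW hx⟩, hx⟩, ?_⟩
    intro S hS hne hS2
    have := h2 (Subtype.val '' S) (by rintro _ ⟨y, hy, rfl⟩; exact hS hy) (hne.image _) (by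
      rintro _ ⟨y, hy, rfl⟩ b hb hbS
      exact hS2 y hy ⟨b, hΦW hb⟩ hb (fun hh => hbS ⟨_, hh, rfl⟩))
    rw [← this, Set.preimage_image_eq _ Subtype.val_injective]
  have hsp : Submodule.span ℝ (Subtype.val ⁻¹' Φ : Set W) = ⊤ := by
    rw [hW]; exact Submodule.span_span_coe_preimage
  obtain ⟨w, hw, p, hpw, hgen, hind, hcase⟩ := root_main h' hsp hI' (P := Subtype.val ⁻¹' P)
    (fun x hx => hP hx) (t := ⟨t, hcl t ht⟩) ((cΦ _).2 ht) he
    (by intro k; rw [cP]; exact hord k)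
    (by
      intro s hs hn
      rw [cP]
      refine hexp s ((cΦ _).1 hs) ?_
      obtain ⟨n, hn0, hn⟩ := hn
      exact ⟨n, hn0, (cP _).1 hn⟩)
  refine ⟨w, (cΦ _).1 hw, p, (cP _).1 hpw, ?_, ?_, hcase⟩
  · intro s hs hn
    obtain ⟨n, hn0, hn⟩ := hn
    obtain ⟨k, l, hkl⟩ := hgen ⟨s, hcl s hs⟩ ((cΦ _).2 hs) ⟨n, hn0, (cP _).2 hn⟩
    exact ⟨k, l, (cP _).1 hkl⟩
  · intro k l hkl
    exact hind k l ((cP _).2 hkl)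

end V
end TS

namespace TS
open scoped InnerProductSpace
section W
variable {ι M N : Type*} [Fintype ι] [AddCommGroup M] [Module ℂ M] [AddCommGroup N] [Module ℂ N]
  (R : RootPairing ι ℂ M N)

noncomputable def psi : M →+ EuclideanSpace ℝ ι where
  toFun v := WithLp.toLp 2 (fun i => (R.coroot' i v).re)
  map_zero' := by ext i; simp
  map_add' x y := by ext i; simp

lemma psi_apply (v : M) (i : ι) : psi R v i = (R.coroot' i v).re := rfl

variable [R.IsCrystallographic]

lemma coroot_int (v : M) (hv : v ∈ AddSubgroup.closure (Set.range R.root)) (i : ι) :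
    ∃ n : ℤ, R.coroot' i v = n := by
  induction hv using AddSubgroup.closure_induction with
  | mem x hx =>
    obtain ⟨j, rfl⟩ := hx
    refine ⟨R.pairingIn ℤ j i, ?_⟩
    have := R.algebraMap_pairingIn ℤ j i
    simpa using this.symm
  | zero => exact ⟨0, by simp⟩
  | add x y _ _ hx hy =>
    obtain ⟨a, ha⟩ := hx
    obtain ⟨b, hb⟩ := hy
    exact ⟨a + b, by rw [map_add, ha, hb]; push_cast; rfl⟩
  | neg x _ hx =>
    obtain ⟨a, ha⟩ := hx
    exact ⟨-a, by rw [map_neg, ha]; push_cast; rfl⟩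

lemma psi_inj [R.IsRootSystem] (v : M) (hv : v ∈ AddSubgroup.closure (Set.range R.root)) (h : psi R v = 0) : v = 0 := by
  rw [R.eq_zero_iff_forall_coroot'_eq_zero]
  intro i
  obtain ⟨n, hn⟩ := coroot_int R v hv i
  have : psi R v i = 0 := by rw [h]; rfl
  rw [psi_apply, hn] at this
  rw [hn]
  have h2 : (n : ℝ) = 0 := by simpa using this
  have h3 : n = 0 := by exact_mod_cast h2
  simp [h3]

lemma psi_root (i j : ι) : psi R (R.root i) j = (R.pairingIn ℤ i j : ℝ) := by
  rw [psi_apply]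
  have := R.algebraMap_pairingIn ℤ i j
  rw [R.root_coroot'_eq_pairing, ← this]
  simp

lemma psi_inner (i j : ι) : ((⟪psi R (R.root i), psi R (R.root j)⟫_ℝ : ℝ) : ℂ) = R.RootForm (R.root i) (R.root j) := by
  rw [R.rootForm_apply_apply, PiLp.inner_apply]
  push_cast
  refine Finset.sum_congr rfl fun k _ => ?_
  rw [psi_root, psi_root]
  have h1 := R.algebraMap_pairingIn ℤ i k
  have h2 := R.algebraMap_pairingIn ℤ j k
  rw [R.root_coroot'_eq_pairing, R.root_coroot'_eq_pairing, ← h1, ← h2]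
  simp [mul_comm]

lemma psi_two (i j : ι) : 2 * ⟪psi R (R.root i), psi R (R.root j)⟫_ℝ =
    (R.pairingIn ℤ i j : ℝ) * ⟪psi R (R.root j), psi R (R.root j)⟫_ℝ := by
  have h := R.rootForm_self_smul_coroot j
  have h2 := congrArg (R.toLinearMap (R.root i)) h
  rw [map_smul, map_nsmul, R.toLinearMap_apply_apply_Polarization, ← psi_inner, ← psi_inner, R.root_coroot_eq_pairing,
    ← R.algebraMap_pairingIn ℤ i j] at h2
  rw [real_inner_comm]
  simp only [smul_eq_mul, nsmul_eq_mul, eq_intCast] at h2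
  have h3 : ((⟪psi R (R.root j), psi R (R.root j)⟫_ℝ * (R.pairingIn ℤ i j : ℝ) : ℝ) : ℂ) =
    ((2 * ⟪psi R (R.root j), psi R (R.root i)⟫_ℝ : ℝ) : ℂ) := by push_cast; exact h2
  have h4 := Complex.ofReal_injective h3
  linarith

lemma psi_pos [R.IsRootSystem] (i : ι) : psi R (R.root i) ≠ 0 := by
  intro h
  exact R.ne_zero i (psi_inj R _ (AddSubgroup.subset_closure ⟨i, rfl⟩) h)

lemma psi_rsys [R.IsRootSystem] : RSys (psi R '' Set.range R.root) := by
  refine ⟨(Set.finite_range _).image _, ?_, ?_⟩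
  · rintro _ ⟨_, ⟨i, rfl⟩, rfl⟩; exact psi_pos R i
  · rintro _ ⟨_, ⟨i, rfl⟩, rfl⟩ _ ⟨_, ⟨j, rfl⟩, rfl⟩
    refine ⟨R.pairingIn ℤ i j, psi_two R i j, ?_⟩
    rw [← map_zsmul, ← map_sub]
    refine ⟨_, ⟨R.reflectionPerm j i, ?_⟩, rfl⟩
    rw [R.root_reflectionPerm, R.reflection_apply_root, ← R.algebraMap_pairingIn ℤ i j]
    simp only [eq_intCast, Int.cast_smul_eq_zsmul]

lemma psi_irr [R.IsRootSystem] [R.IsIrreducible] : Irr (psi R '' Set.range R.root) := by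
  refine ⟨?_, ?_⟩
  · by_contra hne
    rw [Set.not_nonempty_iff_eq_empty, Set.image_eq_empty, Set.range_eq_empty_iff] at hne
    have : Nontrivial M := RootPairing.IsIrreducible.nontrivial R
    obtain ⟨x, hx⟩ := exists_ne (0 : M)
    exact hx ((R.eq_zero_iff_forall_coroot'_eq_zero).2 (fun i => hne.elim i))
  · intro S hS hne hort
    refine Set.Subset.antisymm hS ?_
    by_contra hcon
    rw [Set.not_subset] at hcon
    obtain ⟨_, ⟨_, ⟨j, rfl⟩, rfl⟩, hj⟩ := hcon
    set s : Set ι := {i | psi R (R.root i) ∈ S} with hs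
    have hperp : ∀ j, psi R (R.root j) ∉ S → ∀ i ∈ s, R.pairing i j = 0 ∧ R.pairing j i = 0 := by
      intro j hj i hi
      have h1 := hort _ hi _ ⟨_, ⟨j, rfl⟩, rfl⟩ hj
      have h2 := psi_two R i j
      have h3 := psi_two R j i
      rw [h1] at h2
      rw [real_inner_comm, h1] at h3
      have p1 : ⟪psi R (R.root j), psi R (R.root j)⟫_ℝ ≠ 0 := inner_self_ne_zero.2 (psi_pos R j)
      have p2 : ⟪psi R (R.root i), psi R (R.root i)⟫_ℝ ≠ 0 := inner_self_ne_zero.2 (psi_pos R i)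
      have q1 : (R.pairingIn ℤ i j : ℝ) = 0 := by
        rcases mul_eq_zero.1 (by linarith : (R.pairingIn ℤ i j : ℝ) * ⟪psi R (R.root j), psi R (R.root j)⟫_ℝ = 0) with h | h
        · exact h
        · exact absurd h p1
      have q2 : (R.pairingIn ℤ j i : ℝ) = 0 := by
        rcases mul_eq_zero.1 (by linarith : (R.pairingIn ℤ j i : ℝ) * ⟪psi R (R.root i), psi R (R.root i)⟫_ℝ = 0) with h | h
        · exact h
        · exact absurd h p2
      have q1' : R.pairingIn ℤ i j = 0 := by exact_mod_cast q1
      have q2' : R.pairingIn ℤ j i = 0 := by exact_mod_cast q2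
      rw [← R.algebraMap_pairingIn ℤ i j, ← R.algebraMap_pairingIn ℤ j i, q1', q2']
      simp
    have htop := R.span_root_image_eq_top_of_forall_orthogonal s (by
        obtain ⟨x, hx⟩ := hne
        obtain ⟨_, ⟨i, rfl⟩, rfl⟩ := hS hx
        exact ⟨i, hx⟩) (by
        intro j hj i hi
        have : psi R (R.root j) ∉ S := fun hh => hj (Submodule.subset_span ⟨j, hh, rfl⟩)
        obtain ⟨h1, h2⟩ := hperp j this i hi
        exact ⟨h2, h1⟩)
    have hle : Submodule.span ℂ (R.root '' s) ≤ LinearMap.ker (R.coroot' j) := by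
      rw [Submodule.span_le]
      rintro _ ⟨i, hi, rfl⟩
      simpa using (hperp j hj i hi).1
    rw [htop] at hle
    have h2 : R.root j ∈ LinearMap.ker (R.coroot' j) := hle trivial
    simp at h2

lemma pairing_final [R.IsRootSystem] [R.IsIrreducible] (P : Set M) (hP : P ⊆ Set.range R.root) :
    TorConcl (AddCommGroup.torsion (AddSubgroup.closure (Set.range R.root) ⧸
      (AddSubgroup.closure P).addSubgroupOf (AddSubgroup.closure (Set.range R.root)))) := by
  set Ω := Set.range R.root with hΩ
  have hPc : AddSubgroup.closure P ≤ AddSubgroup.closure Ω := AddSubgroup.closure_mono hP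
  have mΩ : (AddSubgroup.closure Ω).map (psi R) = AddSubgroup.closure (psi R '' Ω) := AddMonoidHom.map_closure _ _
  have mP : (AddSubgroup.closure P).map (psi R) = AddSubgroup.closure (psi R '' P) := AddMonoidHom.map_closure _ _
  have cP : ∀ x ∈ AddSubgroup.closure Ω, (psi R x ∈ AddSubgroup.closure (psi R '' P) ↔ x ∈ AddSubgroup.closure P) := by
    intro x hx
    rw [← mP]
    constructor
    · rintro ⟨y, hy, hyx⟩
      have : y - x = 0 := psi_inj R _ (sub_mem (hPc hy) hx) (by rw [map_sub, hyx, sub_self])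
      rwa [← sub_eq_zero.1 this]
    · intro h; exact ⟨x, h, rfl⟩
  apply group_final
  · exact ⟨(Set.finite_range R.root).toFinset, by simp [hΩ]⟩
  intro t ht e he hord hexp
  obtain ⟨w, hw, p, hpw, hgen, hind, hcase⟩ := root_main' (psi_rsys R) (psi_irr R) (Set.image_mono hP)
    (t := psi R t) (by rw [← mΩ]; exact ⟨t, ht, rfl⟩) he
    (by intro k; rw [← map_zsmul, cP _ (zsmul_mem ht _)]; exact hord k)
    (by
      intro s hs hn
      rw [← mΩ] at hs
      obtain ⟨s, hs, rfl⟩ := hs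
      obtain ⟨n, hn0, hn⟩ := hn
      rw [← map_zsmul, cP _ (zsmul_mem hs _)] at hn
      rw [← map_zsmul, cP _ (zsmul_mem hs _)]
      exact hexp s hs ⟨n, hn0, hn⟩)
  rw [← mΩ] at hw
  obtain ⟨w, hw, rfl⟩ := hw
  refine ⟨w, hw, p, ?_, ?_, ?_, hcase⟩
  · rw [← map_nsmul, cP _ (nsmul_mem hw _)] at hpw
    exact hpw
  · intro s hs hn
    obtain ⟨n, hn0, hn⟩ := hn
    obtain ⟨k, l, hkl⟩ := hgen (psi R s) (by rw [← mΩ]; exact ⟨s, hs, rfl⟩)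
      ⟨n, hn0, by rw [← map_zsmul, cP _ (zsmul_mem hs _)]; exact hn⟩
    rw [← map_zsmul, ← map_zsmul, ← map_sub, ← map_sub, cP _ (sub_mem (sub_mem hs (zsmul_mem ht _)) (zsmul_mem hw _))] at hkl
    exact ⟨k, l, hkl⟩
  · intro k l hkl
    refine hind k l ?_
    rw [← map_zsmul, ← map_zsmul, ← map_add, cP _ (add_mem (zsmul_mem ht _) (zsmul_mem hw _))]
    exact hkl

end W
end TS

/-- If `𝔤` is simple, then `Tor(Γ_𝔨)` is isomorphic to a direct sum of copies of `ℤ/2ℤ`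
(possibly trivial), or to `ℤ/3ℤ`, `ℤ/4ℤ`, `ℤ/5ℤ`, `ℤ/2ℤ ⊕ ℤ/3ℤ`, `ℤ/2ℤ ⊕ ℤ/4ℤ`, or
`ℤ/3ℤ ⊕ ℤ/3ℤ`. -/
theorem torsion_structure
    (L : Type*) [LieRing L] [LieAlgebra ℂ L] [FiniteDimensional ℂ L]
    [LieAlgebra.IsSimple ℂ L]
    (H : LieSubalgebra ℂ L) [H.IsCartanSubalgebra]
    (P : Set (Module.Dual ℂ H))
    (hP : IsClosedSymmetricSubsystem (lieRoots L H) P) :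
    (∃ ι : Type, Nonempty
        (↥(AddCommGroup.torsion (GammaK L H P)) ≃+ DirectSum ι (fun _ => ZMod 2))) ∨
    Nonempty (↥(AddCommGroup.torsion (GammaK L H P)) ≃+ ZMod 3) ∨
    Nonempty (↥(AddCommGroup.torsion (GammaK L H P)) ≃+ ZMod 4) ∨
    Nonempty (↥(AddCommGroup.torsion (GammaK L H P)) ≃+ ZMod 5) ∨
    Nonempty (↥(AddCommGroup.torsion (GammaK L H P)) ≃+ (ZMod 2 × ZMod 3)) ∨
    Nonempty (↥(AddCommGroup.torsion (GammaK L H P)) ≃+ (ZMod 2 × ZMod 4)) ∨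
    Nonempty (↥(AddCommGroup.torsion (GammaK L H P)) ≃+ (ZMod 3 × ZMod 3)) := by
  classical
  haveI : LieAlgebra.IsKilling ℂ L := inferInstance
  have hΩ : lieRoots L H = Set.range (LieAlgebra.IsKilling.rootSystem H).root := by
    ext α
    constructor
    · rintro ⟨h0, hne⟩
      let w : LieModule.Weight ℂ H L := ⟨⇑α, hne⟩
      have hw : w ∈ H.root := by
        simp only [LieSubalgebra.root, Finset.mem_filter, Finset.mem_univ, true_and]
        intro hz
        apply h0
        ext x
        exact congrFun hz x
      refine ⟨⟨w, hw⟩, ?_⟩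
      ext x
      rfl
    · rintro ⟨⟨w, hw⟩, rfl⟩
      refine ⟨(LieAlgebra.IsKilling.rootSystem H).ne_zero _, ?_⟩
      exact w.genWeightSpace_ne_bot
  have key := TS.pairing_final (LieAlgebra.IsKilling.rootSystem H) P (by rw [← hΩ]; exact hP.1)
  rw [← hΩ] at key
  exact key
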